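/- arXiv:dg-ga/9708012 — 2 statements merged into one kernel-verified Lean document; each statement's English description precedes it below -/
import Mathlib

section
/- Let K ⊆ Ω be a compact set with nonempty interior, and suppose there are smooth maps α : Ω → (ℂⁿ →L[ℝ] ℝ) and ω(x)(u,v) := (Dα_x(u))(v) − (Dα_x(v))(u) such that ω(x)(ξ, J(x)ξ) > 0 for every x ∈ K and every ξ ∈ ℂⁿ, ξ ≠ 0 (J is tamed on K by the exact 2-form ω = dα). Then there exists a constant C_K > 0 such that F_Ω(p, v) ≤ C_K · ‖v‖ for every p ∈ K and every v ∈ ℂⁿ, where ‖·‖ is the standard norm on ℂⁿ. -/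
open Metric Set Filter
open scoped ENNReal Topology

noncomputable section

abbrev Cn (n : ℕ) := EuclideanSpace ℂ (Fin n)

def IsAlmostComplexOn (n : ℕ) (Ω : Set (Cn n)) (J : Cn n → (Cn n →L[ℝ] Cn n)) : Prop :=
  ContDiffOn ℝ (⊤ : ℕ∞) J Ω ∧
    ∀ x ∈ Ω, (J x).comp (J x) = -ContinuousLinearMap.id ℝ (Cn n)

def IsJHolomorphicOn (n : ℕ) (Ω : Set (Cn n)) (J : Cn n → (Cn n →L[ℝ] Cn n))
    (R : ℝ) (f : ℂ → Cn n) : Prop :=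
  MapsTo f (ball (0:ℂ) R) Ω ∧
    ∀ z ∈ ball (0:ℂ) R, DifferentiableAt ℝ f z ∧
      ∀ ξ : ℂ, fderiv ℝ f z (Complex.I * ξ) = J (f z) (fderiv ℝ f z ξ)

def kobayashiRoyden (n : ℕ) (Ω : Set (Cn n)) (J : Cn n → (Cn n →L[ℝ] Cn n))
    (p v : Cn n) : ℝ≥0∞ :=
  sInf {c : ℝ≥0∞ | ∃ r : ℝ, 0 < r ∧
    (∃ f : ℂ → Cn n, IsJHolomorphicOn n Ω J 1 f ∧ f 0 = p ∧ fderiv ℝ f 0 1 = r • v) ∧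
    c = ENNReal.ofReal (1 / r)}

/-- The inverse hyperbolic tangent, `arctanh x = ½ log((1 + x)/(1 - x))`. -/
def arctanh (x : ℝ) : ℝ := (1 / 2) * Real.log ((1 + x) / (1 - x))

/-- The Poincaré distance on the unit disc. -/
def poincareDist (z w : ℂ) : ℝ :=
  arctanh (‖z - w‖ / ‖1 - (starRingEnd ℂ) z * w‖)

/-- The Kobayashi pseudodistance `d_Ω(p, q)` of the almost complex manifold `(Ω, J)`. -/
def kobayashiDist (n : ℕ) (Ω : Set (Cn n)) (J : Cn n → (Cn n →L[ℝ] Cn n))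
    (p q : Cn n) : ℝ≥0∞ :=
  sInf {c : ℝ≥0∞ | ∃ m : ℕ, ∃ z w : Fin (m + 1) → ℂ, ∃ f : Fin (m + 1) → ℂ → Cn n,
    (∀ k, z k ∈ ball (0:ℂ) 1 ∧ w k ∈ ball (0:ℂ) 1 ∧ IsJHolomorphicOn n Ω J 1 (f k)) ∧
    f 0 (z 0) = p ∧
    (∀ k : Fin m, f k.castSucc (w k.castSucc) = f k.succ (z k.succ)) ∧
    f (Fin.last m) (w (Fin.last m)) = q ∧
    c = ENNReal.ofReal (∑ k, poincareDist (z k) (w k))}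

/-- `γ` is a piecewise continuously differentiable path in `Ω`, parametrized by `[0,1]`. -/
def IsPiecewiseC1PathIn (n : ℕ) (Ω : Set (Cn n)) (γ : ℝ → Cn n) : Prop :=
  ContinuousOn γ (Icc (0:ℝ) 1) ∧ MapsTo γ (Icc (0:ℝ) 1) Ω ∧
    ∃ (k : ℕ) (t : Fin (k + 1) → ℝ), StrictMono t ∧ t 0 = 0 ∧ t (Fin.last k) = 1 ∧
      ∀ i : Fin k, ContDiffOn ℝ 1 γ (Icc (t i.castSucc) (t i.succ))

/-- The Kobayashi–Royden length `∫₀¹ F_Ω(γ(t), γ′(t)) dt` of a path. -/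
def kobayashiRoydenLength (n : ℕ) (Ω : Set (Cn n)) (J : Cn n → (Cn n →L[ℝ] Cn n))
    (γ : ℝ → Cn n) : ℝ≥0∞ :=
  ∫⁻ t in Icc (0:ℝ) 1, kobayashiRoyden n Ω J (γ t) (deriv γ t)

/-- The integrated Kobayashi–Royden pseudodistance `d̄_Ω(p, q)`. -/
def integratedKRDist (n : ℕ) (Ω : Set (Cn n)) (J : Cn n → (Cn n →L[ℝ] Cn n))
    (p q : Cn n) : ℝ≥0∞ :=
  ⨅ γ : {γ : ℝ → Cn n // IsPiecewiseC1PathIn n Ω γ ∧ γ 0 = p ∧ γ 1 = q},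
    kobayashiRoydenLength n Ω J γ


open MeasureTheory UnitAddTorus

local instance instMSp : MeasureSpace UnitAddCircle := ⟨AddCircle.haarAddCircle⟩

local instance instHaar : Measure.IsAddHaarMeasure (volume : Measure UnitAddCircle) :=
  inferInstanceAs (Measure.IsAddHaarMeasure AddCircle.haarAddCircle)

local instance instProb : IsProbabilityMeasure (volume : Measure UnitAddCircle) :=
  inferInstanceAs (IsProbabilityMeasure AddCircle.haarAddCircle)

abbrev TT := UnitAddTorus (Fin 2)
abbrev ZZ := Fin 2 → ℤ

def sh (i : Fin 2) (s : ℝ) : TT := Pi.single i (s : UnitAddCircle)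

def DD {E : Type*} [AddGroup E] (i : Fin 2) (s : ℝ) (u : TT → E) : TT → E :=
  fun x => u (x + sh i s) - u x

lemma DD_cont {E : Type*} [NormedAddCommGroup E] {u : TT → E} (hu : Continuous u) (i : Fin 2)
    (s : ℝ) : Continuous (DD i s u) := by
  unfold DD; fun_prop

lemma cont_integrable {E : Type*} [NormedAddCommGroup E] {u : TT → E} (hu : Continuous u) :
    Integrable u (volume : Measure TT) := by
  rw [← integrableOn_univ]
  exact hu.continuousOn.integrableOn_compact isCompact_univ

lemma mF_add (k : ZZ) (x y : TT) : mFourier k (x + y) = mFourier k x * mFourier k y := by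
  simp [mFourier, fourier_apply, AddCircle.toCircle_add]
  ring

lemma mF_norm (k : ZZ) (x : TT) : ‖mFourier k x‖ = 1 := by
  simp only [mFourier, fourier_apply, ContinuousMap.coe_mk, norm_prod, Circle.norm_coe,
      Finset.prod_const_one]

lemma mF_sh (k : ZZ) (i : Fin 2) (s : ℝ) :
    mFourier k (sh i s) = Complex.exp (2 * Real.pi * Complex.I * (k i) * s) := by
  have : mFourier k (sh i s) = fourier (k i) (s : UnitAddCircle) := by
    fin_cases i <;> simp [mFourier, sh, fourier_apply]
  rw [this, fourier_coe_apply]; simp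

lemma mF_sh_sub_one (k : ZZ) (i : Fin 2) (s : ℝ) :
    ‖mFourier k (sh i s) - 1‖ ≤ 2 * Real.pi * |(k i : ℝ)| * |s| := by
  rw [mF_sh]
  have := Real.norm_exp_I_mul_ofReal_sub_one_le (x := 2 * Real.pi * k i * s)
  convert this using 2
  · congr 1; push_cast; ring_nf
  · rw [Real.norm_eq_abs, abs_mul, abs_mul, abs_of_pos Real.two_pi_pos]

lemma mF_sh_lim (k : ZZ) (i : Fin 2) :
    Tendsto (fun s : ℝ => ‖mFourier k (sh i s) - 1‖ / |s|) (𝓝[≠] 0) (𝓝 (2 * Real.pi * |(k i : ℝ)|)) := by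
  have h : HasDerivAt (fun s : ℝ => Complex.exp (2 * Real.pi * Complex.I * (k i) * s))
      (2 * Real.pi * Complex.I * (k i)) 0 := by
    have h1 : HasDerivAt (fun s : ℝ => (2 * Real.pi * Complex.I * (k i) * (s : ℂ)))
        (2 * Real.pi * Complex.I * (k i)) 0 := by
      simpa using (Complex.ofRealCLM.hasDerivAt (x := (0:ℝ))).const_mul (2 * Real.pi * Complex.I * (k i))
    have h2 := h1.cexp
    simpa using h2
  rw [hasDerivAt_iff_tendsto_slope] at h
  have h3 := h.norm
  have e : ‖(2 * Real.pi * Complex.I * (k i) : ℂ)‖ = 2 * Real.pi * |(k i : ℝ)| := by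
    simp [abs_of_pos Real.pi_pos]
  rw [e] at h3
  refine h3.congr (fun s => ?_)
  rw [mF_sh, slope_def_module]
  simp [div_eq_inv_mul]

lemma mFc_cont_integrable {n : ℕ} {u : TT → Cn n} (hu : Continuous u) (k : ZZ) :
    Integrable (fun x => mFourier k x • u x) (volume : Measure TT) :=
  cont_integrable (by fun_prop)

lemma mFc_trans {n : ℕ} {u : TT → Cn n} (a : TT) (k : ZZ) :
    mFourierCoeff (fun x => u (x + a)) k = mFourier k a • mFourierCoeff u k := by
  unfold mFourierCoeff
  rw [← integral_add_right_eq_self (μ := (volume : Measure TT)) (fun t => mFourier (-k) t • u t) a,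
    ← integral_smul]
  congr 1; ext1 x
  rw [mF_add, smul_smul]
  congr 1
  have : mFourier k a * mFourier (-k) a = 1 := by
    rw [← mFourier_add]; simp [mFourier_zero]
  linear_combination (-mFourier (-k) x) * this

lemma mFc_DD {n : ℕ} {u : TT → Cn n} (hu : Continuous u) (i : Fin 2) (s : ℝ) (k : ZZ) :
    mFourierCoeff (DD i s u) k = (mFourier k (sh i s) - 1) • mFourierCoeff u k := by
  rw [sub_smul, one_smul, ← mFc_trans]
  unfold mFourierCoeff DD
  rw [← integral_sub (mFc_cont_integrable (by fun_prop) _) (mFc_cont_integrable hu _)]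
  simp_rw [smul_sub]

lemma mFc_sub {n : ℕ} {u v : TT → Cn n} (hu : Continuous u) (hv : Continuous v) (k : ZZ) :
    mFourierCoeff (fun x => u x - v x) k = mFourierCoeff u k - mFourierCoeff v k := by
  unfold mFourierCoeff
  rw [← integral_sub (mFc_cont_integrable hu _) (mFc_cont_integrable hv _)]
  simp_rw [smul_sub]

lemma mFc_coord {n : ℕ} {u : TT → Cn n} (hu : Continuous u) (k : ZZ) (j : Fin n) :
    mFourierCoeff u k j = mFourierCoeff (fun x => u x j) k := by
  unfold mFourierCoeff
  have := (EuclideanSpace.proj (𝕜 := ℂ) j : Cn n →L[ℂ] ℂ).integral_comp_comm (mFc_cont_integrable hu (-k))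
  simpa using this.symm

lemma parseval1 {u : TT → ℂ} (hu : Continuous u) :
    HasSum (fun k : ZZ => ‖mFourierCoeff u k‖ ^ 2) (∫ x, ‖u x‖ ^ 2) := by
  have h := hasSum_sq_mFourierCoeff (ContinuousMap.toLp 2 volume ℂ (⟨u, hu⟩ : C(TT, ℂ)))
  simp only [mFourierCoeff_toLp] at h
  convert! h using 1
  apply integral_congr_ae
  filter_upwards [ContinuousMap.coeFn_toLp (p := 2) (𝕜 := ℂ) (volume : Measure TT) (⟨u, hu⟩ : C(TT, ℂ))] with x hx
  rw [hx]; rfl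

lemma parseval {n : ℕ} {u : TT → Cn n} (hu : Continuous u) :
    HasSum (fun k : ZZ => ‖mFourierCoeff u k‖ ^ 2) (∫ x, ‖u x‖ ^ 2) := by
  have h : ∀ j : Fin n, HasSum (fun k : ZZ => ‖mFourierCoeff u k j‖ ^ 2) (∫ x, ‖u x j‖ ^ 2) := by
    intro j
    simp_rw [mFc_coord hu]
    exact parseval1 (by fun_prop)
  have h2 := hasSum_sum (s := Finset.univ) (fun j _ => h j)
  rw [← integral_finsetSum _ (fun j _ => cont_integrable (by fun_prop))] at h2
  simpa [EuclideanSpace.norm_sq_eq] using h2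

lemma mFc_inv {n : ℕ} {u : TT → Cn n} (hu : Continuous u)
    (hs : Summable (fun k => ‖mFourierCoeff u k‖)) (x : TT) :
    u x = ∑' k, mFourier k x • mFourierCoeff u k := by
  have hs' : Summable (fun k => mFourier k x • mFourierCoeff u k) := by
    apply Summable.of_norm
    simpa [norm_smul, mF_norm] using hs
  ext j
  have h1 := (hs'.hasSum.mapL (EuclideanSpace.proj (𝕜 := ℂ) j : Cn n →L[ℂ] ℂ))
  have hs2 : Summable (mFourierCoeff (⟨fun x => u x j, by fun_prop⟩ : C(TT, ℂ))) := by
    apply Summable.of_norm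
    refine Summable.of_nonneg_of_le (fun _ => norm_nonneg _) (fun k => ?_) hs
    have := mFc_coord hu k j
    change ‖mFourierCoeff (fun x => u x j) k‖ ≤ _
    rw [← this]; exact PiLp.norm_apply_le _ _
  have h2 := hasSum_mFourier_series_apply_of_summable hs2 x
  refine h2.unique ?_
  have h3 : (fun k => mFourierCoeff (⟨fun x => u x j, by fun_prop⟩ : C(TT, ℂ)) k • mFourier k x)
      = fun k => (EuclideanSpace.proj (𝕜 := ℂ) j : Cn n →L[ℂ] ℂ) (mFourier k x • mFourierCoeff u k) := by
    ext1 k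
    change mFourierCoeff (fun x => u x j) k • _ = _
    rw [← mFc_coord hu]
    simp [mul_comm]
  rw [h3]
  exact h1

def ser {n : ℕ} (c : ZZ → Cn n) (x : TT) : Cn n := ∑' k, mFourier k x • c k

section ser
variable {n : ℕ} {c : ZZ → Cn n} (hc : Summable (fun k => ‖c k‖))
include hc

lemma ser_summable (x : TT) : Summable (fun k => mFourier k x • c k) := by
  apply Summable.of_norm
  simpa [norm_smul, mF_norm] using hc

lemma ser_cont : Continuous (ser c) := by
  refine continuous_tsum (fun k => by fun_prop) hc (fun k x => ?_)
  simp [norm_smul, mF_norm]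

lemma ser_norm (x : TT) : ‖ser c x‖ ≤ ∑' k, ‖c k‖ := by
  refine tsum_of_norm_bounded hc.hasSum (fun k => ?_)
  simp [norm_smul, mF_norm]

lemma ser_DD (i : Fin 2) (s : ℝ) : DD i s (ser c) = ser (fun k => (mFourier k (sh i s) - 1) • c k) := by
  ext1 x
  unfold DD ser
  rw [← (ser_summable hc _).tsum_sub (ser_summable hc _)]
  congr 1; ext1 k
  rw [mF_add, smul_smul, ← sub_smul]; congr 1; ring

lemma mFc_ser (k : ZZ) : mFourierCoeff (ser c) k = c k := by
  have hI : ∀ j : ZZ, ∫ x : TT, mFourier (-k) x • mFourier j x • c j = if j = k then c k else 0 := by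
    intro j
    have h1 := (orthonormal_iff_ite.mp (orthonormal_mFourier (d := Fin 2))) k j
    simp only [ContinuousMap.inner_toLp, ← mFourier_neg] at h1
    simp_rw [smul_smul]
    rw [integral_smul_const]
    simp_rw [mul_comm (mFourier (-k) _)]
    rw [h1]
    by_cases h : j = k
    · simp [h]
    · simp [h, Ne.symm h]
  have h2 := hasSum_integral_of_summable_integral_norm (μ := (volume : Measure TT))
    (F := fun (j : ZZ) (x : TT) => mFourier (-k) x • mFourier j x • c j)
    (fun j => cont_integrable (by fun_prop)) (by simpa [norm_smul, mF_norm] using hc)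
  simp_rw [hI] at h2
  have h3 : ∀ x : TT, ∑' j, mFourier (-k) x • mFourier j x • c j = mFourier (-k) x • ser c x := by
    intro x
    exact (ser_summable hc x).tsum_const_smul _
  simp_rw [h3] at h2
  exact h2.unique (by simpa using hasSum_ite_eq k (c k))

lemma ser_L2 : HasSum (fun k => ‖c k‖ ^ 2) (∫ x, ‖ser c x‖ ^ 2) := by
  simpa [mFc_ser hc] using parseval (ser_cont hc)

end ser


def L2 {E : Type*} [NormedAddCommGroup E] (u : TT → E) (M : ℝ) : Prop :=
  ∫ x, ‖u x‖ ^ 2 ≤ M ^ 2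

section L2
variable {E F : Type*} [NormedAddCommGroup E] [NormedAddCommGroup F]

lemma L2.of_le {u : TT → E} {v : TT → F} {a M : ℝ} (hu : Continuous u) (hv : Continuous v)
    (ha : 0 ≤ a) (h : ∀ x, ‖u x‖ ≤ a * ‖v x‖) (hM : L2 v M) : L2 u (a * M) := by
  unfold L2 at *
  calc ∫ x, ‖u x‖ ^ 2 ≤ ∫ x, a ^ 2 * ‖v x‖ ^ 2 := by
        apply integral_mono (cont_integrable (by fun_prop)) (cont_integrable (by fun_prop))
        intro x
        have := h x
        dsimp only
        rw [← mul_pow]; gcongr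
    _ = a ^ 2 * ∫ x, ‖v x‖ ^ 2 := by rw [integral_const_mul]
    _ ≤ a ^ 2 * M ^ 2 := by gcongr
    _ = _ := by ring

lemma L2.of_sup {u : TT → E} {M : ℝ} (hu : Continuous u)
    (h : ∀ x, ‖u x‖ ≤ M) : L2 u M := by
  unfold L2 at *
  calc ∫ x, ‖u x‖ ^ 2 ≤ ∫ x : TT, M ^ 2 := by
        apply integral_mono (cont_integrable (by fun_prop)) (cont_integrable (by fun_prop))
        intro x
        dsimp only
        gcongr; exact h x
    _ = _ := by simp

lemma L2.mono {u : TT → E} {M N : ℝ} (h : L2 u M) (h0 : 0 ≤ M) (hN : M ≤ N) : L2 u N := by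
  unfold L2 at *
  exact h.trans (by gcongr)

lemma L2.four {u : TT → E} {f1 f2 f3 f4 : TT → ℝ} {M : ℝ} (hu : Continuous u)
    (h1 : Continuous f1) (h2 : Continuous f2) (h3 : Continuous f3) (h4 : Continuous f4)
    (h : ∀ x, ‖u x‖ ≤ f1 x + f2 x + f3 x + f4 x)
    (l1 : L2 f1 M) (l2 : L2 f2 M) (l3 : L2 f3 M) (l4 : L2 f4 M) : L2 u (4 * M) := by
  unfold L2 at *
  simp only [Real.norm_eq_abs, sq_abs] at l1 l2 l3 l4
  calc ∫ x, ‖u x‖ ^ 2 ≤ ∫ x, (4 * f1 x ^ 2 + 4 * f2 x ^ 2 + 4 * f3 x ^ 2 + 4 * f4 x ^ 2) := by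
        apply integral_mono (cont_integrable (by fun_prop)) (cont_integrable (by fun_prop))
        intro x
        dsimp only
        have h5 : ‖u x‖ ^ 2 ≤ (f1 x + f2 x + f3 x + f4 x) ^ 2 :=
          pow_le_pow_left₀ (norm_nonneg _) (h x) 2
        nlinarith [sq_nonneg (f1 x - f2 x), sq_nonneg (f1 x - f3 x), sq_nonneg (f1 x - f4 x),
          sq_nonneg (f2 x - f3 x), sq_nonneg (f2 x - f4 x), sq_nonneg (f3 x - f4 x)]
    _ = 4 * (∫ x, f1 x ^ 2) + 4 * (∫ x, f2 x ^ 2) + 4 * (∫ x, f3 x ^ 2) + 4 * (∫ x, f4 x ^ 2) := by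
        rw [integral_add (cont_integrable (by fun_prop)) (cont_integrable (by fun_prop)),
          integral_add (cont_integrable (by fun_prop)) (cont_integrable (by fun_prop)),
          integral_add (cont_integrable (by fun_prop)) (cont_integrable (by fun_prop)),
          integral_const_mul, integral_const_mul, integral_const_mul, integral_const_mul]
    _ ≤ _ := by nlinarith

lemma L2.shift {u : TT → E} {M : ℝ} (h : L2 u M) (a : TT) : L2 (fun x => u (x + a)) M := by
  unfold L2 at *
  rwa [integral_add_right_eq_self (μ := (volume : Measure TT)) (fun t => ‖u t‖ ^ 2) a]

end L2

structure XB {E : Type*} [NormedAddCommGroup E] (u : TT → E) (M : ℝ) : Prop where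
  cont : Continuous u
  sup : ∀ x, ‖u x‖ ≤ M
  d : ∀ i s, L2 (DD i s u) (M * |s|)
  dd : ∀ s t, L2 (DD 0 s (DD 1 t u)) (M * |s| * |t|)

structure YB {E : Type*} [NormedAddCommGroup E] (u : TT → E) (M : ℝ) : Prop where
  cont : Continuous u
  sup : ∀ x, ‖u x‖ ≤ M
  d : ∀ i s x, ‖DD i s u x‖ ≤ M * |s|
  dd : ∀ s t, L2 (DD 0 s (DD 1 t u)) (M * |s| * |t|)

lemma XB.nn {E : Type*} [NormedAddCommGroup E] {u : TT → E} {M : ℝ} (h : XB u M) : 0 ≤ M :=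
  (norm_nonneg _).trans (h.sup 0)
lemma YB.nn {E : Type*} [NormedAddCommGroup E] {u : TT → E} {M : ℝ} (h : YB u M) : 0 ≤ M :=
  (norm_nonneg _).trans (h.sup 0)

lemma XB.mono {E : Type*} [NormedAddCommGroup E] {u : TT → E} {M N : ℝ} (h : XB u M) (hN : M ≤ N) :
    XB u N where
  cont := h.cont
  sup x := (h.sup x).trans hN
  d i s := (h.d i s).mono (by have := h.nn; positivity) (by gcongr)
  dd s t := (h.dd s t).mono (by have := h.nn; positivity) (by gcongr)

lemma YB.mono {E : Type*} [NormedAddCommGroup E] {u : TT → E} {M N : ℝ} (h : YB u M) (hN : M ≤ N) :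
    YB u N where
  cont := h.cont
  sup x := (h.sup x).trans hN
  d i s x := (h.d i s x).trans (by gcongr)
  dd s t := (h.dd s t).mono (by have := h.nn; positivity) (by gcongr)

lemma YB.toXB {E : Type*} [NormedAddCommGroup E] {u : TT → E} {M : ℝ} (h : YB u M) : XB u M where
  cont := h.cont
  sup := h.sup
  d i s := L2.of_sup (DD_cont h.cont i s) (h.d i s)
  dd := h.dd

lemma L2.add {E : Type*} [NormedAddCommGroup E] {u v w : TT → E} {M : ℝ} (hw : Continuous w)
    (hu : Continuous u) (hv : Continuous v) (h : ∀ x, w x = u x + v x)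
    (l1 : L2 u M) (l2 : L2 v M) : L2 w (4 * M) := by
  have hz : L2 (fun _ : TT => (0 : ℝ)) M := by unfold L2; simp; positivity
  refine L2.four (f1 := fun x => ‖u x‖) (f2 := fun x => ‖v x‖) (f3 := fun _ => 0) (f4 := fun _ => 0)
    hw (by fun_prop) (by fun_prop) (by fun_prop) (by fun_prop) ?_ ?_ ?_ hz hz
  · intro x; rw [h]; simpa using norm_add_le _ _
  · unfold L2 at *; simpa using l1
  · unfold L2 at *; simpa using l2

lemma XB.add {E : Type*} [NormedAddCommGroup E] {u v : TT → E} {M N : ℝ} (h : XB u M) (h' : XB v N) :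
    XB (fun x => u x + v x) (4 * (M + N)) := by
  have n1 := h.nn
  have n2 := h'.nn
  have h := h.mono (N := M + N) (by linarith)
  have h' := h'.mono (N := M + N) (by linarith)
  have hc := h.cont
  have hc' := h'.cont
  have hcc : Continuous (fun x => u x + v x) := by fun_prop
  refine ⟨hcc, fun x => ?_, fun i s => ?_, fun s t => ?_⟩
  · have := norm_add_le (u x) (v x)
    have := h.sup x; have := h'.sup x
    linarith
  · rw [mul_assoc]
    exact L2.add (DD_cont hcc _ _) (DD_cont hc i s) (DD_cont hc' i s) (fun x => by simp only [DD]; abel) (h.d i s) (h'.d i s)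
  · rw [mul_assoc, mul_assoc]
    refine L2.add (DD_cont (DD_cont hcc _ _) _ _) (DD_cont (DD_cont hc _ _) _ _) (DD_cont (DD_cont hc' _ _) _ _) (fun x => by simp only [DD]; abel) (?_) (?_)
    · rw [← mul_assoc]; exact (h.dd s t)
    · rw [← mul_assoc]; exact (h'.dd s t)

lemma YB.add {E : Type*} [NormedAddCommGroup E] {u v : TT → E} {M N : ℝ} (h : YB u M) (h' : YB v N) :
    YB (fun x => u x + v x) (4 * (M + N)) := by
  have n1 := h.nn
  have n2 := h'.nn
  have hx := h.toXB.add h'.toXB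
  refine ⟨hx.cont, hx.sup, fun i s x => ?_, hx.dd⟩
  have e : DD i s (fun x => u x + v x) x = DD i s u x + DD i s v x := by simp only [DD]; abel
  rw [e]
  have h1 := norm_add_le (DD i s u x) (DD i s v x)
  have h2 := h.d i s x; have h3 := h'.d i s x
  have : 0 ≤ M * |s| + N * |s| := by positivity
  nlinarith

lemma XB.map {E F : Type*} [NormedAddCommGroup E] [NormedAddCommGroup F] [NormedSpace ℝ E] [NormedSpace ℝ F]
    {u : TT → E} {M : ℝ} (h : XB u M) (T : E →L[ℝ] F) {a : ℝ} (hT : ‖T‖ ≤ a) :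
    XB (fun x => T (u x)) (a * M) := by
  have ha : 0 ≤ a := (norm_nonneg _).trans hT
  have hc := h.cont
  have hcc : Continuous (fun x => T (u x)) := by fun_prop
  have hb : ∀ v : E, ‖T v‖ ≤ a * ‖v‖ := fun v => (T.le_opNorm v).trans (by gcongr)
  refine ⟨hcc, fun x => ?_, fun i s => ?_, fun s t => ?_⟩
  · exact (hb _).trans (mul_le_mul_of_nonneg_left (h.sup x) ha)
  · rw [mul_assoc]
    refine L2.of_le (DD_cont hcc _ _) (DD_cont hc i s) ha (fun x => ?_) (h.d i s)
    simp only [DD, ← map_sub]; exact hb _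
  · rw [mul_assoc, mul_assoc, ← mul_assoc M]
    refine L2.of_le (DD_cont (DD_cont hcc _ _) _ _) (DD_cont (DD_cont hc _ _) _ _) ha (fun x => ?_) (h.dd s t)
    simp only [DD, ← map_sub]; exact hb _

lemma YB.map {E F : Type*} [NormedAddCommGroup E] [NormedAddCommGroup F] [NormedSpace ℝ E] [NormedSpace ℝ F]
    {u : TT → E} {M : ℝ} (h : YB u M) (T : E →L[ℝ] F) {a : ℝ} (hT : ‖T‖ ≤ a) :
    YB (fun x => T (u x)) (a * M) := by
  have ha : 0 ≤ a := (norm_nonneg _).trans hT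
  have hb : ∀ v : E, ‖T v‖ ≤ a * ‖v‖ := fun v => (T.le_opNorm v).trans (by gcongr)
  have hx := h.toXB.map T hT
  refine ⟨hx.cont, hx.sup, fun i s x => ?_, hx.dd⟩
  simp only [DD, ← map_sub]
  refine (hb _).trans ?_
  rw [mul_assoc]
  exact mul_le_mul_of_nonneg_left (h.d i s x) ha

/-! weights -/

def WW (k : ZZ) : ℝ := (1 + |(k 0 : ℝ)|) * (1 + |(k 1 : ℝ)|)

lemma WW_pos (k : ZZ) : 0 < WW k := by unfold WW; positivity

lemma WW_summable : Summable (fun k : ZZ => ((WW k)⁻¹) ^ 2) := by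
  have h1 : Summable (fun k : ℤ => ((1 + |(k : ℝ)|)⁻¹) ^ 2) := by
    have h2 : Summable (fun k : ℤ => 1 / (k : ℝ) ^ 2 + if k = 0 then 1 else 0) :=
      (Real.summable_one_div_int_pow.mpr one_lt_two).add (hasSum_ite_eq (0 : ℤ) (1:ℝ)).summable
    refine Summable.of_nonneg_of_le (fun k => by positivity) (fun k => ?_) h2
    by_cases hk : k = 0
    · simp [hk]
    · simp only [hk, if_false, add_zero]
      rw [← sq_abs (k : ℝ), inv_pow, one_div]
      have : 0 < |(k : ℝ)| := by positivity
      gcongr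
      linarith
  have h3 := h1.mul_of_nonneg h1 (fun _ => by positivity) (fun _ => by positivity)
  rw [← (finTwoArrowEquiv ℤ).summable_iff] at h3
  refine h3.congr (fun k => ?_)
  simp [WW, mul_pow]
  ring

abbrev HH (n : ℕ) := lp (fun _ : ZZ => Cn n) 2

lemma HH_hasSum {n : ℕ} (b : HH n) : HasSum (fun k => ‖b k‖ ^ 2) (‖b‖ ^ 2) := by
  have := lp.hasSum_norm (p := 2) (by norm_num) b
  simpa using this

lemma exists_CW : ∃ C : ℝ, 0 ≤ C ∧ ∀ (n : ℕ) (b : HH n),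
    Summable (fun k => ‖b k‖ / WW k) ∧ ∑' k, ‖b k‖ / WW k ≤ C * ‖b‖ := by
  refine ⟨(∑' k, ((WW k)⁻¹) ^ 2) ^ (1 / (2:ℝ)), by positivity, fun n b => ?_⟩
  have h := Real.summable_and_inner_le_Lp_mul_Lq_tsum_of_nonneg (p := 2) (q := 2)
    (f := fun k => ‖b k‖) (g := fun k => (WW k)⁻¹) Real.HolderConjugate.two_two (fun _ => norm_nonneg _)
    (fun k => (inv_pos.mpr (WW_pos k)).le) (by simpa using (HH_hasSum b).summable)
    (by simpa using WW_summable)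
  refine ⟨by simpa [div_eq_mul_inv] using h.1, ?_⟩
  have h2 := h.2
  simp only [Real.rpow_two] at h2
  rw [(HH_hasSum b).tsum_eq, ← Real.sqrt_eq_rpow (‖b‖ ^ 2), Real.sqrt_sq (norm_nonneg _)] at h2
  simpa [div_eq_mul_inv, mul_comm] using h2

def CW : ℝ := exists_CW.choose
lemma CW_nn : 0 ≤ CW := exists_CW.choose_spec.1
lemma CW_sum {n : ℕ} (b : HH n) : Summable (fun k => ‖b k‖ / WW k) := (exists_CW.choose_spec.2 n b).1
lemma CW_le {n : ℕ} (b : HH n) : ∑' k, ‖b k‖ / WW k ≤ CW * ‖b‖ := (exists_CW.choose_spec.2 n b).2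

def Syn {n : ℕ} (m : ZZ → ℂ) (b : HH n) : TT → Cn n := ser (fun k => (m k / WW k : ℂ) • b k)

lemma Syn_term {n : ℕ} {m : ZZ → ℂ} (hm : ∀ k, ‖m k‖ ≤ 1) (b : HH n) (k : ZZ) :
    ‖(m k / WW k : ℂ) • b k‖ ≤ ‖b k‖ / WW k := by
  have := WW_pos k
  rw [norm_smul, norm_div, Complex.norm_real, Real.norm_of_nonneg this.le, div_mul_eq_mul_div]
  gcongr
  exact mul_le_of_le_one_left (norm_nonneg _) (hm k)

lemma Syn_sum {n : ℕ} {m : ZZ → ℂ} (hm : ∀ k, ‖m k‖ ≤ 1) (b : HH n) :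
    Summable (fun k => ‖(m k / WW k : ℂ) • b k‖) :=
  Summable.of_nonneg_of_le (fun _ => norm_nonneg _) (Syn_term hm b) (CW_sum b)

lemma WW_ge0 (k : ZZ) : 1 ≤ WW k := by
  unfold WW; nlinarith [abs_nonneg (k 0 : ℝ), abs_nonneg (k 1 : ℝ), mul_nonneg (abs_nonneg (k 0 : ℝ)) (abs_nonneg (k 1 : ℝ))]
lemma WW_ge1 (k : ZZ) (i : Fin 2) : |(k i : ℝ)| ≤ WW k := by
  unfold WW
  have := mul_nonneg (abs_nonneg (k 0 : ℝ)) (abs_nonneg (k 1 : ℝ))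
  have := abs_nonneg (k 0 : ℝ)
  have := abs_nonneg (k 1 : ℝ)
  fin_cases i <;> simp <;> nlinarith
lemma WW_ge2 (k : ZZ) : |(k 0 : ℝ)| * |(k 1 : ℝ)| ≤ WW k := by
  unfold WW; nlinarith [abs_nonneg (k 0 : ℝ), abs_nonneg (k 1 : ℝ), mul_nonneg (abs_nonneg (k 0 : ℝ)) (abs_nonneg (k 1 : ℝ))]

lemma ser_L2_le {n : ℕ} {c : ZZ → Cn n} (hc : Summable (fun k => ‖c k‖)) (b : HH n) {a : ℝ}
    (h : ∀ k, ‖c k‖ ≤ a * ‖b k‖) : L2 (ser c) (a * ‖b‖) := by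
  unfold L2
  rw [mul_pow]
  refine hasSum_le (fun k => ?_) (ser_L2 hc) ((HH_hasSum b).mul_left (a ^ 2))
  rw [← mul_pow]; exact pow_le_pow_left₀ (norm_nonneg _) (h k) 2

def CX : ℝ := CW + 2 * Real.pi * CW + 2 * Real.pi + (2 * Real.pi) ^ 2

lemma mul_summable {n : ℕ} {c : ZZ → Cn n} (hc : Summable (fun k => ‖c k‖)) (i : Fin 2) (s : ℝ) :
    Summable (fun k => ‖(mFourier k (sh i s) - 1) • c k‖) := by
  refine Summable.of_nonneg_of_le (fun _ => norm_nonneg _) (fun k => ?_) (hc.mul_left 2)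
  rw [norm_smul]; gcongr
  refine (norm_sub_le _ _).trans ?_
  rw [mF_norm]; norm_num

lemma Syn_XB {n : ℕ} {m : ZZ → ℂ} (hm : ∀ k, ‖m k‖ ≤ 1) (b : HH n) : XB (Syn m b) (CX * ‖b‖) := by
  have hs := Syn_sum hm b
  have hp := Real.pi_pos
  have hC := CW_nn
  have hnb := norm_nonneg b
  refine ⟨ser_cont hs, fun x => ?_, fun i s => ?_, fun s t => ?_⟩
  · refine (ser_norm hs x).trans ?_
    refine (hs.tsum_le_tsum (Syn_term hm b) (CW_sum b)).trans ((CW_le b).trans ?_)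
    gcongr; unfold CX
    have : 0 ≤ 2 * Real.pi * CW + 2 * Real.pi + (2 * Real.pi) ^ 2 := by positivity
    linarith
  · unfold Syn
    rw [ser_DD hs]
    have : L2 (ser (fun k => (mFourier k (sh i s) - 1) • (m k / WW k : ℂ) • b k)) (2 * Real.pi * |s| * ‖b‖) := by
      refine ser_L2_le (mul_summable hs _ _) b (fun k => ?_)
      rw [norm_smul]
      calc _ ≤ (2 * Real.pi * |(k i : ℝ)| * |s|) * (‖b k‖ / WW k) :=
            mul_le_mul (mF_sh_sub_one k i s) (Syn_term hm b k) (norm_nonneg _) (by positivity)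
        _ = 2 * Real.pi * |s| * ‖b k‖ * (|(k i : ℝ)| / WW k) := by ring
        _ ≤ 2 * Real.pi * |s| * ‖b k‖ * 1 := by
            gcongr; rw [div_le_one (WW_pos k)]; exact WW_ge1 k i
        _ = _ := by ring
    refine this.mono (by positivity) ?_
    rw [mul_right_comm]; gcongr; unfold CX
    have : 0 ≤ CW + 2 * Real.pi * CW + (2 * Real.pi) ^ 2 := by positivity
    linarith
  · unfold Syn
    rw [ser_DD hs, ser_DD (mul_summable hs _ _)]
    have : L2 (ser (fun k => (mFourier k (sh 0 s) - 1) • (mFourier k (sh 1 t) - 1) • (m k / WW k : ℂ) • b k))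
        ((2 * Real.pi) ^ 2 * |s| * |t| * ‖b‖) := by
      refine ser_L2_le (mul_summable (mul_summable hs _ _) _ _) b (fun k => ?_)
      rw [norm_smul, norm_smul]
      calc _ ≤ (2 * Real.pi * |(k 0 : ℝ)| * |s|) * ((2 * Real.pi * |(k 1 : ℝ)| * |t|) * (‖b k‖ / WW k)) := by
            refine mul_le_mul (mF_sh_sub_one k 0 s) ?_ (by positivity) (by positivity)
            exact mul_le_mul (mF_sh_sub_one k 1 t) (Syn_term hm b k) (norm_nonneg _) (by positivity)
        _ = (2 * Real.pi) ^ 2 * |s| * |t| * ‖b k‖ * (|(k 0 : ℝ)| * |(k 1 : ℝ)| / WW k) := by ring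
        _ ≤ (2 * Real.pi) ^ 2 * |s| * |t| * ‖b k‖ * 1 := by
            gcongr; rw [div_le_one (WW_pos k)]; exact WW_ge2 k
        _ = _ := by ring
    refine this.mono (by positivity) ?_
    have e : (2 * Real.pi) ^ 2 * |s| * |t| * ‖b‖ = (2 * Real.pi) ^ 2 * ‖b‖ * |s| * |t| := by ring
    rw [e]; gcongr; unfold CX
    have : 0 ≤ CW + 2 * Real.pi * CW + 2 * Real.pi := by positivity
    linarith

lemma Syn_YB {n : ℕ} {m : ZZ → ℂ} (hm : ∀ k, ‖m k‖ ≤ 1) (hk : ∀ k i, ‖m k‖ * |((k : ZZ) i : ℝ)| ≤ 1)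
    (b : HH n) : YB (Syn m b) (CX * ‖b‖) := by
  have hs := Syn_sum hm b
  have hp := Real.pi_pos
  have hC := CW_nn
  have hnb := norm_nonneg b
  have hX := Syn_XB hm b
  refine ⟨hX.cont, hX.sup, fun i s x => ?_, hX.dd⟩
  unfold Syn
  rw [ser_DD hs]
  refine (ser_norm (mul_summable hs _ _) x).trans ?_
  have : ∀ k, ‖(mFourier k (sh i s) - 1) • (m k / WW k : ℂ) • b k‖ ≤ 2 * Real.pi * |s| * (‖b k‖ / WW k) := by
    intro k
    have hW := WW_pos k
    rw [norm_smul, norm_smul, norm_div, Complex.norm_real, Real.norm_of_nonneg hW.le]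
    calc _ ≤ (2 * Real.pi * |(k i : ℝ)| * |s|) * (‖m k‖ / WW k * ‖b k‖) :=
            mul_le_mul_of_nonneg_right (mF_sh_sub_one k i s) (by positivity)
      _ = 2 * Real.pi * |s| * (‖b k‖ / WW k) * (‖m k‖ * |(k i : ℝ)|) := by ring
      _ ≤ 2 * Real.pi * |s| * (‖b k‖ / WW k) * 1 := by
          gcongr; exact hk k i
      _ = _ := by ring
  refine ((mul_summable hs _ _).tsum_le_tsum this ((CW_sum b).mul_left _)).trans ?_
  rw [tsum_mul_left]
  calc _ ≤ 2 * Real.pi * |s| * (CW * ‖b‖) := by gcongr; exact CW_le b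
    _ = (2 * Real.pi * CW) * ‖b‖ * |s| := by ring
    _ ≤ _ := by
      gcongr; unfold CX
      have : 0 ≤ CW + 2 * Real.pi + (2 * Real.pi) ^ 2 := by positivity
      linarith


lemma bessel {n : ℕ} {u : TT → Cn n} (hu : Continuous u) {M : ℝ} (h : L2 u M) (F : Finset ZZ) :
    ∑ k ∈ F, ‖mFourierCoeff u k‖ ^ 2 ≤ M ^ 2 :=
  (sum_le_hasSum F (fun _ _ => by positivity) (parseval hu)).trans h

lemma XB.c1 {n : ℕ} {u : TT → Cn n} {M : ℝ} (h : XB u M) (i : Fin 2) (F : Finset ZZ) :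
    ∑ k ∈ F, |(k i : ℝ)| ^ 2 * ‖mFourierCoeff u k‖ ^ 2 ≤ M ^ 2 := by
  have hl : Tendsto (fun s : ℝ => ∑ k ∈ F, (‖mFourier k (sh i s) - 1‖ / |s|) ^ 2 * ‖mFourierCoeff u k‖ ^ 2)
      (𝓝[≠] 0) (𝓝 (∑ k ∈ F, (2 * Real.pi * |(k i : ℝ)|) ^ 2 * ‖mFourierCoeff u k‖ ^ 2)) :=
    tendsto_finsetSum _ (fun k _ => ((mF_sh_lim k i).pow 2).mul_const _)
  have h2 : ∑ k ∈ F, (2 * Real.pi * |(k i : ℝ)|) ^ 2 * ‖mFourierCoeff u k‖ ^ 2 ≤ M ^ 2 := by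
    refine le_of_tendsto hl ?_
    filter_upwards [self_mem_nhdsWithin] with s hs
    have hs : 0 < |s| := abs_pos.mpr hs
    have h3 := bessel (DD_cont h.cont i s) (h.d i s) F
    simp_rw [mFc_DD h.cont, norm_smul] at h3
    have h4 : ∑ k ∈ F, (‖mFourier k (sh i s) - 1‖ / |s|) ^ 2 * ‖mFourierCoeff u k‖ ^ 2
      = (∑ k ∈ F, (‖mFourier k (sh i s) - 1‖ * ‖mFourierCoeff u k‖) ^ 2) / |s| ^ 2 := by
      rw [Finset.sum_div]; congr 1; ext k; field_simp
    rw [h4, div_le_iff₀ (by positivity), ← mul_pow]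
    exact h3
  refine le_trans (Finset.sum_le_sum fun k _ => ?_) h2
  gcongr
  nlinarith [abs_nonneg (k i : ℝ), Real.pi_gt_three]

lemma XB.c2 {n : ℕ} {u : TT → Cn n} {M : ℝ} (h : XB u M) (F : Finset ZZ) :
    ∑ k ∈ F, (|(k 0 : ℝ)| * |(k 1 : ℝ)|) ^ 2 * ‖mFourierCoeff u k‖ ^ 2 ≤ M ^ 2 := by
  have hl : Tendsto (fun s : ℝ => ∑ k ∈ F, (‖mFourier k (sh 0 s) - 1‖ / |s| * (‖mFourier k (sh 1 s) - 1‖ / |s|)) ^ 2 * ‖mFourierCoeff u k‖ ^ 2)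
      (𝓝[≠] 0) (𝓝 (∑ k ∈ F, (2 * Real.pi * |(k 0 : ℝ)| * (2 * Real.pi * |(k 1 : ℝ)|)) ^ 2 * ‖mFourierCoeff u k‖ ^ 2)) :=
    tendsto_finsetSum _ (fun k _ => (((mF_sh_lim k 0).mul (mF_sh_lim k 1)).pow 2).mul_const _)
  have h2 : ∑ k ∈ F, (2 * Real.pi * |(k 0 : ℝ)| * (2 * Real.pi * |(k 1 : ℝ)|)) ^ 2 * ‖mFourierCoeff u k‖ ^ 2 ≤ M ^ 2 := by
    refine le_of_tendsto hl ?_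
    filter_upwards [self_mem_nhdsWithin] with s hs
    have hs : 0 < |s| := abs_pos.mpr hs
    have h3 := bessel (DD_cont (DD_cont h.cont 1 s) 0 s) (h.dd s s) F
    simp_rw [mFc_DD (DD_cont h.cont 1 s), mFc_DD h.cont, norm_smul] at h3
    have h4 : ∑ k ∈ F, (‖mFourier k (sh 0 s) - 1‖ / |s| * (‖mFourier k (sh 1 s) - 1‖ / |s|)) ^ 2 * ‖mFourierCoeff u k‖ ^ 2
      = (∑ k ∈ F, (‖mFourier k (sh 0 s) - 1‖ * (‖mFourier k (sh 1 s) - 1‖ * ‖mFourierCoeff u k‖)) ^ 2) / (|s| * |s|) ^ 2 := by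
      rw [Finset.sum_div]; congr 1; ext k; field_simp
    rw [h4, div_le_iff₀ (by positivity), ← mul_pow, ← mul_assoc]
    exact h3
  refine le_trans (Finset.sum_le_sum fun k _ => ?_) h2
  gcongr <;>
  nlinarith [abs_nonneg (k 0 : ℝ), abs_nonneg (k 1 : ℝ), Real.pi_gt_three]

lemma XB.coef {n : ℕ} {u : TT → Cn n} {M : ℝ} (h : XB u M) (F : Finset ZZ) :
    ∑ k ∈ F, ‖(WW k : ℂ) • mFourierCoeff u k‖ ^ 2 ≤ (4 * M) ^ 2 := by
  have h0 := bessel h.cont (L2.of_sup h.cont h.sup) F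
  have h1 := h.c1 0 F
  have h2 := h.c1 1 F
  have h3 := h.c2 F
  have : ∑ k ∈ F, ‖(WW k : ℂ) • mFourierCoeff u k‖ ^ 2 ≤
    ∑ k ∈ F, 4 * (‖mFourierCoeff u k‖ ^ 2 + |(k 0 : ℝ)| ^ 2 * ‖mFourierCoeff u k‖ ^ 2 +
      |(k 1 : ℝ)| ^ 2 * ‖mFourierCoeff u k‖ ^ 2 +
      (|(k 0 : ℝ)| * |(k 1 : ℝ)|) ^ 2 * ‖mFourierCoeff u k‖ ^ 2) := by
    refine Finset.sum_le_sum fun k _ => ?_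
    rw [norm_smul, Complex.norm_real, Real.norm_of_nonneg (WW_pos k).le, mul_pow]
    have : WW k ^ 2 ≤ 4 * (1 + |(k 0 : ℝ)| ^ 2 + |(k 1 : ℝ)| ^ 2 + (|(k 0 : ℝ)| * |(k 1 : ℝ)|) ^ 2) := by
      unfold WW
      generalize |(k 0 : ℝ)| = a
      generalize |(k 1 : ℝ)| = b
      have e1 : (1 + a) ^ 2 ≤ 2 * (1 + a ^ 2) := by nlinarith [sq_nonneg (1 - a)]
      have e2 : (1 + b) ^ 2 ≤ 2 * (1 + b ^ 2) := by nlinarith [sq_nonneg (1 - b)]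
      calc ((1 + a) * (1 + b)) ^ 2 = (1 + a) ^ 2 * (1 + b) ^ 2 := by ring
        _ ≤ (2 * (1 + a ^ 2)) * (2 * (1 + b ^ 2)) := by gcongr
        _ = _ := by ring
    nlinarith [mul_le_mul_of_nonneg_right this (sq_nonneg ‖mFourierCoeff u k‖)]
  refine this.trans ?_
  rw [← Finset.mul_sum, Finset.sum_add_distrib, Finset.sum_add_distrib, Finset.sum_add_distrib]
  nlinarith

lemma XB.mem {n : ℕ} {u : TT → Cn n} {M : ℝ} (h : XB u M) :
    Memℓp (fun k => (WW k : ℂ) • mFourierCoeff u k) 2 := by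
  refine memℓp_gen' (C := (4 * M) ^ 2) (fun F => ?_)
  simpa using h.coef F

def XB.toHH {n : ℕ} {u : TT → Cn n} {M : ℝ} (h : XB u M) : HH n := ⟨_, h.mem⟩

lemma XB.toHH_apply {n : ℕ} {u : TT → Cn n} {M : ℝ} (h : XB u M) (k : ZZ) :
    h.toHH k = (WW k : ℂ) • mFourierCoeff u k := rfl

lemma XB.norm_toHH {n : ℕ} {u : TT → Cn n} {M : ℝ} (h : XB u M) : ‖h.toHH‖ ≤ 4 * M := by
  have := h.nn
  refine lp.norm_le_of_forall_sum_le (by norm_num) (by positivity) (fun F => ?_)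
  simp only [XB.toHH_apply]
  simpa using h.coef F

lemma XB.norm_toHH_sub {n : ℕ} {u v : TT → Cn n} {M N L : ℝ} (h : XB u M) (h' : XB v N)
    (hd : XB (fun x => u x - v x) L) : ‖h.toHH - h'.toHH‖ ≤ 4 * L := by
  have : h.toHH - h'.toHH = hd.toHH := by
    ext1
    funext k
    rw [lp.coeFn_sub, Pi.sub_apply, XB.toHH_apply, XB.toHH_apply, XB.toHH_apply,
      mFc_sub h.cont h'.cont, smul_sub]
  rw [this]; exact hd.norm_toHH

/-! finite-dimensional difference lemmas -/

section fd
variable {E F : Type*} [NormedAddCommGroup E] [NormedSpace ℝ E] [NormedAddCommGroup F] [NormedSpace ℝ F]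

/-- interpolation -/
def lint (x d : E) (τ : ℝ) : E := x + τ • d

lemma lint_deriv (x d : E) (τ : ℝ) : HasDerivAt (lint x d) d τ := by
  unfold lint
  simpa using ((hasDerivAt_id τ).smul_const d).const_add x

lemma lint_mem {R : ℝ} {x y : E} (hx : x ∈ closedBall (0:E) R) (hy : y ∈ closedBall (0:E) R) {τ : ℝ}
    (hτ : τ ∈ Icc (0:ℝ) 1) : lint x (y - x) τ ∈ closedBall (0:E) R := by
  have := (convex_closedBall (0:E) R).add_smul_sub_mem hx hy hτ
  exact this

lemma lint_diff {x x' y y' : E} {r : ℝ} (h0 : ‖x - y‖ ≤ r) (h1 : ‖x' - y'‖ ≤ r) {τ : ℝ}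
    (hτ : τ ∈ Icc (0:ℝ) 1) : ‖lint x (x' - x) τ - lint y (y' - y) τ‖ ≤ r := by
  have : lint x (x' - x) τ - lint y (y' - y) τ = lint (x - y) ((x' - y') - (x - y)) τ := by
    unfold lint; module
  rw [this]
  have := lint_mem (R := r) (x := x - y) (y := x' - y') (by simpa using h0) (by simpa using h1) hτ
  simpa using this

lemma mvt {φ φ' : ℝ → F} {C : ℝ} (h : ∀ τ ∈ Icc (0:ℝ) 1, HasDerivAt φ (φ' τ) τ)
    (hb : ∀ τ ∈ Icc (0:ℝ) 1, ‖φ' τ‖ ≤ C) : ‖φ 1 - φ 0‖ ≤ C := by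
  have := norm_image_sub_le_of_norm_deriv_le_segment' (f := φ) (f' := φ') (a := 0) (b := 1) (C := C)
    (fun x hx => (h x hx).hasDerivWithinAt) (fun x hx => hb x (Ico_subset_Icc_self hx)) 1 (by simp)
  simpa using this

structure GB (B : E → F) (B' : E → E →L[ℝ] F) (R ε : ℝ) : Prop where
  der : ∀ x ∈ closedBall (0:E) R, HasFDerivAt B (B' x) x
  bd : ∀ x ∈ closedBall (0:E) R, ‖B' x‖ ≤ ε
  lip : ∀ x ∈ closedBall (0:E) R, ∀ y ∈ closedBall (0:E) R, ‖B' x - B' y‖ ≤ ε * ‖x - y‖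

variable {B : E → F} {B' : E → E →L[ℝ] F} {R ε : ℝ}

lemma GB.der_lint (h : GB B B' R ε) {x y : E} (hx : x ∈ closedBall (0:E) R)
    (hy : y ∈ closedBall (0:E) R) {τ : ℝ} (hτ : τ ∈ Icc (0:ℝ) 1) :
    HasDerivAt (fun τ => B (lint x (y - x) τ)) (B' (lint x (y - x) τ) (y - x)) τ :=
  (h.der _ (lint_mem hx hy hτ)).comp_hasDerivAt τ (lint_deriv x (y - x) τ)

lemma GB.two (h : GB B B' R ε) {x y : E} (hx : x ∈ closedBall (0:E) R)
    (hy : y ∈ closedBall (0:E) R) : ‖B y - B x‖ ≤ ε * ‖y - x‖ := by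
  have := mvt (fun τ hτ => h.der_lint hx hy hτ) (C := ε * ‖y - x‖) (fun τ hτ =>
    ((B' _).le_opNorm _).trans (by gcongr; exact h.bd _ (lint_mem hx hy hτ)))
  simpa [lint] using this

/-- four point estimate -/
lemma GB.fourpt (h : GB B B' R ε) {x x' y y' : E} (hx : x ∈ closedBall (0:E) R)
    (hx' : x' ∈ closedBall (0:E) R) (hy : y ∈ closedBall (0:E) R) (hy' : y' ∈ closedBall (0:E) R)
    {r : ℝ} (h0 : ‖x - y‖ ≤ r) (h1 : ‖x' - y'‖ ≤ r) :
    ‖(B x' - B x) - (B y' - B y)‖ ≤ ε * ‖(x' - x) - (y' - y)‖ + ε * r * ‖y' - y‖ := by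
  have := mvt (fun τ hτ => (h.der_lint hx hx' hτ).sub (h.der_lint hy hy' hτ))
    (C := ε * ‖(x' - x) - (y' - y)‖ + ε * r * ‖y' - y‖) (fun τ hτ => by
      have m1 := lint_mem hx hx' hτ
      have m2 := lint_mem hy hy' hτ
      have e : B' (lint x (x' - x) τ) (x' - x) - B' (lint y (y' - y) τ) (y' - y) =
        B' (lint x (x' - x) τ) ((x' - x) - (y' - y)) +
          (B' (lint x (x' - x) τ) - B' (lint y (y' - y) τ)) (y' - y) := by
        simp only [map_sub, sub_apply]; abel
      rw [e]
      refine (norm_add_le _ _).trans (add_le_add ?_ ?_)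
      · exact ((B' _).le_opNorm _).trans (by gcongr; exact h.bd _ m1)
      · refine (ContinuousLinearMap.le_opNorm _ _).trans ?_
        gcongr
        refine (h.lip _ m1 _ m2).trans ?_
        have : 0 ≤ ε := (norm_nonneg _).trans (h.bd _ m1)
        gcongr
        exact lint_diff h0 h1 hτ)
  refine le_trans (le_of_eq ?_) this
  congr 1
  simp [lint]
  abel

/-- eight point estimate -/
lemma GB.eight {B'' : E → E →L[ℝ] (E →L[ℝ] F)} (h : GB B B' R ε) (h' : GB B' B'' R ε)
    {x00 x01 x10 x11 y00 y01 y10 y11 : E}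
    (hx00 : x00 ∈ closedBall (0:E) R) (hx01 : x01 ∈ closedBall (0:E) R)
    (hx10 : x10 ∈ closedBall (0:E) R) (hx11 : x11 ∈ closedBall (0:E) R)
    (hy00 : y00 ∈ closedBall (0:E) R) (hy01 : y01 ∈ closedBall (0:E) R)
    (hy10 : y10 ∈ closedBall (0:E) R) (hy11 : y11 ∈ closedBall (0:E) R)
    {s t q p d ds dt dq : ℝ}
    (h1 : ‖x10 - x00‖ ≤ s) (h2 : ‖x11 - x01‖ ≤ s) (h3 : ‖y10 - y00‖ ≤ s) (h4 : ‖y11 - y01‖ ≤ s)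
    (h5 : ‖x01 - x00‖ ≤ t) (h6 : ‖y01 - y00‖ ≤ t)
    (h7 : ‖(x11 - x01) - (x10 - x00)‖ ≤ q) (h8 : ‖(y11 - y01) - (y10 - y00)‖ ≤ p)
    (k1 : ‖y11 - x11‖ ≤ d) (k2 : ‖(y11 - x11) - (y10 - x10)‖ ≤ dt)
    (k3 : ‖(y11 - x11) - (y01 - x01)‖ ≤ ds)
    (k4 : ‖((y11 - x11) - (y01 - x01)) - ((y10 - x10) - (y00 - x00))‖ ≤ dq) :
    ‖((B y11 - B x11) - (B y01 - B x01)) - ((B y10 - B x10) - (B y00 - B x00))‖ ≤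
      ε * ((q + p + s * t) * d + s * dt + t * ds + dq) := by
  have hε : 0 ≤ ε := (norm_nonneg _).trans (h.bd _ hx00)
  have hs : 0 ≤ s := (norm_nonneg _).trans h1
  have hd : 0 ≤ d := (norm_nonneg _).trans k1
  have ht : 0 ≤ t := (norm_nonneg _).trans h5
  have hq : 0 ≤ q := (norm_nonneg _).trans h7
  have hp : 0 ≤ p := (norm_nonneg _).trans h8
  have := mvt (fun τ hτ => ((h.der_lint hx11 hy11 hτ).sub (h.der_lint hx01 hy01 hτ)).sub
      ((h.der_lint hx10 hy10 hτ).sub (h.der_lint hx00 hy00 hτ)))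
    (C := ε * ((q + p + s * t) * d + s * dt + t * ds + dq)) (fun τ hτ => by
      have m11 := lint_mem hx11 hy11 hτ
      have m01 := lint_mem hx01 hy01 hτ
      have m10 := lint_mem hx10 hy10 hτ
      have m00 := lint_mem hx00 hy00 hτ
      have s1 := lint_diff h1 h3 hτ
      have s2 := lint_diff h2 h4 hτ
      have t1 := lint_diff h5 h6 hτ
      have q1 : ‖(lint x11 (y11 - x11) τ - lint x01 (y01 - x01) τ) -
          (lint x10 (y10 - x10) τ - lint x00 (y00 - x00) τ)‖ ≤ q + p := by
        have e : (lint x11 (y11 - x11) τ - lint x01 (y01 - x01) τ) -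
          (lint x10 (y10 - x10) τ - lint x00 (y00 - x00) τ) =
          lint ((x11 - x01) - (x10 - x00)) (((y11 - y01) - (y10 - y00)) - ((x11 - x01) - (x10 - x00))) τ := by
          unfold lint; module
        rw [e]
        have := lint_mem (R := q + p) (x := (x11 - x01) - (x10 - x00)) (y := (y11 - y01) - (y10 - y00))
          (by simp only [mem_closedBall_zero_iff]; linarith) (by simp only [mem_closedBall_zero_iff]; linarith) hτ
        simpa using this
      generalize lint x11 (y11 - x11) τ = a11 at *
      generalize lint x01 (y01 - x01) τ = a01 at *
      generalize lint x10 (y10 - x10) τ = a10 at *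
      generalize lint x00 (y00 - x00) τ = a00 at *
      generalize y11 - x11 = d11 at *
      generalize y10 - x10 = d10 at *
      generalize y01 - x01 = d01 at *
      generalize y00 - x00 = d00 at *
      have e : B' a11 d11 - B' a01 d01 - (B' a10 d10 - B' a00 d00) =
        ((B' a11 - B' a10) - (B' a01 - B' a00)) d11 + (B' a10 - B' a00) (d11 - d10)
        + (B' a01 - B' a00) (d11 - d01) + B' a00 ((d11 - d01) - (d10 - d00)) := by
        simp only [map_sub, sub_apply]; abel
      rw [e]
      have n1 : ‖(B' a11 - B' a10) - (B' a01 - B' a00)‖ ≤ ε * (q + p) + ε * s * t := by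
        refine (h'.fourpt m10 m11 m00 m01 (r := s) s1 s2).trans ?_
        gcongr
        refine le_trans (le_of_eq ?_) q1
        congr 1; abel
      have n2 : ‖B' a10 - B' a00‖ ≤ ε * s := (h.lip _ m10 _ m00).trans (by gcongr)
      have n3 : ‖B' a01 - B' a00‖ ≤ ε * t := (h.lip _ m01 _ m00).trans (by gcongr)
      have n4 := h.bd _ m00
      have r1 : ‖((B' a11 - B' a10) - (B' a01 - B' a00)) d11‖ ≤ (ε * (q + p) + ε * s * t) * d :=
        (ContinuousLinearMap.le_opNorm _ _).trans (by gcongr)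
      have r2 : ‖(B' a10 - B' a00) (d11 - d10)‖ ≤ ε * s * dt :=
        (ContinuousLinearMap.le_opNorm _ _).trans (by gcongr)
      have r3 : ‖(B' a01 - B' a00) (d11 - d01)‖ ≤ ε * t * ds :=
        (ContinuousLinearMap.le_opNorm _ _).trans (by gcongr)
      have r4 : ‖B' a00 ((d11 - d01) - (d10 - d00))‖ ≤ ε * dq :=
        (ContinuousLinearMap.le_opNorm _ _).trans (by gcongr)
      refine (norm_add_le _ _).trans ?_
      refine (add_le_add_left (norm_add_le _ _) _).trans ?_
      refine (add_le_add_left (add_le_add_left (norm_add_le _ _) _) _).trans ?_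
      linarith)
  refine le_trans (le_of_eq ?_) this
  congr 1
  simp [lint]
  abel

end fd


lemma L2.normed {E : Type*} [NormedAddCommGroup E] {u : TT → E} {M c : ℝ} (h : L2 u M) (N : ℝ)
    (hu : Continuous u) (hM : 0 ≤ M) (hc : 0 ≤ c) (hN : c * M ≤ N) : L2 (fun x => c * ‖u x‖) N := by
  refine (L2.of_le (a := c) (by fun_prop) hu hc (fun x => ?_) h).mono (by positivity) hN
  rw [norm_mul, norm_norm, Real.norm_of_nonneg hc]

lemma DDDD {E : Type*} [AddCommGroup E] (u : TT → E) (s t : ℝ) (x : TT) :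
    DD 0 s (DD 1 t u) x = (u (x + sh 0 s + sh 1 t) - u (x + sh 1 t)) - (u (x + sh 0 s) - u x) := by
  simp only [DD]; abel

section comp
variable {E F : Type*} [NormedAddCommGroup E] [NormedSpace ℝ E] [NormedAddCommGroup F] [NormedSpace ℝ F]

lemma YB.comp_sub {B : E → F} {B' : E → E →L[ℝ] F} {B'' : E → E →L[ℝ] (E →L[ℝ] F)} {R ε β : ℝ}
    (h : GB B B' R ε) (h' : GB B' B'' R ε) {f g : TT → E} (hf : YB f R) (hg : YB g R)
    (hd : YB (fun x => g x - f x) β) :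
    YB (fun x => B (g x) - B (f x)) (4 * (1 + R) ^ 2 * (ε * β)) := by
  have hR := hf.nn
  have hβ := hd.nn
  have mf : ∀ x, f x ∈ closedBall (0:E) R := fun x => by simpa using hf.sup x
  have mg : ∀ x, g x ∈ closedBall (0:E) R := fun x => by simpa using hg.sup x
  have hε : 0 ≤ ε := (norm_nonneg _).trans (h.bd _ (mf 0))
  have hBc : ContinuousOn B (closedBall (0:E) R) := fun x hx => (h.der x hx).continuousAt.continuousWithinAt
  have hc : Continuous (fun x => B (g x) - B (f x)) :=
    (hBc.comp_continuous hg.cont mg).sub (hBc.comp_continuous hf.cont mf)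
  refine ⟨hc, fun x => ?_, fun i s x => ?_, fun s t => ?_⟩
  · refine (h.two (mf x) (mg x)).trans ?_
    have := hd.sup x
    calc ε * ‖g x - f x‖ ≤ ε * β := by gcongr
      _ ≤ 4 * (1 + R) ^ 2 * (ε * β) := le_mul_of_one_le_left (by positivity) (by nlinarith)
  · refine (h.fourpt (mf (x + sh i s)) (mg (x + sh i s)) (mf x) (mg x) (r := R * |s|)
      (hf.d i s x) (hg.d i s x)).trans ?_
    have h1 := hd.d i s x
    have h2 := hd.sup x
    simp only [DD] at h1
    calc _ ≤ ε * (β * |s|) + ε * (R * |s|) * β := by gcongr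
      _ = (1 + R) * (ε * β) * |s| := by ring
      _ ≤ _ := by gcongr; nlinarith
  · have cf : Continuous (DD 0 s (DD 1 t f)) := DD_cont (DD_cont hf.cont 1 t) 0 s
    have cg : Continuous (DD 0 s (DD 1 t g)) := DD_cont (DD_cont hg.cont 1 t) 0 s
    have cd : Continuous (DD 0 s (DD 1 t (fun x => g x - f x))) := DD_cont (DD_cont hd.cont 1 t) 0 s
    have e : 4 * (1 + R) ^ 2 * (ε * β) * |s| * |t| = 4 * ((1 + R) ^ 2 * (ε * β) * |s| * |t|) := by ring
    rw [e]
    refine L2.four (f1 := fun x => (ε * β) * ‖DD 0 s (DD 1 t f) x‖)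
      (f2 := fun x => (ε * β) * ‖DD 0 s (DD 1 t g) x‖)
      (f3 := fun x => ε * β * (R ^ 2 + 2 * R) * |s| * |t|)
      (f4 := fun x => ε * ‖DD 0 s (DD 1 t (fun x => g x - f x)) x‖)
      (DD_cont (DD_cont hc _ _) _ _) (by fun_prop) (by fun_prop) (by fun_prop) (by fun_prop)
      (fun x => ?_) ?_ ?_ ?_ ?_
    · rw [DDDD]
      have hxy : x + sh 0 s + sh 1 t = x + sh 1 t + sh 0 s := add_right_comm _ _ _
      have key := h.eight h' (mf x) (mf (x + sh 1 t)) (mf (x + sh 0 s)) (mf (x + sh 0 s + sh 1 t))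
        (mg x) (mg (x + sh 1 t)) (mg (x + sh 0 s)) (mg (x + sh 0 s + sh 1 t))
        (s := R * |s|) (t := R * |t|) (q := ‖DD 0 s (DD 1 t f) x‖) (p := ‖DD 0 s (DD 1 t g) x‖)
        (d := β) (ds := β * |s|) (dt := β * |t|) (dq := ‖DD 0 s (DD 1 t (fun x => g x - f x)) x‖)
        (hf.d 0 s x) (by rw [hxy]; exact hf.d 0 s _) (hg.d 0 s x) (by rw [hxy]; exact hg.d 0 s _)
        (hf.d 1 t x) (hg.d 1 t x) (by rw [DDDD]) (by rw [DDDD]) (hd.sup _) (hd.d 1 t (x + sh 0 s))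
        (by rw [hxy]; exact hd.d 0 s (x + sh 1 t)) (by rw [DDDD])
      refine key.trans (le_of_eq ?_)
      ring
    · refine (hf.dd s t).normed _ cf (by positivity) (by positivity) ?_
      have : R ≤ (1 + R) ^ 2 := by nlinarith
      calc _ = R * (ε * β) * |s| * |t| := by ring
        _ ≤ _ := by gcongr
    · refine (hg.dd s t).normed _ cg (by positivity) (by positivity) ?_
      have : R ≤ (1 + R) ^ 2 := by nlinarith
      calc _ = R * (ε * β) * |s| * |t| := by ring
        _ ≤ _ := by gcongr
    · refine L2.of_sup (by fun_prop) (fun x => ?_)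
      rw [Real.norm_of_nonneg (by positivity)]
      calc _ = (R ^ 2 + 2 * R) * (ε * β) * |s| * |t| := by ring
        _ ≤ _ := by gcongr; nlinarith
    · refine (hd.dd s t).normed _ cd (by positivity) (by positivity) ?_
      have : 1 ≤ (1 + R) ^ 2 := by nlinarith
      calc _ = 1 * (ε * β) * |s| * |t| := by ring
        _ ≤ _ := by gcongr

lemma YB.mul {a : TT → (E →L[ℝ] F)} {h : TT → E} {α η : ℝ} (ha : YB a α) (hh : XB h η) :
    XB (fun x => a x (h x)) (4 * (α * η)) := by
  have hα := ha.nn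
  have hη := hh.nn
  have ca := ha.cont
  have ch := hh.cont
  have hc : Continuous (fun x => a x (h x)) := by fun_prop
  have hz : ∀ M : ℝ, L2 (fun _ : TT => (0 : ℝ)) M := fun M => by unfold L2; simp; positivity
  have op : ∀ (T : E →L[ℝ] F) (v : E) (c d : ℝ), 0 ≤ c → ‖T‖ ≤ c → ‖v‖ ≤ d → ‖T v‖ ≤ c * d :=
    fun T v c d hc h1 h2 => (T.le_opNorm v).trans (by gcongr)
  refine ⟨hc, fun x => ?_, fun i s => ?_, fun s t => ?_⟩
  · refine (op _ _ α η hα (ha.sup x) (hh.sup x)).trans ?_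
    have : 0 ≤ α * η := by positivity
    linarith
  · have cd := DD_cont ch i s
    have e : 4 * (α * η) * |s| = 4 * (α * (η * |s|)) := by ring
    rw [e]
    refine L2.four (f1 := fun x => α * ‖DD i s h x‖) (f2 := fun x => α * |s| * η) (f3 := fun _ => 0)
      (f4 := fun _ => 0) (DD_cont hc i s) (by fun_prop) (by fun_prop) (by fun_prop) (by fun_prop)
      (fun x => ?_) ?_ ?_ (hz _) (hz _)
    · have e : DD i s (fun x => a x (h x)) x = a (x + sh i s) (DD i s h x) + (DD i s a x) (h x) := by
        simp only [DD, map_sub, sub_apply]; abel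
      rw [e, add_zero, add_zero]
      refine (norm_add_le _ _).trans (add_le_add ?_ ?_)
      · exact op _ _ _ _ hα (ha.sup _) le_rfl
      · exact op _ _ _ _ (by positivity) (ha.d _ _ _) (hh.sup _)
    · exact (hh.d i s).normed _ cd (by positivity) hα le_rfl
    · refine L2.of_sup (by fun_prop) (fun x => ?_)
      rw [Real.norm_of_nonneg (by positivity)]
      exact le_of_eq (by ring)
  · have c1 := DD_cont (DD_cont ca 1 t) 0 s
    have c2 := DD_cont (DD_cont ch 1 t) 0 s
    have c3 := DD_cont ch 1 t
    have c4 := DD_cont ch 0 s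
    have e : 4 * (α * η) * |s| * |t| = 4 * (α * η * |s| * |t|) := by ring
    rw [e]
    refine L2.four (f1 := fun x => η * ‖DD 0 s (DD 1 t a) x‖)
      (f2 := fun x => α * |s| * ‖DD 1 t h (x + sh 0 s)‖)
      (f3 := fun x => α * |t| * ‖DD 0 s h (x + sh 1 t)‖)
      (f4 := fun x => α * ‖DD 0 s (DD 1 t h) x‖)
      (DD_cont (DD_cont hc _ _) _ _) (by fun_prop) (by fun_prop) (by fun_prop) (by fun_prop)
      (fun x => ?_) ?_ ?_ ?_ ?_
    · have hxy : x + sh 0 s + sh 1 t = x + sh 1 t + sh 0 s := add_right_comm _ _ _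
      have e : DD 0 s (DD 1 t (fun x => a x (h x))) x =
          (DD 0 s (DD 1 t a) x) (h (x + sh 0 s + sh 1 t)) + (DD 0 s a x) (DD 1 t h (x + sh 0 s))
          + (DD 1 t a x) (DD 0 s h (x + sh 1 t)) + a x (DD 0 s (DD 1 t h) x) := by
        simp only [DDDD]
        simp only [DD, map_sub, sub_apply, ← hxy]
        abel
      rw [e]
      refine (norm_add_le _ _).trans (add_le_add ((norm_add_le _ _).trans (add_le_add ((norm_add_le _ _).trans (add_le_add ?_ ?_)) ?_)) ?_)
      · rw [mul_comm]; exact op _ _ _ _ (norm_nonneg _) le_rfl (hh.sup _)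
      · exact op _ _ _ _ (by positivity) (ha.d _ _ _) le_rfl
      · exact op _ _ _ _ (by positivity) (ha.d _ _ _) le_rfl
      · exact op _ _ _ _ hα (ha.sup _) le_rfl
    · exact (ha.dd s t).normed _ c1 (by positivity) hη (le_of_eq (by ring))
    · exact ((hh.d 1 t).shift _).normed _ (by fun_prop) (by positivity) (by positivity) (le_of_eq (by ring))
    · exact ((hh.d 0 s).shift _).normed _ (by fun_prop) (by positivity) (by positivity) (le_of_eq (by ring))
    · exact (hh.dd s t).normed _ c2 (by positivity) hα (le_of_eq (by ring))

end comp


/-- triangle wave -/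
def TW (x : UnitAddCircle) : ℝ := ‖x + ((1/4 : ℝ) : UnitAddCircle)‖ - ‖((1/4 : ℝ) : UnitAddCircle)‖

lemma TW_cont : Continuous TW := by unfold TW; fun_prop

lemma UAC_norm_le (s : ℝ) : ‖(s : UnitAddCircle)‖ ≤ |s| := by
  rw [UnitAddCircle.norm_eq]
  have := round_le s 0
  simpa using this

lemma UAC_norm_le_one (x : UnitAddCircle) : ‖x‖ ≤ 1 := by
  have := AddCircle.norm_le_half_period (1:ℝ) (x := x) one_ne_zero
  have h1 : |(1:ℝ)| / 2 ≤ 1 := by norm_num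
  exact this.trans h1

lemma TW_lip (x : UnitAddCircle) (s : ℝ) : |TW (x + s) - TW x| ≤ |s| := by
  unfold TW
  refine le_trans ?_ (UAC_norm_le s)
  have := abs_norm_sub_norm_le (x + (s : UnitAddCircle) + ((1/4 : ℝ) : UnitAddCircle)) (x + ((1/4 : ℝ) : UnitAddCircle))
  rw [show x + (s : UnitAddCircle) + ((1/4 : ℝ) : UnitAddCircle) - (x + ((1/4 : ℝ) : UnitAddCircle)) = s by abel] at this
  rwa [sub_sub_sub_cancel_right]

lemma TW_le (x : UnitAddCircle) : |TW x| ≤ 1 := by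
  unfold TW
  have := abs_norm_sub_norm_le (x + ((1/4 : ℝ) : UnitAddCircle)) ((1/4 : ℝ) : UnitAddCircle)
  rw [add_sub_cancel_right] at this
  exact this.trans (UAC_norm_le_one x)

lemma TW_eq {t : ℝ} (ht : |t| < 1/4) : TW t = t := by
  have h := abs_lt.mp ht
  have e : ∀ s : ℝ, 0 ≤ s → s < 1/2 → ‖(s : UnitAddCircle)‖ = s := by
    intro s h1 h2
    rw [UnitAddCircle.norm_eq]
    have : round s = 0 := by
      rw [round_eq, Int.floor_eq_iff]; constructor <;> push_cast <;> linarith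
    rw [this]; simp [abs_of_nonneg h1]
  unfold TW
  rw [← AddCircle.coe_add, e _ (by linarith) (by linarith), e _ (by norm_num) (by norm_num)]
  ring

lemma const_YB {E : Type*} [NormedAddCommGroup E] (a : E) : YB (fun _ : TT => a) ‖a‖ := by
  refine ⟨by fun_prop, fun x => le_rfl, fun i s x => ?_, fun s t => ?_⟩
  · simp only [DD, sub_self, norm_zero]; positivity
  · unfold L2; simp only [DD, sub_self, norm_zero]; simp; positivity

lemma TW_YB {n : ℕ} (i : Fin 2) (a : Cn n) : YB (fun x : TT => TW (x i) • a) ‖a‖ := by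
  have hT := TW_cont
  have hc : Continuous (fun x : TT => TW (x i) • a) := by
    have : Continuous (fun x : TT => TW (x i)) := hT.comp (continuous_apply i)
    fun_prop
  have hne : ∀ (j : Fin 2) (s : ℝ) (x : TT), i ≠ j → (x + sh j s) i = x i := by
    intro j s x h; simp [sh, h]
  refine ⟨hc, fun x => ?_, fun j s x => ?_, fun s t => ?_⟩
  · rw [norm_smul]; exact mul_le_of_le_one_left (norm_nonneg _) (TW_le _)
  · simp only [DD]
    by_cases h : i = j
    · subst h
      rw [← sub_smul, norm_smul, mul_comm]
      gcongr
      simpa [sh] using TW_lip (x i) s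
    · rw [hne j s x h]; simp; positivity
  · have : DD 0 s (DD 1 t (fun x : TT => TW (x i) • a)) = fun _ => 0 := by
      ext1 x
      rw [DDDD]
      by_cases h : i = 0
      · rw [hne 1 t _ (by simp [h]), hne 1 t _ (by simp [h])]; simp
      · rw [add_right_comm, hne 0 s _ h, hne 0 s _ h]; simp
    rw [this]; unfold L2; simp; positivity

/-! multipliers -/

def kk (k : ZZ) : ℝ := (k 0 : ℝ) ^ 2 + (k 1 : ℝ) ^ 2
def RR (i j : Fin 2) (k : ZZ) : ℂ := (((k i : ℝ) * (k j : ℝ) / kk k : ℝ) : ℂ)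
def rr (j : Fin 2) (k : ZZ) : ℂ := -Complex.I * (((k j : ℝ) / (2 * Real.pi * kk k) : ℝ) : ℂ)

lemma kk_abs (k : ZZ) (i j : Fin 2) : |(k i : ℝ)| * |(k j : ℝ)| ≤ kk k := by
  unfold kk
  have h0 := sq_abs (k 0 : ℝ)
  have h1 := sq_abs (k 1 : ℝ)
  fin_cases i <;> fin_cases j <;> simp <;>
    nlinarith [sq_nonneg (|(k 0 : ℝ)| - |(k 1 : ℝ)|), sq_nonneg (|(k 0 : ℝ)| + |(k 1 : ℝ)|),
      sq_nonneg (k 0 : ℝ), sq_nonneg (k 1 : ℝ)]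

lemma kk_nn (k : ZZ) : 0 ≤ kk k := by unfold kk; positivity

lemma RR_le (i j : Fin 2) (k : ZZ) : ‖RR i j k‖ ≤ 1 := by
  unfold RR
  rw [Complex.norm_real, norm_div, Real.norm_of_nonneg (kk_nn k), norm_mul]
  exact div_le_one_of_le₀ (kk_abs k i j) (kk_nn k)

lemma rr_le' (j : Fin 2) (k : ZZ) (i : Fin 2) : ‖rr j k‖ * |((k : ZZ) i : ℝ)| ≤ 1 := by
  unfold rr
  have hp := Real.pi_gt_three
  have := kk_nn k
  rw [norm_mul, Complex.norm_real, norm_div, norm_neg, Complex.norm_I, one_mul,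
    Real.norm_of_nonneg (show 0 ≤ 2 * Real.pi * kk k by positivity), Real.norm_eq_abs, div_mul_eq_mul_div]
  refine div_le_one_of_le₀ ((kk_abs k j i).trans ?_) (by positivity)
  nlinarith

lemma rr_le (j : Fin 2) (k : ZZ) : ‖rr j k‖ ≤ 1 := by
  by_cases h : k j = 0
  · simp [rr, h]
  · refine le_trans (le_mul_of_one_le_right (norm_nonneg _) ?_) (rr_le' j k j)
    exact_mod_cast Int.one_le_abs h

lemma rr_RR (i j : Fin 2) (k : ZZ) : 2 * Real.pi * Complex.I * (k i : ℂ) * rr j k = RR i j k := by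
  unfold rr RR
  push_cast
  have hp : (Real.pi : ℂ) ≠ 0 := by exact_mod_cast Real.pi_ne_zero
  calc _ = -(Complex.I * Complex.I) * (2 * Real.pi * (k i : ℂ) * ((k j : ℂ) / (2 * Real.pi * (kk k : ℂ)))) := by ring
    _ = (k i : ℂ) * ((2 * Real.pi * (k j : ℂ)) / (2 * Real.pi * (kk k : ℂ))) := by
        rw [Complex.I_mul_I]; ring
    _ = _ := by rw [mul_div_mul_left _ _ (by simp [hp])]; ring

lemma RR_trace (k : ZZ) (hk : k ≠ 0) : RR 0 0 k + RR 1 1 k = 1 := by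
  unfold RR
  have : kk k ≠ 0 := by
    intro h
    apply hk
    unfold kk at h
    have h0 : (k 0 : ℝ) = 0 := by nlinarith [sq_nonneg (k 0 : ℝ), sq_nonneg (k 1 : ℝ)]
    have h1 : (k 1 : ℝ) = 0 := by nlinarith [sq_nonneg (k 0 : ℝ), sq_nonneg (k 1 : ℝ)]
    ext i; fin_cases i
    · exact_mod_cast h0
    · exact_mod_cast h1
  rw [← Complex.ofReal_add, ← add_div]
  rw [show (k 0 : ℝ) * (k 0 : ℝ) + (k 1 : ℝ) * (k 1 : ℝ) = kk k by unfold kk; ring, div_self this]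
  simp

lemma Syn_sub {n : ℕ} {m : ZZ → ℂ} (hm : ∀ k, ‖m k‖ ≤ 1) (b c : HH n) (x : TT) :
    Syn m (b - c) x = Syn m b x - Syn m c x := by
  unfold Syn
  unfold ser
  rw [← (ser_summable (Syn_sum hm b) x).tsum_sub (ser_summable (Syn_sum hm c) x)]
  congr 1; ext1 k
  change mFourier k x • (m k / WW k : ℂ) • (b k - c k) = _
  rw [smul_sub, smul_sub]

lemma Syn_trace {n : ℕ} (b : HH n) (x : TT) :
    Syn (RR 0 0) b x + Syn (RR 1 1) b x = Syn (fun _ => 1) b x - b 0 := by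
  have h0 := ser_summable (Syn_sum (RR_le 0 0) b) x
  have h1 := ser_summable (Syn_sum (RR_le 1 1) b) x
  have h2 := ser_summable (Syn_sum (m := fun _ => 1) (by simp) b) x
  have h3 : HasSum (fun k : ZZ => if k = 0 then b 0 else 0) (b 0) := hasSum_ite_eq (0 : ZZ) (b 0)
  have e1 := h0.hasSum.add h1.hasSum
  have e2 := h2.hasSum.sub h3
  change _ = ∑' k, _ - _
  refine e1.unique ?_
  convert e2 using 1
  ext1 k
  by_cases hk : k = 0
  · subst hk
    have : mFourier (0 : ZZ) x = 1 := by rw [mFourier_zero]; rfl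
    simp [RR, WW, this]
  · simp only [hk, if_false, sub_zero]
    rw [← smul_add, ← add_smul, ← add_div, RR_trace k hk]

section def1
variable {n : ℕ} (J0 : Cn n →L[ℝ] Cn n)

def wF (b : HH n) (x : TT) : Cn n := Syn (rr 1) b x + J0 (Syn (rr 0) b x)
def wX (b : HH n) (x : TT) : Cn n := Syn (RR 0 1) b x + J0 (Syn (RR 0 0) b x)
def wY (b : HH n) (x : TT) : Cn n := Syn (RR 1 1) b x + J0 (Syn (RR 1 0) b x)
def aa (v : Cn n) (b : HH n) : Cn n := v - wX J0 b 0
def FF (v : Cn n) (b : HH n) (x : TT) : Cn n :=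
  (TW (x 0) • aa J0 v b + TW (x 1) • (J0 (aa J0 v b) + b 0)) + (wF J0 b x + -wF J0 b 0)
def FX (v : Cn n) (b : HH n) (x : TT) : Cn n := aa J0 v b + wX J0 b x

lemma wF_sub (b c : HH n) (x : TT) : wF J0 (b - c) x = wF J0 b x - wF J0 c x := by
  unfold wF; rw [Syn_sub (rr_le 1), Syn_sub (rr_le 0), map_sub]; abel
lemma wX_sub (b c : HH n) (x : TT) : wX J0 (b - c) x = wX J0 b x - wX J0 c x := by
  unfold wX; rw [Syn_sub (RR_le 0 1), Syn_sub (RR_le 0 0), map_sub]; abel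

lemma FF_sub (v : Cn n) (b c : HH n) (x : TT) : FF J0 v b x - FF J0 v c x = FF J0 0 (b - c) x := by
  unfold FF aa
  simp only [wF_sub, wX_sub, lp.coeFn_sub, Pi.sub_apply, map_sub, map_zero]
  module

lemma FX_sub (v : Cn n) (b c : HH n) (x : TT) : FX J0 v b x - FX J0 v c x = FX J0 0 (b - c) x := by
  unfold FX aa
  simp only [wX_sub]
  module

lemma CX_nn : 0 ≤ CX := by
  have := CW_nn
  have := Real.pi_pos
  unfold CX; positivity

def K1 (Λ : ℝ) : ℝ := 4 * (CX + Λ * CX)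
def K2 (Λ : ℝ) : ℝ := 4 * (4 * ((1 + K1 Λ) + (Λ * (1 + K1 Λ) + 1)) + 4 * (K1 Λ + K1 Λ))

variable {Λ : ℝ} (hJ : ‖J0‖ ≤ Λ)

lemma wF_YB (hJ : ‖J0‖ ≤ Λ) (b : HH n) : YB (wF J0 b) (K1 Λ * ‖b‖) := by
  have := (Syn_YB (rr_le 1) (rr_le' 1) b).add ((Syn_YB (rr_le 0) (rr_le' 0) b).map J0 hJ)
  exact this.mono (le_of_eq (by unfold K1; ring))
lemma wX_XB (hJ : ‖J0‖ ≤ Λ) (b : HH n) : XB (wX J0 b) (K1 Λ * ‖b‖) := by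
  have := (Syn_XB (RR_le 0 1) b).add ((Syn_XB (RR_le 0 0) b).map J0 hJ)
  exact this.mono (le_of_eq (by unfold K1; ring))

lemma K1_nn (hJ : ‖J0‖ ≤ Λ) : 0 ≤ K1 Λ := by
  have := CX_nn
  have := (norm_nonneg _).trans hJ
  unfold K1; positivity

lemma aa_le (hJ : ‖J0‖ ≤ Λ) (v : Cn n) (b : HH n) : ‖aa J0 v b‖ ≤ (1 + K1 Λ) * (‖v‖ + ‖b‖) := by
  have h1 := (wX_XB J0 hJ b).sup 0
  have h2 := norm_sub_le v (wX J0 b 0)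
  have := K1_nn J0 hJ
  unfold aa
  nlinarith [norm_nonneg v, norm_nonneg b, mul_nonneg this (norm_nonneg v)]

lemma FF_YB (hJ : ‖J0‖ ≤ Λ) (v : Cn n) (b : HH n) : YB (FF J0 v b) (K2 Λ * (‖v‖ + ‖b‖)) := by
  have hK := K1_nn J0 hJ
  have hL : 0 ≤ Λ := (norm_nonneg _).trans hJ
  have ha := aa_le J0 hJ v b
  have hb : ‖b 0‖ ≤ ‖b‖ := lp.norm_apply_le_norm (by norm_num) b 0
  have hw := wF_YB J0 hJ b
  have hw0 := hw.sup 0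
  have nv := norm_nonneg v
  have hJa : ‖J0 (aa J0 v b) + b 0‖ ≤ (Λ * (1 + K1 Λ) + 1) * (‖v‖ + ‖b‖) := by
    refine (norm_add_le _ _).trans ?_
    have : ‖J0 (aa J0 v b)‖ ≤ Λ * ((1 + K1 Λ) * (‖v‖ + ‖b‖)) := (J0.le_opNorm _).trans (by gcongr)
    linarith
  have := (((TW_YB 0 (aa J0 v b)).mono ha).add ((TW_YB 1 (J0 (aa J0 v b) + b 0)).mono hJa)).add
    (hw.add ((const_YB (-wF J0 b 0)).mono ((norm_neg _).trans_le hw0)))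
  refine this.mono ?_
  unfold K2
  nlinarith [mul_nonneg hK nv]

lemma FX_XB (hJ : ‖J0‖ ≤ Λ) (v : Cn n) (b : HH n) : XB (FX J0 v b) (K2 Λ * (‖v‖ + ‖b‖)) := by
  have hK := K1_nn J0 hJ
  have hL : 0 ≤ Λ := (norm_nonneg _).trans hJ
  have ha := aa_le J0 hJ v b
  have hw := wX_XB J0 hJ b
  have := ((const_YB (aa J0 v b)).mono ha).toXB.add hw
  refine this.mono ?_
  unfold K2
  have nv := norm_nonneg v
  have nb := norm_nonneg b
  have h1 := mul_nonneg hK nv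
  have h2 := mul_nonneg hK nb
  have h3 := mul_nonneg hL nv
  have h4 := mul_nonneg hL nb
  have h5 := mul_nonneg hL h1
  have h6 := mul_nonneg hL h2
  nlinarith

end def1


def lft (z : ℂ) : TT := fun i => ((if i = 0 then z.re else z.im : ℝ) : UnitAddCircle)

lemma mF_lft (k : ZZ) (z : ℂ) :
    mFourier k (lft z) = Complex.exp (2 * Real.pi * Complex.I * (k 0 * (z.re : ℂ) + k 1 * (z.im : ℂ))) := by
  simp only [mFourier, lft, ContinuousMap.coe_mk, Fin.prod_univ_two]
  rw [fourier_coe_apply, fourier_coe_apply, ← Complex.exp_add]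
  congr 1
  simp
  ring

def tD {n : ℕ} (k : ZZ) (z : ℂ) (c : Cn n) : ℂ →L[ℝ] Cn n :=
  Complex.reCLM.smulRight (mFourier k (lft z) • (2 * Real.pi * Complex.I * k 0 : ℂ) • c) +
  Complex.imCLM.smulRight (mFourier k (lft z) • (2 * Real.pi * Complex.I * k 1 : ℂ) • c)

lemma tD_has {n : ℕ} (k : ZZ) (z : ℂ) (c : Cn n) :
    HasFDerivAt (fun z => mFourier k (lft z) • c) (tD k z c) z := by
  have h1 : HasFDerivAt (fun z : ℂ => 2 * Real.pi * Complex.I * (k 0 * (z.re : ℂ) + k 1 * (z.im : ℂ)))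
    ((2 * Real.pi * Complex.I : ℂ) • ((k 0 : ℂ) • (Complex.ofRealCLM.comp Complex.reCLM) + (k 1 : ℂ) • (Complex.ofRealCLM.comp Complex.imCLM)) : ℂ →L[ℝ] ℂ) z := by
    refine HasFDerivAt.const_mul (HasFDerivAt.add (HasFDerivAt.const_mul ?_ _) (HasFDerivAt.const_mul ?_ _)) _
    · exact (Complex.ofRealCLM.comp Complex.reCLM).hasFDerivAt
    · exact (Complex.ofRealCLM.comp Complex.imCLM).hasFDerivAt
  have h2 := (h1.cexp).smul_const c
  simp_rw [← mF_lft] at h2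
  refine h2.congr_fderiv ?_
  ext ξ
  simp [tD, smul_smul]
  ring

lemma tD_norm {n : ℕ} (k : ZZ) (z : ℂ) (c : Cn n) (M : ℝ) (h : ∀ i, |(k i : ℝ)| * ‖c‖ ≤ M) :
    ‖tD k z c‖ ≤ 2 * (2 * Real.pi * M) := by
  have hp := Real.pi_pos
  have e : ∀ i, ‖mFourier k (lft z) • (2 * Real.pi * Complex.I * k i : ℂ) • c‖ ≤ 2 * Real.pi * M := by
    intro i
    rw [norm_smul, mF_norm, one_mul, norm_smul]
    simp only [norm_mul, Complex.norm_I, Complex.norm_real, Complex.norm_intCast, Complex.norm_ofNat,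
      Real.norm_of_nonneg hp.le, mul_one]
    rw [mul_assoc]
    gcongr; exact h i
  unfold tD
  refine (norm_add_le _ _).trans ?_
  rw [ContinuousLinearMap.norm_smulRight_apply, ContinuousLinearMap.norm_smulRight_apply,
    Complex.reCLM_norm, Complex.imCLM_norm]
  linarith [e 0, e 1]

lemma Syn_diff {n : ℕ} {m : ZZ → ℂ} (hm : ∀ k, ‖m k‖ ≤ 1) (hk : ∀ k i, ‖m k‖ * |((k : ZZ) i : ℝ)| ≤ 1)
    (b : HH n) (z : ℂ) : ∃ L : ℂ →L[ℝ] Cn n, HasFDerivAt (fun z => Syn m b (lft z)) L z ∧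
      L 1 = Syn (fun k => 2 * Real.pi * Complex.I * k 0 * m k) b (lft z) ∧
      L Complex.I = Syn (fun k => 2 * Real.pi * Complex.I * k 1 * m k) b (lft z) := by
  have hb : ∀ (k : ZZ) (z : ℂ), ‖tD k z ((m k / WW k : ℂ) • b k)‖ ≤ 2 * (2 * Real.pi * (‖b k‖ / WW k)) := by
    intro k z
    refine tD_norm _ _ _ _ (fun i => ?_)
    have hW := WW_pos k
    rw [norm_smul, norm_div, Complex.norm_real, Real.norm_of_nonneg hW.le]
    calc _ = (‖b k‖ / WW k) * (‖m k‖ * |(k i : ℝ)|) := by ring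
      _ ≤ (‖b k‖ / WW k) * 1 := by gcongr; exact hk k i
      _ = _ := by ring
  have hs : Summable (fun k => 2 * (2 * Real.pi * (‖b k‖ / WW k))) := ((CW_sum b).mul_left _).mul_left _
  have hd := hasFDerivAt_tsum (f := fun k z => mFourier k (lft z) • (m k / WW k : ℂ) • b k) hs
    (fun k z => tD_has k z _) hb (x₀ := z) (ser_summable (Syn_sum hm b) _) z
  have hts : Summable (fun k => tD k z ((m k / WW k : ℂ) • b k)) := Summable.of_norm_bounded hs (fun k => hb k z)
  refine ⟨_, hd, ?_, ?_⟩
  · have := hts.hasSum.mapL (ContinuousLinearMap.apply ℝ (Cn n) (1:ℂ))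
    simp only [ContinuousLinearMap.apply_apply] at this
    rw [← this.tsum_eq]
    unfold Syn ser
    congr 1; ext1 k
    simp only [tD, add_apply, ContinuousLinearMap.smulRight_apply, Complex.reCLM_apply, Complex.imCLM_apply, Complex.one_re, Complex.one_im, one_smul, zero_smul, add_zero, smul_smul]
    congr 1; ring
  · have := hts.hasSum.mapL (ContinuousLinearMap.apply ℝ (Cn n) (Complex.I))
    simp only [ContinuousLinearMap.apply_apply] at this
    rw [← this.tsum_eq]
    unfold Syn ser
    congr 1; ext1 k
    simp only [tD, add_apply, ContinuousLinearMap.smulRight_apply, Complex.reCLM_apply, Complex.imCLM_apply, Complex.I_re, Complex.I_im, one_smul, zero_smul, zero_add, smul_smul]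
    congr 1; ring

lemma lft_zero : lft 0 = 0 := by
  ext i; simp [lft]

lemma FF_diff {n : ℕ} (J0 : Cn n →L[ℝ] Cn n) (hJ2 : ∀ u, J0 (J0 u) = -u) (v : Cn n) (b : HH n) {z : ℂ}
    (hz : ‖z‖ < 1/4) : ∃ L : ℂ →L[ℝ] Cn n, HasFDerivAt (fun z => FF J0 v b (lft z)) L z ∧
      L 1 = FX J0 v b (lft z) ∧
      L Complex.I = J0 (FX J0 v b (lft z)) + Syn (fun _ => 1) b (lft z) := by
  obtain ⟨L0, h0, h0x, h0y⟩ := Syn_diff (rr_le 0) (rr_le' 0) b z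
  obtain ⟨L1, h1, h1x, h1y⟩ := Syn_diff (rr_le 1) (rr_le' 1) b z
  simp_rw [rr_RR] at h0x h0y h1x h1y
  have hw : HasFDerivAt (fun z => wF J0 b (lft z)) (L1 + J0.comp L0) z :=
    h1.add (J0.hasFDerivAt.comp z h0)
  have hlin : HasFDerivAt (fun z : ℂ => z.re • aa J0 v b + z.im • (J0 (aa J0 v b) + b 0))
      (Complex.reCLM.smulRight (aa J0 v b) + Complex.imCLM.smulRight (J0 (aa J0 v b) + b 0)) z :=
    (Complex.reCLM.smulRight (aa J0 v b)).hasFDerivAt.add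
      (Complex.imCLM.smulRight (J0 (aa J0 v b) + b 0)).hasFDerivAt
  have hh := hlin.add (hw.add_const (-wF J0 b 0))
  refine ⟨_, hh.congr_of_eventuallyEq ?_, ?_, ?_⟩
  · have : ∀ᶠ y : ℂ in 𝓝 z, ‖y‖ < 1/4 := (continuous_norm.continuousAt.eventually_lt continuousAt_const hz)
    filter_upwards [this] with y hy
    have e0 : TW (lft y 0) = y.re := TW_eq ((Complex.abs_re_le_norm y).trans_lt hy)
    have e1 : TW (lft y 1) = y.im := TW_eq ((Complex.abs_im_le_norm y).trans_lt hy)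
    simp only [FF, e0, e1, Pi.add_apply]
  · simp only [add_apply, ContinuousLinearMap.smulRight_apply, Complex.reCLM_apply, Complex.imCLM_apply, Complex.one_re, Complex.one_im, one_smul, zero_smul, add_zero, ContinuousLinearMap.comp_apply, h0x, h1x]
    rfl
  · simp only [add_apply, ContinuousLinearMap.smulRight_apply, Complex.reCLM_apply, Complex.imCLM_apply, Complex.I_re, Complex.I_im, one_smul, zero_smul, zero_add, ContinuousLinearMap.comp_apply, h0y, h1y]
    have ht := Syn_trace b (lft z)
    have hc : RR 1 0 = RR 0 1 := by ext1 k; unfold RR; rw [mul_comm]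
    simp only [FX, wX, map_add, hJ2]
    change J0 (aa J0 v b) + b 0 + (Syn (RR 1 1) b (lft z) + J0 (Syn (RR 1 0) b (lft z))) = _
    rw [hc, ← add_sub_cancel_right (Syn (fun _ => 1) b (lft z)) (b 0), add_sub_right_comm, ← ht]
    abel

lemma FF_zero {n : ℕ} (J0 : Cn n →L[ℝ] Cn n) (v : Cn n) (b : HH n) : FF J0 v b (lft 0) = 0 := by
  have e : TW 0 = 0 := by simp [TW]
  simp [FF, lft_zero, e]

lemma FX_zero {n : ℕ} (J0 : Cn n →L[ℝ] Cn n) (v : Cn n) (b : HH n) : FX J0 v b (lft 0) = v := by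
  simp [FX, lft_zero, aa]


def NN {n : ℕ} (J0 : Cn n →L[ℝ] Cn n) (B : Cn n → (Cn n →L[ℝ] Cn n)) (v : Cn n) (b : HH n) (x : TT) : Cn n :=
  B (FF J0 v b x) (FX J0 v b x)

lemma K2_nn {n : ℕ} (J0 : Cn n →L[ℝ] Cn n) {Λ : ℝ} (hJ : ‖J0‖ ≤ Λ) : 0 ≤ K2 Λ := by
  have hK := K1_nn J0 hJ
  have hL : 0 ≤ Λ := (norm_nonneg _).trans hJ
  unfold K2; positivity

section core
variable {n : ℕ} {J0 : Cn n →L[ℝ] Cn n} {B : Cn n → (Cn n →L[ℝ] Cn n)}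
  {B' : Cn n → Cn n →L[ℝ] (Cn n →L[ℝ] Cn n)} {B'' : Cn n → Cn n →L[ℝ] (Cn n →L[ℝ] (Cn n →L[ℝ] Cn n))}
  {Λ R ε : ℝ} {v : Cn n}

lemma NN_XB (hJ : ‖J0‖ ≤ Λ) (hR : R = 2 * K2 Λ + 1) (h : GB B B' R ε) (h' : GB B' B'' R ε) (hB : B 0 = 0)
    (hv : ‖v‖ ≤ 1) {b : HH n} (hb : ‖b‖ ≤ 1) :
    YB (fun x => B (FF J0 v b x)) (4 * (1 + R) ^ 2 * (ε * R)) ∧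
    YB (FF J0 v b) R ∧ XB (FX J0 v b) R ∧
    XB (NN J0 B v b) (4 * (4 * (1 + R) ^ 2 * (ε * R) * R)) := by
  have hK := K2_nn J0 hJ
  have hle : K2 Λ * (‖v‖ + ‖b‖) ≤ R := by rw [hR]; nlinarith
  have hf := (FF_YB J0 hJ v b).mono hle
  have hx := (FX_XB J0 hJ v b).mono hle
  have h0 : YB (fun _ : TT => (0 : Cn n)) R := (const_YB 0).mono (by rw [norm_zero]; linarith)
  have h1 := h0.comp_sub h h' hf (by simpa using hf)
  simp only [hB, sub_zero] at h1
  exact ⟨h1, hf, hx, h1.mul hx⟩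

lemma NN_sub (hJ : ‖J0‖ ≤ Λ) (hR : R = 2 * K2 Λ + 1) (h : GB B B' R ε) (h' : GB B' B'' R ε) (hB : B 0 = 0)
    (hv : ‖v‖ ≤ 1) {b c : HH n} (hb : ‖b‖ ≤ 1) (hc : ‖c‖ ≤ 1) :
    XB (fun x => NN J0 B v b x - NN J0 B v c x) (128 * (1 + R) ^ 2 * (ε * R) * R * ‖b - c‖) := by
  have hK := K2_nn J0 hJ
  obtain ⟨a1, a2, a3, a4⟩ := NN_XB hJ hR h h' hB hv hb
  obtain ⟨c1, c2, c3, c4⟩ := NN_XB hJ hR h h' hB hv hc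
  have hle : K2 Λ * (‖(0 : Cn n)‖ + ‖b - c‖) ≤ R * ‖b - c‖ := by
    rw [norm_zero, zero_add]
    have := norm_nonneg (b - c)
    gcongr
    linarith
  have d1 := (FF_YB J0 hJ 0 (b - c)).mono hle
  have d2 := (FX_XB J0 hJ 0 (b - c)).mono hle
  have e1 : FF J0 0 (b - c) = fun x => FF J0 v b x - FF J0 v c x := by ext1 x; rw [FF_sub]
  have e2 : FX J0 0 (b - c) = fun x => FX J0 v b x - FX J0 v c x := by ext1 x; rw [FX_sub]
  rw [e1] at d1
  rw [e2] at d2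
  have m1 := a1.mul d2
  have m2 := (c2.comp_sub h h' a2 d1).mul c3
  have := m1.add m2
  have e3 : (fun x => NN J0 B v b x - NN J0 B v c x) = fun x =>
    (B (FF J0 v b x)) (FX J0 v b x - FX J0 v c x) + (B (FF J0 v b x) - B (FF J0 v c x)) (FX J0 v c x) := by
    ext1 x
    simp only [NN, map_sub, sub_apply]
    abel
  rw [e3]
  exact this.mono (le_of_eq (by ring))

open Classical in
def Phi (J0 : Cn n →L[ℝ] Cn n) (B : Cn n → (Cn n →L[ℝ] Cn n)) (v : Cn n) (M : ℝ) (b : HH n) : HH n :=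
  if h : XB (NN J0 B v b) M then h.toHH else 0

lemma exists_fix (hJ : ‖J0‖ ≤ Λ) (hR : R = 2 * K2 Λ + 1) (h : GB B B' R ε) (h' : GB B' B'' R ε) (hB : B 0 = 0)
    (hε : 1024 * (1 + R) ^ 2 * (ε * R) * R ≤ 1)
    (hv : ‖v‖ ≤ 1) : ∃ b : HH n, ‖b‖ ≤ 1 ∧ ∀ x, NN J0 B v b x = Syn (fun _ => 1) b x := by
  set M := 4 * (4 * (1 + R) ^ 2 * (ε * R) * R) with hM
  have hK := K2_nn J0 hJ
  have hN : ∀ b : HH n, ‖b‖ ≤ 1 → XB (NN J0 B v b) M := fun b hb => (NN_XB hJ hR h h' hB hv hb).2.2.2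
  have hP : ∀ b : HH n, ∀ hb : ‖b‖ ≤ 1, Phi J0 B v M b = (hN b hb).toHH := fun b hb => by
    unfold Phi; rw [dif_pos (hN b hb)]
  have hmaps : MapsTo (Phi J0 B v M) (closedBall (0 : HH n) 1) (closedBall (0 : HH n) 1) := by
    intro b hb
    rw [mem_closedBall_zero_iff] at hb ⊢
    rw [hP b hb]
    refine (hN b hb).norm_toHH.trans ?_
    have := (hN b hb).nn
    nlinarith
  have hcon : ContractingWith (1/2) (hmaps.restrict (Phi J0 B v M) _ _) := by
    refine ⟨by norm_num, LipschitzWith.of_dist_le_mul ?_⟩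
    rintro ⟨b, hb⟩ ⟨c, hc⟩
    rw [Subtype.dist_eq, Subtype.dist_eq]
    simp only [MapsTo.val_restrict_apply]
    rw [mem_closedBall_zero_iff] at hb hc
    rw [hP b hb, hP c hc, dist_eq_norm, dist_eq_norm]
    refine ((hN b hb).norm_toHH_sub (hN c hc) (NN_sub hJ hR h h' hB hv hb hc)).trans ?_
    have := norm_nonneg (b - c)
    push_cast
    nlinarith
  obtain ⟨b, hb, hfix, -⟩ := ContractingWith.exists_fixedPoint' isClosed_closedBall.isComplete hmaps hcon
    (x := (0 : HH n)) (by simp) (edist_ne_top _ _)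
  rw [mem_closedBall_zero_iff] at hb
  refine ⟨b, hb, fun x => ?_⟩
  have hfix : Phi J0 B v M b = b := hfix
  rw [hP b hb] at hfix
  have hco : ∀ k, mFourierCoeff (NN J0 B v b) k = ((1 : ℂ) / WW k) • b k := by
    intro k
    have e : b k = (WW k : ℂ) • mFourierCoeff (NN J0 B v b) k := by
      conv_lhs => rw [← hfix]
      rfl
    have hW : (WW k : ℂ) ≠ 0 := by exact_mod_cast (WW_pos k).ne'
    rw [e, smul_smul, one_div, inv_mul_cancel₀ hW, one_smul]
  have hs : Summable (fun k => ‖mFourierCoeff (NN J0 B v b) k‖) := by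
    simp_rw [hco]; exact Syn_sum (m := fun _ => 1) (by simp) b
  rw [mFc_inv (hN b hb).cont hs x]
  unfold Syn ser
  simp_rw [hco]

end core

theorem core_disc (n : ℕ) (Λ : ℝ) (hΛ : 0 ≤ Λ) : ∃ ε : ℝ, 0 < ε ∧ ∃ R : ℝ, 0 < R ∧
    ∀ (J0 : Cn n →L[ℝ] Cn n) (B : Cn n → (Cn n →L[ℝ] Cn n)) (B' : Cn n → Cn n →L[ℝ] (Cn n →L[ℝ] Cn n))
    (B'' : Cn n → Cn n →L[ℝ] (Cn n →L[ℝ] (Cn n →L[ℝ] Cn n))) (v : Cn n),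
    ‖J0‖ ≤ Λ → (∀ u, J0 (J0 u) = -u) → GB B B' R ε → GB B' B'' R ε → B 0 = 0 → ‖v‖ ≤ 1 →
    ∃ h : ℂ → Cn n, h 0 = 0 ∧ (∀ z, ‖h z‖ ≤ R) ∧ ∀ z, ‖z‖ < 1/4 → ∃ L : ℂ →L[ℝ] Cn n, HasFDerivAt h L z ∧
      L Complex.I = J0 (L 1) + B (h z) (L 1) ∧ (z = 0 → L 1 = v) := by
  have hz : ‖(0 : Cn n →L[ℝ] Cn n)‖ ≤ Λ := by simpa using hΛ
  have hK := K2_nn _ hz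
  refine ⟨1 / (1024 * (1 + (2 * K2 Λ + 1)) ^ 2 * (2 * K2 Λ + 1) ^ 2), by positivity, 2 * K2 Λ + 1, by positivity, ?_⟩
  intro J0 B B' B'' v hJ hJ2 h h' hB hv
  obtain ⟨b, hb, hN⟩ := exists_fix hJ rfl h h' hB (by
    apply le_of_eq
    field_simp) hv
  have hf := (NN_XB hJ rfl h h' hB hv hb).2.1
  refine ⟨fun z => FF J0 v b (lft z), FF_zero J0 v b, fun z => hf.sup _, fun z hz => ?_⟩
  obtain ⟨L, hL, h1, hI⟩ := FF_diff J0 hJ2 v b hz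
  refine ⟨L, hL, ?_, fun h0 => ?_⟩
  · rw [hI, h1, ← hN]; rfl
  · rw [h1, h0, FX_zero]


lemma GB_of {E F : Type*} [NormedAddCommGroup E] [NormedSpace ℝ E] [NormedAddCommGroup F] [NormedSpace ℝ F]
    {B : E → F} {B' : E → E →L[ℝ] F} {B'' : E → E →L[ℝ] (E →L[ℝ] F)} {R ε : ℝ}
    (h : ∀ x ∈ closedBall (0:E) R, HasFDerivAt B (B' x) x)
    (h' : ∀ x ∈ closedBall (0:E) R, HasFDerivAt B' (B'' x) x)
    (hb : ∀ x ∈ closedBall (0:E) R, ‖B' x‖ ≤ ε)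
    (hb' : ∀ x ∈ closedBall (0:E) R, ‖B'' x‖ ≤ ε) : GB B B' R ε :=
  ⟨h, hb, fun _ hx _ hy => (convex_closedBall (0:E) R).norm_image_sub_le_of_norm_hasFDerivWithin_le
    (fun z hz => (h' z hz).hasFDerivWithinAt) hb' hy hx⟩

lemma scaled_der {E F : Type*} [NormedAddCommGroup E] [NormedSpace ℝ E] [NormedAddCommGroup F] [NormedSpace ℝ F]
    {G : E → F} {L : E →L[ℝ] F} {p x : E} {δ : ℝ} (c : ℝ) (h : HasFDerivAt G L (p + δ • x)) :
    HasFDerivAt (fun x => c • G (p + δ • x)) ((c * δ) • L) x := by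
  have h1 : HasFDerivAt (fun x : E => p + δ • x) (δ • ContinuousLinearMap.id ℝ E) x :=
    ((hasFDerivAt_id x).const_smul δ).const_add p
  refine ((h.comp x h1).const_smul c).congr_fderiv ?_
  ext u
  simp [smul_smul]

lemma J_all {n : ℕ} {J : Cn n →L[ℝ] Cn n} (hJ : J.comp J = -ContinuousLinearMap.id ℝ (Cn n))
    {D : ℂ →L[ℝ] Cn n} (h : D Complex.I = J (D 1)) (ξ : ℂ) : D (Complex.I * ξ) = J (D ξ) := by
  have hJ2 : ∀ u, J (J u) = -u := fun u => by
    have := congrArg (fun T : Cn n →L[ℝ] Cn n => T u) hJ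
    simpa using this
  have e1 : ξ = ξ.re • (1 : ℂ) + ξ.im • Complex.I := by
    apply Complex.ext <;> simp
  have e2 : Complex.I * ξ = ξ.re • Complex.I - ξ.im • (1 : ℂ) := by
    apply Complex.ext <;> simp
  rw [e2]
  conv_rhs => rw [e1]
  simp only [map_add, map_sub, map_smul, h, hJ2]
  module

lemma KR_le {n : ℕ} {Ω : Set (Cn n)} {J : Cn n → (Cn n →L[ℝ] Cn n)} {p v : Cn n} {r : ℝ} (hr : 0 < r)
    {f : ℂ → Cn n} (hf : IsJHolomorphicOn n Ω J 1 f) (h0 : f 0 = p) (h1 : fderiv ℝ f 0 1 = r • v) :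
    kobayashiRoyden n Ω J p v ≤ ENNReal.ofReal (1 / r) :=
  sInf_le ⟨r, hr, ⟨f, hf, h0, h1⟩, rfl⟩

lemma KR_main {n : ℕ} {Ω : Set (Cn n)} {J : Cn n → (Cn n →L[ℝ] Cn n)} {p : Cn n} {η : ℝ} (hη : 0 < η)
    (H : ∀ v : Cn n, ‖v‖ ≤ 1 → ∃ f : ℂ → Cn n, IsJHolomorphicOn n Ω J 1 f ∧ f 0 = p ∧ fderiv ℝ f 0 1 = η • v)
    (v : Cn n) : kobayashiRoyden n Ω J p v ≤ ENNReal.ofReal (1 / η * ‖v‖) := by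
  by_cases hv : v = 0
  · subst hv
    obtain ⟨f, hf, h0, h1⟩ := H 0 (by simp)
    rw [norm_zero, mul_zero, ENNReal.ofReal_zero]
    refine ENNReal.le_of_forall_pos_le_add (fun ε hε _ => ?_)
    have hε' : (0:ℝ) < ε := hε
    have := KR_le (r := 1 / (ε : ℝ)) (v := 0) (by positivity) hf h0 (by rw [h1]; simp)
    rw [one_div_one_div, ENNReal.ofReal_coe_nnreal] at this
    simpa using this
  · have hn : 0 < ‖v‖ := norm_pos_iff.mpr hv
    obtain ⟨f, hf, h0, h1⟩ := H (‖v‖⁻¹ • v) (by rw [norm_smul, norm_inv, norm_norm, inv_mul_cancel₀ hn.ne'])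
    have := KR_le (r := η * ‖v‖⁻¹) (v := v) (by positivity) hf h0 (by rw [h1, smul_smul])
    convert this using 2
    field_simp

lemma bd_gen {E F : Type*} [NormedAddCommGroup E] [NormedSpace ℝ E] [NormedAddCommGroup F] [NormedSpace ℝ F]
    {Ω K' : Set E} {G : E → F} (hG : ContDiffOn ℝ (⊤ : ℕ∞) G Ω) (hK' : IsCompact K')
    (hK'Ω : K' ⊆ Ω) : ∃ M : ℝ, ∀ x ∈ K', ‖G x‖ ≤ M :=
  hK'.exists_bound_of_continuousOn (hG.continuousOn.mono hK'Ω)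

lemma nsm_le {F : Type*} [NormedAddCommGroup F] [NormedSpace ℝ F] {c m : ℝ} {T : F} (hc : 0 ≤ c)
    (hT : ‖T‖ ≤ m) : ‖c • T‖ ≤ c * m := by
  rw [norm_smul, Real.norm_of_nonneg hc]; gcongr

lemma gb_gen {E F : Type*} [NormedAddCommGroup E] [NormedSpace ℝ E] [NormedAddCommGroup F] [NormedSpace ℝ F]
    {Ω K' : Set E} (hΩ : IsOpen Ω) {G : E → F} (hG : ContDiffOn ℝ (⊤ : ℕ∞) G Ω) (hK' : IsCompact K')
    (hK'Ω : K' ⊆ Ω) : ∃ M : ℝ, 0 < M ∧ ∀ (c δ ε R : ℝ) (p : E), 0 ≤ c → 0 ≤ δ → δ ≤ 1 → c * δ * M ≤ ε →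
      (∀ x ∈ closedBall (0:E) R, p + δ • x ∈ K') →
      GB (fun x => c • G (p + δ • x)) (fun x => (c * δ) • fderiv ℝ G (p + δ • x)) R ε := by
  have s1 : ContDiffOn ℝ (⊤ : ℕ∞) (fderiv ℝ G) Ω := hG.fderiv_of_isOpen hΩ (by simp)
  have s2 : ContDiffOn ℝ (⊤ : ℕ∞) (fderiv ℝ (fderiv ℝ G)) Ω := s1.fderiv_of_isOpen hΩ (by simp)
  obtain ⟨M1, hM1⟩ := bd_gen s1 hK' hK'Ω
  obtain ⟨M2, hM2⟩ := bd_gen s2 hK' hK'Ω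
  have d0 : ∀ x ∈ Ω, HasFDerivAt G (fderiv ℝ G x) x := fun x hx =>
    ((hG.differentiableOn (by simp)).differentiableAt (hΩ.mem_nhds hx)).hasFDerivAt
  have d1 : ∀ x ∈ Ω, HasFDerivAt (fderiv ℝ G) (fderiv ℝ (fderiv ℝ G) x) x := fun x hx =>
    ((s1.differentiableOn (by simp)).differentiableAt (hΩ.mem_nhds hx)).hasFDerivAt
  have b1 : M1 ≤ |M1| + |M2| + 1 := by linarith [le_abs_self M1, abs_nonneg M2]
  have b2 : M2 ≤ |M1| + |M2| + 1 := by linarith [le_abs_self M2, abs_nonneg M1]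
  refine ⟨|M1| + |M2| + 1, by positivity, fun c δ ε R p hc hδ hδ1 hε hmem => ?_⟩
  refine GB_of (B'' := fun x => (c * δ * δ) • fderiv ℝ (fderiv ℝ G) (p + δ • x))
    (fun x hx => scaled_der c (d0 _ (hK'Ω (hmem x hx))))
    (fun x hx => scaled_der (c * δ) (d1 _ (hK'Ω (hmem x hx)))) (fun x hx => ?_) (fun x hx => ?_)
  · rw [norm_smul, Real.norm_of_nonneg (by positivity)]
    refine le_trans ?_ hε
    have := (hM1 _ (hmem x hx)).trans b1
    gcongr
  · refine (nsm_le (by positivity) ((hM2 _ (hmem x hx)).trans b2)).trans (le_trans ?_ hε)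
    have : c * δ * δ ≤ c * δ := mul_le_of_le_one_right (by positivity) hδ1
    gcongr

lemma disc_exists {n : ℕ} {Ω : Set (Cn n)} (hΩ : IsOpen Ω) {J : Cn n → (Cn n →L[ℝ] Cn n)}
    (hJ : IsAlmostComplexOn n Ω J) {K : Set (Cn n)} (hK : IsCompact K) (hKΩ : K ⊆ Ω) :
    ∃ η : ℝ, 0 < η ∧ ∀ p ∈ K, ∀ v : Cn n, ‖v‖ ≤ 1 →
      ∃ f : ℂ → Cn n, IsJHolomorphicOn n Ω J 1 f ∧ f 0 = p ∧ fderiv ℝ f 0 1 = η • v := by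
  obtain ⟨hJs, hJ2⟩ := hJ
  obtain ⟨r, hr, hrΩ⟩ := hK.exists_cthickening_subset_open hΩ hKΩ
  have hK' : IsCompact (cthickening r K) := hK.cthickening
  obtain ⟨M0, hM0⟩ := hK'.exists_bound_of_continuousOn (hJs.continuousOn.mono hrΩ)
  obtain ⟨M1, hM1, g1⟩ := gb_gen hΩ hJs hK' hrΩ
  obtain ⟨M2, hM2, g2⟩ := gb_gen hΩ (hJs.fderiv_of_isOpen (m := (⊤ : ℕ∞)) hΩ (by simp)) hK' hrΩ
  obtain ⟨ε, hε, R, hR, hcore⟩ := core_disc n |M0| (abs_nonneg _)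
  obtain ⟨δ, hδ, hδ1, hδR, hδM1, hδM2⟩ : ∃ δ : ℝ, 0 < δ ∧ δ ≤ 1 ∧ δ * R ≤ r ∧ δ * M1 ≤ ε ∧ δ * M2 ≤ ε := by
    refine ⟨min 1 (min (r / R) (min (ε / M1) (ε / M2))), by positivity, min_le_left _ _, ?_, ?_, ?_⟩
    · rw [← le_div_iff₀ hR]; exact (min_le_right _ _).trans (min_le_left _ _)
    · rw [← le_div_iff₀ hM1]
      exact (min_le_right _ _).trans ((min_le_right _ _).trans (min_le_left _ _))
    · rw [← le_div_iff₀ hM2]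
      exact (min_le_right _ _).trans ((min_le_right _ _).trans (min_le_right _ _))
  refine ⟨δ * (1/4), by positivity, fun p hp v hv => ?_⟩
  have hmem : ∀ x ∈ closedBall (0 : Cn n) R, p + δ • x ∈ cthickening r K := by
    intro x hx
    rw [mem_closedBall_zero_iff] at hx
    refine mem_cthickening_of_dist_le _ p _ _ hp ?_
    rw [dist_eq_norm, add_sub_cancel_left, norm_smul, Real.norm_of_nonneg hδ.le]
    exact (by gcongr : δ * ‖x‖ ≤ δ * R).trans hδR
  have hp0 : p ∈ cthickening r K := self_subset_cthickening _ hp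
  have G1 := g1 1 δ ε R p zero_le_one hδ.le hδ1 (by rwa [one_mul]) hmem
  have G2 := g2 δ δ ε R p hδ.le hδ.le hδ1 (le_trans (by nlinarith [mul_pos hδ hM2]) hδM2) hmem
  simp only [one_smul, one_mul] at G1
  have G1' : GB (fun x => J (p + δ • x) - J p) (fun x => δ • fderiv ℝ J (p + δ • x)) R ε :=
    ⟨fun x hx => (G1.der x hx).sub_const _, G1.bd, G1.lip⟩
  have hJp2 : ∀ u, J p (J p u) = -u := fun u => by
    have := congrArg (fun T : Cn n →L[ℝ] Cn n => T u) (hJ2 p (hKΩ hp))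
    simpa using this
  obtain ⟨h, h0, hsup, hder⟩ := hcore (J p) _ _ _ v ((hM0 p hp0).trans (le_abs_self _)) hJp2
    G1' G2 (by simp) hv
  have hD : ∀ z : ℂ, ‖z‖ < 1 → ∃ D : ℂ →L[ℝ] Cn n, HasFDerivAt (fun z : ℂ => p + δ • h ((1/4 : ℝ) • z)) D z ∧
      D Complex.I = J (p + δ • h ((1/4 : ℝ) • z)) (D 1) ∧ (z = 0 → D 1 = (δ * (1/4)) • v) := by
    intro z hz
    obtain ⟨L, hL, hLI, hL1⟩ := hder ((1/4 : ℝ) • z) (by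
      rw [norm_smul, Real.norm_of_nonneg (by norm_num)]; linarith)
    have hs : HasFDerivAt (fun z : ℂ => (1/4 : ℝ) • z) ((1/4 : ℝ) • ContinuousLinearMap.id ℝ ℂ) z :=
      (hasFDerivAt_id z).const_smul (1/4 : ℝ)
    refine ⟨_, ((hL.comp z hs).const_smul δ).const_add p, ?_, fun hz0 => ?_⟩
    · simp only [smul_apply, ContinuousLinearMap.comp_apply, ContinuousLinearMap.id_apply, map_smul, hLI,
        sub_apply]
      congr 2
      abel
    · simp only [smul_apply, ContinuousLinearMap.comp_apply, ContinuousLinearMap.id_apply, map_smul]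
      rw [hL1 (by rw [hz0, smul_zero]), smul_smul]
  refine ⟨fun z => p + δ • h ((1/4 : ℝ) • z), ⟨fun z hz => ?_, fun z hz => ?_⟩, by simp [h0], ?_⟩
  · exact hrΩ (hmem _ (by simpa using hsup _))
  · obtain ⟨D, hD1, hD2, -⟩ := hD z (by simpa using hz)
    refine ⟨hD1.differentiableAt, fun ξ => ?_⟩
    rw [hD1.fderiv]
    exact J_all (hJ2 _ (hrΩ (hmem _ (by simpa using hsup _)))) hD2 ξ
  · obtain ⟨D, hD1, -, hD3⟩ := hD 0 (by simp)
    rw [hD1.fderiv]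
    exact hD3 rfl

/-- on a compact set with nonempty interior on which `J` is tamed by an
exact symplectic form `ω = dα`, the Kobayashi–Royden pseudonorm is bounded above by a
constant multiple of the standard norm. -/
theorem kobayashiRoyden_le_of_tamed
    (n : ℕ) (hn : 1 ≤ n) (Ω : Set (Cn n)) (hΩ : IsOpen Ω) (hne : Ω.Nonempty)
    (J : Cn n → (Cn n →L[ℝ] Cn n)) (hJ : IsAlmostComplexOn n Ω J)
    (K : Set (Cn n)) (hKc : IsCompact K) (hKΩ : K ⊆ Ω) (hKint : (interior K).Nonempty)
    (α : Cn n → (Cn n →L[ℝ] ℝ)) (hα : ContDiffOn ℝ (⊤ : ℕ∞) α Ω)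
    (htame : ∀ x ∈ K, ∀ ξ : Cn n, ξ ≠ 0 →
      0 < fderiv ℝ α x ξ (J x ξ) - fderiv ℝ α x (J x ξ) ξ) :
    ∃ C : ℝ, 0 < C ∧ ∀ p ∈ K, ∀ v : Cn n,
      kobayashiRoyden n Ω J p v ≤ ENNReal.ofReal (C * ‖v‖) := by
  obtain ⟨η, hη, H⟩ := disc_exists hΩ hJ hKc hKΩ
  exact ⟨1 / η, by positivity, fun p hp v => KR_main hη (H p hp) v⟩
end
end

section
/- For every p ∈ Ω and every v ∈ ℂⁿ there exist r > 0 and a J-holomorphic map f : 𝔻 → Ω with f(0) = p and Df_0(1) = r·v. Consequently the Kobayashi–Royden pseudonorm is finite: F_Ω(p, v) < ∞ for all (p, v) ∈ Ω × ℂⁿ. -/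
open Metric Set Filter
open scoped ENNReal Topology

noncomputable section

section KRAux
open MeasureTheory BoundedContinuousFunction

/-- ambient space -/
def X1 (F : Type*) [NormedAddCommGroup F] [NormedSpace ℝ F] :=
  (ℂ →ᵇ F) × (ℂ →ᵇ (ℂ →L[ℝ] F))

instance (F : Type*) [NormedAddCommGroup F] [NormedSpace ℝ F] : NormedAddCommGroup (X1 F) :=
  inferInstanceAs (NormedAddCommGroup ((ℂ →ᵇ F) × (ℂ →ᵇ (ℂ →L[ℝ] F))))

instance (F : Type*) [NormedAddCommGroup F] [NormedSpace ℝ F] : NormedSpace ℝ (X1 F) :=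
  inferInstanceAs (NormedSpace ℝ ((ℂ →ᵇ F) × (ℂ →ᵇ (ℂ →L[ℝ] F))))

instance (F : Type*) [NormedAddCommGroup F] [NormedSpace ℝ F] [CompleteSpace F] :
    CompleteSpace (X1 F) :=
  inferInstanceAs (CompleteSpace ((ℂ →ᵇ F) × (ℂ →ᵇ (ℂ →L[ℝ] F))))

/-- bounded `C¹` maps on the plane with bounded derivative -/
def C1b (F : Type*) [NormedAddCommGroup F] [NormedSpace ℝ F] :
    Submodule ℝ (X1 F) where
  carrier := {u | ∀ z, HasFDerivAt (fun y => u.1 y) (u.2 z) z}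
  add_mem' := by
    intro a b ha hb z
    exact (ha z).add (hb z)
  zero_mem' := by
    intro z
    exact hasFDerivAt_const (0:F) z
  smul_mem' := by
    intro c a ha z
    exact (ha z).const_smul c

variable {F G : Type*} [NormedAddCommGroup F] [NormedSpace ℝ F]
  [NormedAddCommGroup G] [NormedSpace ℝ G]

lemma C1b_isClosed : IsClosed (C1b F : Set (X1 F)) := by
  apply isClosed_of_closure_subset
  intro u hu
  obtain ⟨x, hx, hlim⟩ := mem_closure_iff_seq_limit.1 hu
  intro z
  have h1 : Tendsto (fun n => (x n).1) atTop (𝓝 u.1) := ((continuous_fst (X := ℂ →ᵇ F) (Y := ℂ →ᵇ (ℂ →L[ℝ] F))).tendsto u).comp hlim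
  have h2 : Tendsto (fun n => (x n).2) atTop (𝓝 u.2) := ((continuous_snd (X := ℂ →ᵇ F) (Y := ℂ →ᵇ (ℂ →L[ℝ] F))).tendsto u).comp hlim
  have h1' := BoundedContinuousFunction.tendsto_iff_tendstoUniformly.1 h1
  have h2' := BoundedContinuousFunction.tendsto_iff_tendstoUniformly.1 h2
  exact hasFDerivAt_of_tendstoUniformly (f := fun n y => (x n).1 y) h2' (fun n y => hx n y)
    (fun y => h1'.tendsto_at y) z

instance [CompleteSpace F] : CompleteSpace (C1b F) :=
  C1b_isClosed.completeSpace_coe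

lemma C1b_hasFDerivAt (u : C1b F) (z : ℂ) : HasFDerivAt (fun y => u.1.1 y) (u.1.2 z) z := u.2 z

lemma C1b_norm1 (u : C1b F) (z : ℂ) : ‖u.1.1 z‖ ≤ ‖u‖ :=
  (u.1.1.norm_coe_le_norm z).trans (norm_fst_le (E := ℂ →ᵇ F) (F := ℂ →ᵇ (ℂ →L[ℝ] F)) u.1)

lemma C1b_norm2 (u : C1b F) (z : ℂ) : ‖u.1.2 z‖ ≤ ‖u‖ :=
  (u.1.2.norm_coe_le_norm z).trans (norm_snd_le (E := ℂ →ᵇ F) (F := ℂ →ᵇ (ℂ →L[ℝ] F)) u.1)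

lemma C1b_norm_le (u : C1b F) {C : ℝ} (hC : 0 ≤ C) (h1 : ∀ z, ‖u.1.1 z‖ ≤ C)
    (h2 : ∀ z, ‖u.1.2 z‖ ≤ C) : ‖u‖ ≤ C := by
  change max ‖u.1.1‖ ‖u.1.2‖ ≤ C
  exact max_le ((BoundedContinuousFunction.norm_le hC).2 h1)
    ((BoundedContinuousFunction.norm_le hC).2 h2)

def C1b.mk' (f : ℂ → F) (f' : ℂ → ℂ →L[ℝ] F) (C : ℝ) (hd : ∀ z, HasFDerivAt f (f' z) z)
    (hc : Continuous f') (h1 : ∀ z, ‖f z‖ ≤ C) (h2 : ∀ z, ‖f' z‖ ≤ C) : C1b F :=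
  ⟨(BoundedContinuousFunction.ofNormedAddCommGroup f
      (continuous_iff_continuousAt.2 fun z => (hd z).continuousAt) C h1,
    BoundedContinuousFunction.ofNormedAddCommGroup f' hc C h2), hd⟩

lemma C1b_ext (u v : C1b F) (h : ∀ z, u.1.1 z = v.1.1 z) : u = v := by
  apply Subtype.ext
  apply Prod.ext
  · ext z; exact h z
  · apply DFunLike.ext
    intro z
    have := C1b_hasFDerivAt u z
    have h' : (fun y => u.1.1 y) = (fun y => v.1.1 y) := funext h
    rw [h'] at this
    exact this.unique (C1b_hasFDerivAt v z)

lemma C1b_mkCLM (T : C1b G → ℂ → F) (T' : C1b G → ℂ → ℂ →L[ℝ] F) (C : ℝ)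
    (hadd : ∀ a b z, T (a + b) z = T a z + T b z)
    (hsmul : ∀ (c : ℝ) a z, T (c • a) z = c • T a z)
    (hd : ∀ a z, HasFDerivAt (T a) (T' a z) z)
    (hc : ∀ a, Continuous (T' a))
    (h1 : ∀ a z, ‖T a z‖ ≤ C * ‖a‖) (h2 : ∀ a z, ‖T' a z‖ ≤ C * ‖a‖) (hC : 0 ≤ C) :
    ∃ L : C1b G →L[ℝ] C1b F, ∀ a z, (L a).1.1 z = T a z := by
  refine ⟨LinearMap.mkContinuous
    { toFun := fun a => C1b.mk' (T a) (T' a) (C * ‖a‖) (hd a) (hc a) (h1 a) (h2 a)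
      map_add' := fun a b => C1b_ext _ _ (hadd a b)
      map_smul' := fun c a => C1b_ext _ _ (hsmul c a) } C ?_, fun a z => rfl⟩
  intro a
  exact C1b_norm_le _ (by positivity) (h1 a) (h2 a)

/-- superposition operator -/
lemma C1b_superpos (A : F → G) (hA : ContDiffAt ℝ 2 A 0) (hA0 : A 0 = 0) (δ₀ : ℝ) (hδ₀ : 0 < δ₀) :
    ∃ L > 0, ∃ δ > 0, δ ≤ δ₀ ∧ ∀ δ' ≤ δ, ∃ N : closedBall (0 : C1b F) δ' → C1b G,
      (∀ u z, (N u).1.1 z = A (u.1.1.1 z)) ∧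
      (∀ u v, ‖N u - N v‖ ≤ L * ‖u.1 - v.1‖) := by
  have hA' : ContDiffAt ℝ 1 (fderiv ℝ A) 0 := hA.fderiv_right (m := 1) (by norm_num)
  obtain ⟨K, t, ht, hK⟩ := hA'.exists_lipschitzOnWith
  have hdiff : ∀ᶠ x in 𝓝 (0:F), DifferentiableAt ℝ A x := by
    have := hA.eventually (by simp)
    filter_upwards [this] with x hx
    exact hx.differentiableAt (by simp)
  obtain ⟨r, hr, hball⟩ := Metric.mem_nhds_iff.1 (Filter.inter_mem ht hdiff)
  set δ := min (min (r/2) δ₀) 1 with hδ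
  have hδpos : 0 < δ := by positivity
  have hδr : δ < r := lt_of_le_of_lt ((min_le_left _ _).trans (min_le_left _ _)) (by linarith)
  have hδ1 : δ ≤ 1 := min_le_right _ _
  set M := ‖fderiv ℝ A 0‖ + K with hM
  have hMpos : 0 ≤ M := by positivity
  have hsub : ∀ x ∈ closedBall (0:F) δ, x ∈ t ∧ DifferentiableAt ℝ A x := fun x hx =>
    hball (closedBall_subset_ball hδr hx)
  have hbd : ∀ x ∈ closedBall (0:F) δ, ‖fderiv ℝ A x‖ ≤ M := by
    intro x hx
    have h := hK.dist_le_mul x (hsub x hx).1 0 (hsub 0 (by simp [hδpos.le])).1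
    rw [dist_eq_norm, dist_eq_norm, sub_zero] at h
    have hx1 : ‖x‖ ≤ 1 := by simpa using (mem_closedBall_zero_iff.1 hx).trans hδ1
    have h2 : ‖fderiv ℝ A x‖ ≤ ‖fderiv ℝ A 0‖ + ‖fderiv ℝ A x - fderiv ℝ A 0‖ := by
      have := norm_add_le (fderiv ℝ A 0) (fderiv ℝ A x - fderiv ℝ A 0)
      simpa using this
    have : (K:ℝ) * ‖x‖ ≤ K := by
      have := mul_le_mul_of_nonneg_left hx1 K.2
      simpa using this
    linarith
  have hlip : ∀ x ∈ closedBall (0:F) δ, ∀ y ∈ closedBall (0:F) δ, ‖A x - A y‖ ≤ M * ‖x - y‖ := by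
    intro x hx y hy
    exact (convex_closedBall (0:F) δ).norm_image_sub_le_of_norm_fderiv_le
      (fun x hx => (hsub x hx).2) hbd hy hx
  refine ⟨2 * M + 1 + K, by positivity, δ, hδpos, (min_le_left _ _).trans (min_le_right _ _), ?_⟩
  intro δ' hδ'
  have hmem : ∀ (u : closedBall (0 : C1b F) δ') z, u.1.1.1 z ∈ closedBall (0:F) δ := by
    intro u z
    rw [mem_closedBall_zero_iff]
    exact (C1b_norm1 u.1 z).trans ((mem_closedBall_zero_iff.1 u.2).trans hδ')
  have hn2 : ∀ (u : closedBall (0 : C1b F) δ') z, ‖u.1.1.2 z‖ ≤ 1 := by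
    intro u z
    exact (C1b_norm2 u.1 z).trans ((mem_closedBall_zero_iff.1 u.2).trans (hδ'.trans hδ1))
  refine ⟨fun u => C1b.mk' (fun z => A (u.1.1.1 z)) (fun z => (fderiv ℝ A (u.1.1.1 z)).comp (u.1.1.2 z))
    M ?_ ?_ ?_ ?_, fun u z => rfl, ?_⟩
  · intro z
    exact (hsub _ (hmem u z)).2.hasFDerivAt.comp z (C1b_hasFDerivAt u.1 z)
  · refine Continuous.clm_comp ?_ u.1.1.2.continuous
    have hcont : ContinuousOn (fderiv ℝ A) (closedBall (0:F) δ) :=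
      hK.continuousOn.mono fun x hx => (hsub x hx).1
    exact hcont.comp_continuous u.1.1.1.continuous (hmem u)
  · intro z
    have := hlip _ (hmem u z) 0 (by simp [hδpos.le])
    rw [hA0, sub_zero, sub_zero] at this
    refine this.trans ?_
    have h1 : ‖u.1.1.1 z‖ ≤ 1 := (mem_closedBall_zero_iff.1 (hmem u z)).trans hδ1
    nlinarith
  · intro z
    refine (ContinuousLinearMap.opNorm_comp_le _ _).trans ?_
    have := hbd _ (hmem u z)
    have := hn2 u z
    nlinarith [norm_nonneg (u.1.1.2 z)]
  · intro u v
    have hn := norm_nonneg (u.1 - v.1)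
    have hK0 : (0:ℝ) ≤ K := K.2
    refine C1b_norm_le _ (by positivity) ?_ ?_
    · intro z
      change ‖A (u.1.1.1 z) - A (v.1.1.1 z)‖ ≤ _
      refine (hlip _ (hmem u z) _ (hmem v z)).trans ?_
      have h1 : ‖u.1.1.1 z - v.1.1.1 z‖ ≤ ‖u.1 - v.1‖ := C1b_norm1 (u.1 - v.1) z
      have := norm_nonneg (u.1.1.1 z - v.1.1.1 z)
      nlinarith
    · intro z
      change ‖(fderiv ℝ A (u.1.1.1 z)).comp (u.1.1.2 z) - (fderiv ℝ A (v.1.1.1 z)).comp (v.1.1.2 z)‖ ≤ _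
      have e : (fderiv ℝ A (u.1.1.1 z)).comp (u.1.1.2 z) - (fderiv ℝ A (v.1.1.1 z)).comp (v.1.1.2 z)
        = (fderiv ℝ A (u.1.1.1 z)).comp (u.1.1.2 z - v.1.1.2 z) +
          (fderiv ℝ A (u.1.1.1 z) - fderiv ℝ A (v.1.1.1 z)).comp (v.1.1.2 z) := by
        simp
      rw [e]
      have h1 : ‖u.1.1.1 z - v.1.1.1 z‖ ≤ ‖u.1 - v.1‖ := C1b_norm1 (u.1 - v.1) z
      have h2 : ‖u.1.1.2 z - v.1.1.2 z‖ ≤ ‖u.1 - v.1‖ := C1b_norm2 (u.1 - v.1) z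
      have h3 := hK.dist_le_mul _ (hsub _ (hmem u z)).1 _ (hsub _ (hmem v z)).1
      rw [dist_eq_norm, dist_eq_norm] at h3
      have h4 := hbd _ (hmem u z)
      have h5 := hn2 v z
      have a1 : ‖(fderiv ℝ A (u.1.1.1 z)).comp (u.1.1.2 z - v.1.1.2 z)‖ ≤ M * ‖u.1 - v.1‖ :=
        (ContinuousLinearMap.opNorm_comp_le _ _).trans
          (mul_le_mul h4 h2 (norm_nonneg _) hMpos)
      have a2 : ‖(fderiv ℝ A (u.1.1.1 z) - fderiv ℝ A (v.1.1.1 z)).comp (v.1.1.2 z)‖ ≤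
          (K * ‖u.1 - v.1‖) * 1 :=
        (ContinuousLinearMap.opNorm_comp_le _ _).trans
          (mul_le_mul (h3.trans (mul_le_mul_of_nonneg_left h1 hK0)) h5 (norm_nonneg _) (by positivity))
      have := norm_add_le ((fderiv ℝ A (u.1.1.1 z)).comp (u.1.1.2 z - v.1.1.2 z))
        ((fderiv ℝ A (u.1.1.1 z) - fderiv ℝ A (v.1.1.1 z)).comp (v.1.1.2 z))
      nlinarith

lemma C1b_fixed {H : Type*} [NormedAddCommGroup H] [NormedSpace ℝ H] [CompleteSpace F]
    (T : C1b G →L[ℝ] C1b F) (S : C1b H →L[ℝ] C1b F)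
    (A : F → G) (hA : ContDiffAt ℝ 2 A 0) (hA0 : A 0 = 0)
    (B : F → H) (hB : ContDiffAt ℝ 2 B 0) (hB0 : B 0 = 0) (δ₀ : ℝ) (hδ₀ : 0 < δ₀) :
    ∃ η > (0:ℝ), η ≤ 1 ∧ ∃ ε > (0:ℝ), ∀ v : F, ‖v‖ ≤ ε → ∃ u : C1b F, ‖u‖ ≤ δ₀ ∧
      ∃ a : C1b G, ∃ b : C1b H, (∀ z, a.1.1 z = A (u.1.1 z)) ∧ (∀ z, b.1.1 z = B (u.1.1 z)) ∧
        ∀ z, u.1.1 z = v + η • (T a).1.1 z + η • (S b).1.1 z := by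
  obtain ⟨L₁, hL₁, δ₁, hδ₁, h₁, H₁⟩ := C1b_superpos A hA hA0 δ₀ hδ₀
  obtain ⟨L₂, hL₂, δ₂, hδ₂, h₂, H₂⟩ := C1b_superpos B hB hB0 δ₁ hδ₁
  obtain ⟨NA, hNA, hNA'⟩ := H₁ δ₂ h₂
  obtain ⟨NB, hNB, hNB'⟩ := H₂ δ₂ le_rfl
  set Q := ‖T‖ * L₁ + ‖S‖ * L₂ with hQ
  have hQ0 : 0 ≤ Q := by positivity
  refine ⟨1 / (2 * Q + 1), by positivity, ?_, δ₂ / 2, by positivity, ?_⟩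
  · rw [div_le_one (by positivity)]; linarith
  intro v hv
  set η := 1 / (2 * Q + 1) with hη
  have hηpos : 0 < η := by positivity
  have hηQ : η * Q ≤ 1 / 2 := by
    rw [hη, div_mul_eq_mul_div, div_le_iff₀ (by positivity)]; linarith
  let vc : C1b F := C1b.mk' (fun _ => v) (fun _ => 0) ‖v‖ (fun z => hasFDerivAt_const v z)
    continuous_const (fun _ => le_rfl) (fun _ => by simp)
  have hvc : ‖vc‖ ≤ δ₂ / 2 :=
    (C1b_norm_le vc (norm_nonneg v) (fun _ => le_rfl) (fun _ => by simp [vc, C1b.mk'])).trans hv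
  let Φ : closedBall (0 : C1b F) δ₂ → C1b F := fun u => vc + η • T (NA u) + η • S (NB u)
  have hlip : ∀ u w, ‖Φ u - Φ w‖ ≤ 1 / 2 * ‖u.1 - w.1‖ := by
    intro u w
    have e : Φ u - Φ w = η • T (NA u - NA w) + η • S (NB u - NB w) := by
      simp only [Φ, map_sub, smul_sub]; abel
    rw [e]
    have a1 := (T.le_opNorm (NA u - NA w)).trans (mul_le_mul_of_nonneg_left (hNA' u w) (norm_nonneg T))
    have a2 := (S.le_opNorm (NB u - NB w)).trans (mul_le_mul_of_nonneg_left (hNB' u w) (norm_nonneg S))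
    refine (norm_add_le _ _).trans ?_
    rw [norm_smul, norm_smul, Real.norm_of_nonneg hηpos.le]
    have := norm_nonneg (u.1 - w.1)
    calc _ ≤ η * (‖T‖ * (L₁ * ‖u.1 - w.1‖)) + η * (‖S‖ * (L₂ * ‖u.1 - w.1‖)) := by gcongr
      _ = (η * Q) * ‖u.1 - w.1‖ := by rw [hQ]; ring
      _ ≤ _ := by gcongr
  have h0mem : (0 : C1b F) ∈ closedBall (0 : C1b F) δ₂ := by simp [hδ₂.le]
  have hΦ0 : Φ ⟨0, h0mem⟩ = vc := by
    have e1 : NA ⟨0, h0mem⟩ = 0 := C1b_ext _ _ fun z => by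
      rw [hNA]; exact hA0
    have e2 : NB ⟨0, h0mem⟩ = 0 := C1b_ext _ _ fun z => by
      rw [hNB]; exact hB0
    simp [Φ, e1, e2]
  have hmaps : ∀ u, Φ u ∈ closedBall (0 : C1b F) δ₂ := by
    intro u
    rw [mem_closedBall_zero_iff]
    have h := hlip u ⟨0, h0mem⟩
    rw [hΦ0, sub_zero] at h
    have hu : ‖u.1‖ ≤ δ₂ := mem_closedBall_zero_iff.1 u.2
    have := norm_add_le vc (Φ u - vc)
    rw [add_sub_cancel] at this
    linarith
  let Ψ : closedBall (0 : C1b F) δ₂ → closedBall (0 : C1b F) δ₂ := fun u => ⟨Φ u, hmaps u⟩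
  have hcontr : ContractingWith (1/2) Ψ := by
    refine ⟨by norm_num, LipschitzWith.of_dist_le_mul fun u w => ?_⟩
    have h := hlip u w
    rw [← dist_eq_norm, ← dist_eq_norm] at h
    have e : ((1 / 2 : NNReal) : ℝ) = 1 / 2 := by norm_num
    rw [e]
    exact h
  have : CompleteSpace (closedBall (0 : C1b F) δ₂) := isClosed_closedBall.completeSpace_coe
  have : Nonempty (closedBall (0 : C1b F) δ₂) := ⟨⟨0, h0mem⟩⟩
  have hfix := hcontr.fixedPoint_isFixedPt
  set u := ContractingWith.fixedPoint Ψ hcontr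
  have hu : Φ u = u.1 := congrArg Subtype.val hfix
  refine ⟨u.1, (mem_closedBall_zero_iff.1 u.2).trans (h₂.trans h₁), NA u, NB u, hNA u, hNB u, ?_⟩
  intro z
  conv_lhs => rw [← hu]
  rfl
end KRAux

section KRAux2
open MeasureTheory BoundedContinuousFunction
variable {F G : Type*} [NormedAddCommGroup F] [NormedSpace ℝ F]
  [NormedAddCommGroup G] [NormedSpace ℝ G]

/-- derivative field of the radial integral -/
def radD (a : ℂ → ℂ →L[ℝ] F) (a' : ℂ → ℂ →L[ℝ] ℂ →L[ℝ] F) (z : ℂ) (t : ℝ) : ℂ →L[ℝ] F :=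
  a (t • z) + t • (a' (t • z)).flip z

lemma radD_cont (a : ℂ → ℂ →L[ℝ] F) (a' : ℂ → ℂ →L[ℝ] ℂ →L[ℝ] F)
    (ha : Continuous a) (ha' : Continuous a') :
    Continuous (Function.uncurry (radD a a')) := by
  unfold radD Function.uncurry
  have h : Continuous fun p : ℂ × ℝ => (a' (p.2 • p.1)).flip := 
    (ContinuousLinearMap.flipₗᵢ ℝ ℂ ℂ F).continuous.comp (by fun_prop)
  fun_prop

lemma rad_hasFDerivAt (a : ℂ → ℂ →L[ℝ] F) (a' : ℂ → ℂ →L[ℝ] ℂ →L[ℝ] F)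
    (had : ∀ z, HasFDerivAt a (a' z) z) (ha' : Continuous a') (M : ℝ)
    (h1 : ∀ z, ‖a z‖ ≤ M) (h2 : ∀ z, ‖a' z‖ ≤ M) (z : ℂ) :
    HasFDerivAt (fun z => ∫ t in (0:ℝ)..1, a (t • z) z) (∫ t in (0:ℝ)..1, radD a a' z t) z := by
  have ha : Continuous a := continuous_iff_continuousAt.2 fun z => (had z).continuousAt
  have hM : 0 ≤ M := (norm_nonneg _).trans (h1 0)
  have hc := radD_cont a a' ha ha'
  refine intervalIntegral.hasFDerivAt_integral_of_dominated_of_fderiv_le (𝕜 := ℝ)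
    (F := fun z (t:ℝ) => a (t • z) z) (F' := radD a a') (bound := fun _ => M + M * (‖z‖ + 1))
    (ball_mem_nhds z one_pos) ?_ ?_ ?_ ?_ ?_ ?_
  · refine Eventually.of_forall fun x => ?_
    exact (by fun_prop : Continuous fun t : ℝ => a (t • x) x).aestronglyMeasurable
  · exact (by fun_prop : Continuous fun t : ℝ => a (t • z) z).intervalIntegrable _ _
  · exact (hc.comp (by fun_prop : Continuous fun t : ℝ => (z, t))).aestronglyMeasurable
  · refine Eventually.of_forall fun t ht x hx => ?_
    rw [uIoc_of_le zero_le_one] at ht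
    have hx' : ‖x‖ ≤ ‖z‖ + 1 := by
      have := norm_add_le z (x - z)
      rw [add_sub_cancel] at this
      have h := (mem_ball_iff_norm.1 hx).le
      linarith
    unfold radD
    refine (norm_add_le _ _).trans (add_le_add (h1 _) ?_)
    rw [norm_smul, Real.norm_of_nonneg ht.1.le]
    have e1 : ‖(a' (t • x)).flip x‖ ≤ M * (‖z‖ + 1) := by
      refine ((a' (t • x)).flip.le_opNorm x).trans ?_
      rw [ContinuousLinearMap.opNorm_flip]
      exact mul_le_mul (h2 _) hx' (norm_nonneg _) hM
    calc _ ≤ 1 * (M * (‖z‖ + 1)) := mul_le_mul ht.2 e1 (norm_nonneg _) zero_le_one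
      _ = _ := one_mul _
  · exact intervalIntegrable_const
  · refine Eventually.of_forall fun t ht x hx => ?_
    have e1 : HasFDerivAt (fun x : ℂ => t • x) (t • ContinuousLinearMap.id ℝ ℂ) x :=
      (hasFDerivAt_id x).const_smul t
    have e2 : HasFDerivAt (fun x : ℂ => a (t • x)) ((a' (t • x)).comp (t • ContinuousLinearMap.id ℝ ℂ)) x :=
      (had (t • x)).comp x e1
    have e3 := e2.clm_apply (hasFDerivAt_id x)
    refine HasFDerivAt.congr_fderiv e3 ?_
    refine ContinuousLinearMap.ext fun h => ?_
    simp [radD]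

lemma rad_norm (a : ℂ → ℂ →L[ℝ] F) (M : ℝ) (h1 : ∀ z, ‖a z‖ ≤ M) (z : ℂ) :
    ‖∫ t in (0:ℝ)..1, a (t • z) z‖ ≤ M * ‖z‖ := by
  have := intervalIntegral.norm_integral_le_of_norm_le_const (a := (0:ℝ)) (b := 1)
    (f := fun t : ℝ => a (t • z) z) (C := M * ‖z‖) (fun t ht =>
      ((a (t • z)).le_opNorm z).trans (mul_le_mul_of_nonneg_right (h1 _) (norm_nonneg _)))
  simpa using this

lemma radD_norm (a : ℂ → ℂ →L[ℝ] F) (a' : ℂ → ℂ →L[ℝ] ℂ →L[ℝ] F) (M : ℝ)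
    (h1 : ∀ z, ‖a z‖ ≤ M) (h2 : ∀ z, ‖a' z‖ ≤ M) (z : ℂ) :
    ‖∫ t in (0:ℝ)..1, radD a a' z t‖ ≤ M + M * ‖z‖ := by
  have := intervalIntegral.norm_integral_le_of_norm_le_const (a := (0:ℝ)) (b := 1)
    (f := fun t : ℝ => radD a a' z t) (C := M + M * ‖z‖) (fun t ht => by
      rw [uIoc_of_le zero_le_one] at ht
      unfold radD
      refine (norm_add_le _ _).trans (add_le_add (h1 _) ?_)
      rw [norm_smul, Real.norm_of_nonneg ht.1.le]
      have e1 : ‖(a' (t • z)).flip z‖ ≤ M * ‖z‖ := by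
        refine ((a' (t • z)).flip.le_opNorm z).trans ?_
        rw [ContinuousLinearMap.opNorm_flip]
        exact mul_le_mul_of_nonneg_right (h2 _) (norm_nonneg _)
      calc _ ≤ 1 * (M * ‖z‖) := mul_le_mul ht.2 e1 (norm_nonneg _) zero_le_one
        _ = _ := one_mul _)
  simpa using this

lemma exists_rad (χ : ℂ → ℝ) (hχ : ContDiff ℝ 1 χ) (r : ℝ) (hr : 0 ≤ r)
    (hs : ∀ z, r ≤ ‖z‖ → χ z = 0) :
    ∃ T : C1b (ℂ →L[ℝ] F) →L[ℝ] C1b F, ∀ a z,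
      (T a).1.1 z = χ z • ∫ t in (0:ℝ)..1, a.1.1 (t • z) z := by
  have hχcs : HasCompactSupport χ := by
    refine HasCompactSupport.intro (isCompact_closedBall (0:ℂ) r) fun z hz => hs z ?_
    simp at hz; exact hz.le
  obtain ⟨C₀, hC₀⟩ := hχ.continuous.bounded_above_of_compact_support hχcs
  obtain ⟨C₁, hC₁⟩ := (hχ.continuous_fderiv one_ne_zero).bounded_above_of_compact_support
    (hχcs.fderiv ℝ)
  have hC₀' : 0 ≤ C₀ := (norm_nonneg _).trans (hC₀ 0)
  have hC₁' : 0 ≤ C₁ := (norm_nonneg _).trans (hC₁ 0)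
  have hs' : ∀ z, r < ‖z‖ → fderiv ℝ χ z = 0 := by
    intro z hz
    have : χ =ᶠ[𝓝 z] fun _ => 0 := by
      filter_upwards [continuous_norm.continuousAt.eventually (lt_mem_nhds hz)] with y hy
      exact hs y (le_of_lt hy)
    rw [this.fderiv_eq]; simp
  have hcont : ∀ a : C1b (ℂ →L[ℝ] F), Continuous fun z => ∫ t in (0:ℝ)..1, a.1.1 (t • z) z := by
    intro a
    refine intervalIntegral.continuous_parametric_intervalIntegral_of_continuous' ?_ _ _
    unfold Function.uncurry
    have := a.1.1.continuous
    fun_prop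
  refine C1b_mkCLM (fun (a : C1b (ℂ →L[ℝ] F)) z => χ z • ∫ t in (0:ℝ)..1, a.1.1 (t • z) z)
    (fun (a : C1b (ℂ →L[ℝ] F)) z => χ z • (∫ t in (0:ℝ)..1, radD a.1.1 a.1.2 z t) +
      (fderiv ℝ χ z).smulRight (∫ t in (0:ℝ)..1, a.1.1 (t • z) z))
    (C₀ * (1 + r) + C₁ * r) ?_ ?_ ?_ ?_ ?_ ?_ (by positivity)
  · intro a b z
    rw [← smul_add, ← intervalIntegral.integral_add]
    · rfl
    · exact Continuous.intervalIntegrable (by have := a.1.1.continuous; fun_prop) _ _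
    · exact Continuous.intervalIntegrable (by have := b.1.1.continuous; fun_prop) _ _
  · intro c a z
    rw [smul_comm c (χ z)]
    congr 1
    rw [← intervalIntegral.integral_smul]
    rfl
  · intro a z
    exact (hχ.differentiable one_ne_zero z).hasFDerivAt.smul
      (rad_hasFDerivAt a.1.1 a.1.2 (C1b_hasFDerivAt a) a.1.2.continuous ‖a‖ (C1b_norm1 a)
        (C1b_norm2 a) z)
  · intro a
    have h1 : Continuous fun z => ∫ t in (0:ℝ)..1, radD a.1.1 a.1.2 z t :=
      intervalIntegral.continuous_parametric_intervalIntegral_of_continuous'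
        (radD_cont _ _ a.1.1.continuous a.1.2.continuous) _ _
    have h2 := hcont a
    have h3 := hχ.continuous
    have h4 := hχ.continuous_fderiv one_ne_zero
    refine (h3.smul h1).add ?_
    exact ((ContinuousLinearMap.smulRightL ℝ ℂ F).continuous.comp h4).clm_apply h2
  · intro a z
    by_cases hz : r ≤ ‖z‖
    · rw [hs z hz, zero_smul, norm_zero]; positivity
    · push Not at hz
      rw [norm_smul]
      have := rad_norm a.1.1 ‖a‖ (C1b_norm1 a) z
      have hn := norm_nonneg a
      calc _ ≤ C₀ * (‖a‖ * r) := mul_le_mul (hC₀ z) (this.trans (by gcongr)) (norm_nonneg _) hC₀'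
        _ ≤ _ := by nlinarith [mul_nonneg hC₀' hn, mul_nonneg (mul_nonneg hC₁' hr) hn]
  · intro a z
    by_cases hz : r < ‖z‖
    · rw [hs z hz.le, hs' z hz, zero_smul, zero_add]
      have : (0 : ℂ →L[ℝ] ℝ).smulRight (∫ t in (0:ℝ)..1, a.1.1 (t • z) z) = 0 := by ext; simp
      rw [this, norm_zero]; positivity
    · push Not at hz
      have h1 := rad_norm a.1.1 ‖a‖ (C1b_norm1 a) z
      have h2 := radD_norm a.1.1 a.1.2 ‖a‖ (C1b_norm1 a) (C1b_norm2 a) z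
      have hn := norm_nonneg a
      refine (norm_add_le _ _).trans ?_
      rw [norm_smul, ContinuousLinearMap.norm_smulRight_apply]
      calc _ ≤ C₀ * (‖a‖ + ‖a‖ * r) + C₁ * (‖a‖ * r) := by
            refine add_le_add (mul_le_mul (hC₀ z) (h2.trans (by gcongr)) (norm_nonneg _) hC₀')
              (mul_le_mul (hC₁ z) (h1.trans (by gcongr)) (norm_nonneg _) hC₁')
        _ = _ := by ring

/-- convolution operator -/
lemma conv_hasFDerivAt (κ : ℂ → G →L[ℝ] F) (hκ : Integrable κ)
    (g : ℂ → G) (g' : ℂ → ℂ →L[ℝ] G) (hg : ∀ z, HasFDerivAt g (g' z) z) (hg' : Continuous g')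
    (M : ℝ) (h1 : ∀ z, ‖g z‖ ≤ M) (h2 : ∀ z, ‖g' z‖ ≤ M) (z : ℂ) :
    HasFDerivAt (fun z => ∫ ζ, κ ζ (g (z - ζ))) (∫ ζ, (κ ζ).comp (g' (z - ζ))) z := by
  have hgc : Continuous g := continuous_iff_continuousAt.2 fun z => (hg z).continuousAt
  have hm : ∀ x, AEStronglyMeasurable (fun ζ => κ ζ (g (x - ζ))) volume := fun x =>
    (ContinuousLinearMap.id ℝ (G →L[ℝ] F)).aestronglyMeasurable_comp₂ hκ.1
      (by fun_prop : Continuous fun ζ => g (x - ζ)).aestronglyMeasurable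
  refine hasFDerivAt_integral_of_dominated_of_fderiv_le (𝕜 := ℝ)
    (F := fun z ζ => κ ζ (g (z - ζ))) (F' := fun z ζ => (κ ζ).comp (g' (z - ζ)))
    (bound := fun ζ => ‖κ ζ‖ * M) univ_mem (Eventually.of_forall hm) ?_ ?_ ?_ ?_ ?_
  · refine (hκ.norm.mul_const M).mono' (hm z) (Eventually.of_forall fun ζ => ?_)
    exact ((κ ζ).le_opNorm _).trans (mul_le_mul_of_nonneg_left (h1 _) (norm_nonneg _))
  · exact (ContinuousLinearMap.compL ℝ ℂ G F).aestronglyMeasurable_comp₂ hκ.1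
      (by fun_prop : Continuous fun ζ => g' (z - ζ)).aestronglyMeasurable
  · refine Eventually.of_forall fun ζ x _ => ?_
    exact ((κ ζ).opNorm_comp_le _).trans (mul_le_mul_of_nonneg_left (h2 _) (norm_nonneg _))
  · exact hκ.norm.mul_const M
  · refine Eventually.of_forall fun ζ x _ => ?_
    have e : HasFDerivAt (fun x => g (x - ζ)) (g' (x - ζ)) x :=
      ((hg (x - ζ)).comp x ((hasFDerivAt_id x).sub_const ζ))
    exact (κ ζ).hasFDerivAt.comp x e

lemma exists_conv (κ : ℂ → G →L[ℝ] F) (hκ : Integrable κ) (χ : ℂ → ℝ) (hχ : ContDiff ℝ 1 χ)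
    (hχcs : HasCompactSupport χ) :
    ∃ T : C1b G →L[ℝ] C1b F, ∀ a z, (T a).1.1 z =
      (∫ ζ, κ ζ (χ (z - ζ) • a.1.1 (z - ζ))) - ∫ ζ, κ ζ (χ (0 - ζ) • a.1.1 (0 - ζ)) := by
  obtain ⟨C₀, hC₀⟩ := hχ.continuous.bounded_above_of_compact_support hχcs
  obtain ⟨C₁, hC₁⟩ := (hχ.continuous_fderiv one_ne_zero).bounded_above_of_compact_support
    (hχcs.fderiv ℝ)
  have hC₀' : 0 ≤ C₀ := (norm_nonneg _).trans (hC₀ 0)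
  have hC₁' : 0 ≤ C₁ := (norm_nonneg _).trans (hC₁ 0)
  have hχc := hχ.continuous
  have hχc' := hχ.continuous_fderiv one_ne_zero
  let g' : C1b G → ℂ → ℂ →L[ℝ] G := fun a z => χ z • a.1.2 z + (fderiv ℝ χ z).smulRight (a.1.1 z)
  have hg : ∀ a z, HasFDerivAt (fun y => χ y • a.1.1 y) (g' a z) z := fun a z =>
    (hχ.differentiable one_ne_zero z).hasFDerivAt.smul (C1b_hasFDerivAt a z)
  have hg' : ∀ a, Continuous (g' a) := by
    intro a
    refine (hχc.smul a.1.2.continuous).add ?_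
    exact ((ContinuousLinearMap.smulRightL ℝ ℂ G).continuous.comp hχc').clm_apply a.1.1.continuous
  have hn1 : ∀ a : C1b G, ∀ z, ‖χ z • a.1.1 z‖ ≤ (C₀ + C₁) * ‖a‖ := by
    intro a z
    rw [norm_smul]
    have := mul_le_mul (hC₀ z) (C1b_norm1 a z) (norm_nonneg _) hC₀'
    have := mul_nonneg hC₁' (norm_nonneg a)
    linarith
  have hn2 : ∀ a : C1b G, ∀ z, ‖g' a z‖ ≤ (C₀ + C₁) * ‖a‖ := by
    intro a z
    refine (norm_add_le _ _).trans ?_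
    rw [norm_smul, ContinuousLinearMap.norm_smulRight_apply]
    have := mul_le_mul (hC₀ z) (C1b_norm2 a z) (norm_nonneg _) hC₀'
    have := mul_le_mul (hC₁ z) (C1b_norm1 a z) (norm_nonneg _) hC₁'
    linarith
  have hgc : ∀ a : C1b G, Continuous fun z => χ z • a.1.1 z := fun a =>
    hχc.smul a.1.1.continuous
  have hint : ∀ (a : C1b G) z, Integrable fun ζ => κ ζ (χ (z - ζ) • a.1.1 (z - ζ)) := by
    intro a z
    refine (hκ.norm.mul_const ((C₀ + C₁) * ‖a‖)).mono' ?_ (Eventually.of_forall fun ζ => ?_)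
    · exact (ContinuousLinearMap.id ℝ (G →L[ℝ] F)).aestronglyMeasurable_comp₂ hκ.1
        ((hgc a).comp (by fun_prop : Continuous fun ζ => z - ζ)).aestronglyMeasurable
    · exact ((κ ζ).le_opNorm _).trans (mul_le_mul_of_nonneg_left (hn1 a _) (norm_nonneg _))
  set Q := ∫ ζ, ‖κ ζ‖ with hQ
  have hQ0 : 0 ≤ Q := integral_nonneg fun _ => norm_nonneg _
  have hb : ∀ (a : C1b G) z, ‖∫ ζ, κ ζ (χ (z - ζ) • a.1.1 (z - ζ))‖ ≤ Q * ((C₀ + C₁) * ‖a‖) := by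
    intro a z
    rw [hQ, ← integral_mul_const]
    refine norm_integral_le_of_norm_le (hκ.norm.mul_const _) (Eventually.of_forall fun ζ => ?_)
    exact ((κ ζ).le_opNorm _).trans (mul_le_mul_of_nonneg_left (hn1 a _) (norm_nonneg _))
  refine C1b_mkCLM (fun a z => (∫ ζ, κ ζ (χ (z - ζ) • a.1.1 (z - ζ))) -
      ∫ ζ, κ ζ (χ (0 - ζ) • a.1.1 (0 - ζ)))
    (fun a z => ∫ ζ, (κ ζ).comp (g' a (z - ζ))) (2 * Q * (C₀ + C₁)) ?_ ?_ ?_ ?_ ?_ ?_ (by positivity)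
  · intro a b z
    have e : ∀ x, (∫ ζ, κ ζ (χ (x - ζ) • (a + b).1.1 (x - ζ))) =
      (∫ ζ, κ ζ (χ (x - ζ) • a.1.1 (x - ζ))) + ∫ ζ, κ ζ (χ (x - ζ) • b.1.1 (x - ζ)) := by
      intro x
      rw [← integral_add (hint a x) (hint b x)]
      congr 1; ext ζ
      rw [← map_add, ← smul_add]; rfl
    simp only [e]; abel
  · intro c a z
    have e : ∀ x, (∫ ζ, κ ζ (χ (x - ζ) • (c • a).1.1 (x - ζ))) =
      c • (∫ ζ, κ ζ (χ (x - ζ) • a.1.1 (x - ζ))) := by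
      intro x
      rw [← integral_smul]
      congr 1; ext ζ
      have e' : (c • a).1.1 (x - ζ) = c • a.1.1 (x - ζ) := rfl
      rw [e', smul_comm]
      exact (κ ζ).map_smul _ _
    simp only [e, smul_sub]
  · intro a z
    exact (conv_hasFDerivAt κ hκ _ (g' a) (hg a) (hg' a) _ (hn1 a) (hn2 a) z).sub_const _
  · intro a
    refine continuous_of_dominated (bound := fun ζ => ‖κ ζ‖ * ((C₀ + C₁) * ‖a‖)) ?_ ?_
      (hκ.norm.mul_const _) ?_
    · intro z
      exact (ContinuousLinearMap.compL ℝ ℂ G F).aestronglyMeasurable_comp₂ hκ.1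
        ((hg' a).comp (by fun_prop : Continuous fun ζ => z - ζ)).aestronglyMeasurable
    · intro z
      refine Eventually.of_forall fun ζ => ?_
      exact ((κ ζ).opNorm_comp_le _).trans (mul_le_mul_of_nonneg_left (hn2 a _) (norm_nonneg _))
    · refine Eventually.of_forall fun ζ => ?_
      exact continuous_const.clm_comp ((hg' a).comp (by fun_prop))
  · intro a z
    refine (norm_sub_le _ _).trans ((add_le_add (hb a z) (hb a 0)).trans_eq (by ring))
  · intro a z
    have : ‖∫ ζ, (κ ζ).comp (g' a (z - ζ))‖ ≤ Q * ((C₀ + C₁) * ‖a‖) := by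
      rw [hQ, ← integral_mul_const]
      refine norm_integral_le_of_norm_le (hκ.norm.mul_const _) (Eventually.of_forall fun ζ => ?_)
      exact ((κ ζ).opNorm_comp_le _).trans (mul_le_mul_of_nonneg_left (hn2 a _) (norm_nonneg _))
    have h0 : 0 ≤ Q * ((C₀ + C₁) * ‖a‖) := by positivity
    linarith
end KRAux2

section KRAux3
open MeasureTheory
variable {E : Type*} [NormedAddCommGroup E] [NormedSpace ℝ E]

/-- complex multiplication through `J0` -/
def rho (J0 : E →L[ℝ] E) : ℂ →L[ℝ] (E →L[ℝ] E) :=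
  Complex.reCLM.smulRight (ContinuousLinearMap.id ℝ E) + Complex.imCLM.smulRight J0

lemma rho_apply (J0 : E →L[ℝ] E) (c : ℂ) (x : E) : rho J0 c x = c.re • x + c.im • J0 x := by
  simp [rho]

lemma rho_polar (J0 : E →L[ℝ] E) (hJ0 : ∀ x, J0 (J0 x) = -x) (r θ : ℝ) (hr : 0 < r)
    (D : ℂ →L[ℝ] E) :
    r • rho J0 ((2 * Real.pi * (r * (Real.cos θ + Real.sin θ * Complex.I)) : ℂ)⁻¹)
      (D 1 + J0 (D Complex.I)) =
    (2 * Real.pi)⁻¹ • (D (Real.cos θ + Real.sin θ * Complex.I)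
      + J0 (D (Complex.I * (Real.cos θ + Real.sin θ * Complex.I)))) := by
  have hpi : (0:ℝ) < 2 * Real.pi := by positivity
  have e0 : ((2 * Real.pi * (r * (Real.cos θ + Real.sin θ * Complex.I)) : ℂ)⁻¹)
      = ((2 * Real.pi)⁻¹ * r⁻¹ : ℝ) • ((Real.cos θ : ℂ) - Real.sin θ * Complex.I) := by
    have h1 : ((Real.cos θ : ℂ) + Real.sin θ * Complex.I) * ((Real.cos θ : ℂ) - Real.sin θ * Complex.I) = 1 := by
      have := Real.cos_sq_add_sin_sq θ
      have h2 : (Real.cos θ : ℂ) ^ 2 + (Real.sin θ : ℂ) ^ 2 = 1 := by exact_mod_cast this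
      linear_combination h2 - (Real.sin θ : ℂ) ^ 2 * Complex.I_sq
    rw [inv_eq_of_mul_eq_one_right]
    rw [Complex.real_smul]
    push_cast
    have hp : (Real.pi : ℂ) ≠ 0 := by exact_mod_cast Real.pi_ne_zero
    have hr' : (r : ℂ) ≠ 0 := by exact_mod_cast hr.ne'
    field_simp
    push_cast at h1
    exact h1
  have e1 : D (Real.cos θ + Real.sin θ * Complex.I) = Real.cos θ • D 1 + Real.sin θ • D Complex.I := by
    rw [← D.map_smul, ← D.map_smul, ← D.map_add]; simp
  have e2 : D (Complex.I * (Real.cos θ + Real.sin θ * Complex.I)) =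
      Real.cos θ • D Complex.I - Real.sin θ • D 1 := by
    rw [← D.map_smul, ← D.map_smul, ← D.map_sub]; congr 1
    simp only [Complex.real_smul]
    linear_combination (Real.sin θ : ℂ) * Complex.I_sq
  have hr' : r ≠ 0 := hr.ne'
  have e3 : (((2 * Real.pi)⁻¹ * r⁻¹ : ℝ) • ((Real.cos θ : ℂ) - Real.sin θ * Complex.I)).re =
      (2 * Real.pi)⁻¹ * r⁻¹ * Real.cos θ := by
    rw [Complex.smul_re]; simp [-Complex.ofReal_cos, -Complex.ofReal_sin]
  have e4 : (((2 * Real.pi)⁻¹ * r⁻¹ : ℝ) • ((Real.cos θ : ℂ) - Real.sin θ * Complex.I)).im =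
      -((2 * Real.pi)⁻¹ * r⁻¹ * Real.sin θ) := by
    rw [Complex.smul_im]; simp [-Complex.ofReal_cos, -Complex.ofReal_sin]
  rw [e0, e1, e2, rho_apply, e3, e4]
  simp only [map_add, map_sub, map_smul, hJ0, smul_add, smul_sub, smul_smul]
  have e5 : ∀ x, r * ((2 * Real.pi)⁻¹ * r⁻¹ * x) = (2 * Real.pi)⁻¹ * x := by
    intro x; field_simp
  rw [← mul_neg, e5, e5]
  module

/-- Cauchy-Pompeiu for compactly supported functions. -/
lemma cauchy_pompeiu [CompleteSpace E] (J0 : E →L[ℝ] E) (hJ0 : ∀ x, J0 (J0 x) = -x)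
    (g : ℂ → E) (g' : ℂ → ℂ →L[ℝ] E)
    (hg : ∀ z, HasFDerivAt g (g' z) z) (hg' : Continuous g') (R : ℝ)
    (hs : ∀ z, R ≤ ‖z‖ → g z = 0) (z : ℂ) :
    ∫ ζ : ℂ, rho J0 ((2 * Real.pi * ζ : ℂ)⁻¹) (g' (z - ζ) 1 + J0 (g' (z - ζ) Complex.I)) = g z := by
  have hs' : ∀ z, R < ‖z‖ → g' z = 0 := by
    intro y hy
    have h1 : g =ᶠ[𝓝 y] fun _ => (0:E) := by
      filter_upwards [(isOpen_lt continuous_const continuous_norm).mem_nhds hy] with x hx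
      exact hs x (le_of_lt hx)
    exact (hg y).unique ((hasFDerivAt_const (0:E) y).congr_of_eventuallyEq h1)
  let e : ℝ → ℂ := fun θ => Real.cos θ + Real.sin θ * Complex.I
  have he : Continuous e := by fun_prop
  have hen : ∀ θ, ‖e θ‖ = 1 := fun θ => by
    have := Complex.norm_exp_ofReal_mul_I θ
    rw [Complex.exp_mul_I] at this
    simpa only [e, Complex.ofReal_cos, Complex.ofReal_sin] using this
  let H1 : ℝ × ℝ → E := fun q => g' (z - q.1 * e q.2) (e q.2)
  let H2 : ℝ × ℝ → E := fun q => g' (z - q.1 * e q.2) (Complex.I * e q.2)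
  have hH1c : Continuous H1 := by
    have : Continuous fun q : ℝ × ℝ => g' (z - q.1 * e q.2) := hg'.comp (by fun_prop)
    exact this.clm_apply (by fun_prop)
  have hH2c : Continuous H2 := by
    have : Continuous fun q : ℝ × ℝ => g' (z - q.1 * e q.2) := hg'.comp (by fun_prop)
    exact this.clm_apply (by fun_prop)
  set M := R + ‖z‖ + 1 with hM
  have hfar : ∀ q : ℝ × ℝ, M ≤ q.1 → R < ‖z - q.1 * e q.2‖ := by
    intro q hq
    have h1 : ‖(q.1 : ℂ) * e q.2‖ = |q.1| := by rw [norm_mul, hen, mul_one]; simp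
    have h2 := norm_sub_norm_le ((q.1 : ℂ) * e q.2) z
    rw [norm_sub_rev, h1] at h2
    have := le_abs_self q.1
    linarith
  have hint : ∀ H : ℝ × ℝ → E, Continuous H → (∀ q : ℝ × ℝ, M ≤ q.1 → H q = 0) →
      IntegrableOn H (Ioi (0:ℝ) ×ˢ Ioo (-Real.pi) Real.pi) (volume.prod volume) := by
    intro H hH hH0
    have h1 : IntegrableOn H (Icc (0:ℝ) M ×ˢ Icc (-Real.pi) Real.pi) (volume.prod volume) :=
      hH.continuousOn.integrableOn_compact (isCompact_Icc.prod isCompact_Icc)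
    refine h1.of_forall_sdiff_eq_zero (measurableSet_Ioi.prod measurableSet_Ioo) ?_
    rintro ⟨r, θ⟩ ⟨⟨h2, h3⟩, h4⟩
    apply hH0
    by_contra hc
    push Not at hc
    exact h4 ⟨⟨le_of_lt h2, hc.le⟩, ⟨h3.1.le, h3.2.le⟩⟩
  have i1 := hint H1 hH1c fun q hq => by simp [H1, hs' _ (hfar q hq)]
  have i2 := hint H2 hH2c fun q hq => by simp [H2, hs' _ (hfar q hq)]
  have v1 : ∫ q in Ioi (0:ℝ) ×ˢ Ioo (-Real.pi) Real.pi, H1 q ∂(volume.prod volume)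
      = (2 * Real.pi) • g z := by
    rw [← setIntegral_prod_swap]
    rw [setIntegral_prod _ (by exact i1.swap)]
    have : ∀ θ, ∫ r in Ioi (0:ℝ), H1 (r, θ) = g z := by
      intro θ
      have hd : ∀ r : ℝ, HasDerivAt (fun r : ℝ => - g (z - r * e θ)) (H1 (r, θ)) r := by
        intro r
        have h1 : HasDerivAt (fun r : ℝ => z - r * e θ) (-(e θ)) r := by
          simpa using ((Complex.ofRealCLM.hasDerivAt (x := r)).mul_const (e θ)).const_sub z
        have := ((hg (z - r * e θ)).comp_hasDerivAt r h1).neg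
        refine this.congr_deriv ?_
        simp [H1]
      have hi : IntegrableOn (fun r => H1 (r, θ)) (Ioi 0) := by
        have h1 : IntegrableOn (fun r => H1 (r, θ)) (Icc 0 M) :=
          (hH1c.comp (by fun_prop : Continuous fun r : ℝ => (r, θ))).continuousOn.integrableOn_compact isCompact_Icc
        refine h1.of_forall_sdiff_eq_zero measurableSet_Ioi ?_
        rintro r ⟨h2, h4⟩
        have : M ≤ r := by
          by_contra hc
          push Not at hc
          exact h4 ⟨le_of_lt h2, hc.le⟩
        simp [H1, hs' _ (hfar (r, θ) this)]
      have ht : Tendsto (fun r : ℝ => - g (z - r * e θ)) atTop (𝓝 0) := by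
        apply tendsto_const_nhds.congr'
        filter_upwards [eventually_ge_atTop M] with r hr
        rw [hs _ (hfar (r, θ) hr).le, neg_zero]
      have := integral_Ioi_of_hasDerivAt_of_tendsto' (a := (0:ℝ)) (fun r _ => hd r) hi ht
      rw [this]; simp
    simp only [Prod.swap_prod_mk, this]
    rw [setIntegral_const]
    congr 1
    simp
    rw [max_eq_left (by linarith [Real.pi_pos])]
    ring
  have v2 : ∫ q in Ioi (0:ℝ) ×ˢ Ioo (-Real.pi) Real.pi, H2 q ∂(volume.prod volume) = 0 := by
    rw [setIntegral_prod _ i2]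
    have : ∀ r ∈ Ioi (0:ℝ), ∫ θ in Ioo (-Real.pi) Real.pi, H2 (r, θ) = 0 := by
      intro r hr
      have hr0 : r ≠ 0 := ne_of_gt hr
      have hd : ∀ θ : ℝ, HasDerivAt (fun θ : ℝ => - (r⁻¹ • g (z - r * e θ))) (H2 (r, θ)) θ := by
        intro θ
        have h0 : HasDerivAt e (Complex.I * e θ) θ := by
          have h := ((Real.hasDerivAt_cos θ).ofReal_comp).add
            (((Real.hasDerivAt_sin θ).ofReal_comp).mul_const Complex.I)
          refine h.congr_deriv ?_
          simp only [e]
          push_cast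
          linear_combination - Complex.sin θ * Complex.I_sq
        have h1 : HasDerivAt (fun θ : ℝ => z - r * e θ) (-(r * (Complex.I * e θ))) θ :=
          (h0.const_mul (r:ℂ)).const_sub z
        have := (((hg (z - r * e θ)).comp_hasDerivAt θ h1).const_smul r⁻¹).neg
        refine this.congr_deriv ?_
        have : -((r:ℂ) * (Complex.I * e θ)) = (-r) • (Complex.I * e θ) := by simp
        rw [this, map_smul, smul_smul, ← neg_smul]
        have : -(r⁻¹ * -r) = 1 := by field_simp
        rw [this, one_smul]
      rw [← integral_Ioc_eq_integral_Ioo, ← intervalIntegral.integral_of_le (by linarith [Real.pi_pos])]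
      rw [intervalIntegral.integral_eq_sub_of_hasDerivAt (fun θ _ => hd θ)
        ((hH2c.comp (by fun_prop : Continuous fun θ : ℝ => (r, θ))).intervalIntegrable _ _)]
      simp [e]
    rw [setIntegral_congr_fun measurableSet_Ioi this]
    simp
  rw [← Complex.integral_comp_polarCoord_symm]
  change ∫ q in Ioi (0:ℝ) ×ˢ Ioo (-Real.pi) Real.pi, _ ∂(volume.prod volume) = _
  have : ∀ q ∈ Ioi (0:ℝ) ×ˢ Ioo (-Real.pi) Real.pi,
     q.1 • (rho J0 ((2 * Real.pi * Complex.polarCoord.symm q : ℂ)⁻¹) (g' (z - Complex.polarCoord.symm q) 1 + J0 (g' (z - Complex.polarCoord.symm q) Complex.I)))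
     = (2 * Real.pi)⁻¹ • (H1 q + J0 (H2 q)) := by
    rintro ⟨r, θ⟩ ⟨hr, -⟩
    rw [Complex.polarCoord_symm_apply]
    exact rho_polar J0 hJ0 r θ hr _
  rw [setIntegral_congr_fun (measurableSet_Ioi.prod measurableSet_Ioo) this]
  rw [integral_smul, integral_add i1 (J0.integrable_comp i2), J0.integral_comp_comm i2, v1, v2]
  rw [map_zero, add_zero, smul_smul, inv_mul_cancel₀ (by positivity), one_smul]

/-- truncated kernel -/
def kap (J0 : E →L[ℝ] E) : ℂ → E →L[ℝ] E :=
  (ball (0:ℂ) 4).indicator fun ζ => rho J0 ((2 * Real.pi * ζ : ℂ)⁻¹)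

lemma integrable_ind_aux {G : Type*} [NormedAddCommGroup G] (f : ℂ → G) (r : ℝ)
    (h : IntegrableOn f (ball 0 r)) : Integrable ((ball 0 r).indicator f) :=
  h.integrable_indicator measurableSet_ball

lemma kap_integrable (J0 : E →L[ℝ] E) : Integrable (kap J0) := by
  suffices key : IntegrableOn (fun ζ : ℂ => rho J0 ((2 * Real.pi * ζ : ℂ)⁻¹)) (ball 0 4) from
    integrable_ind_aux _ _ key
  have hfr : Module.finrank ℝ ℂ = 2 := Complex.finrank_real_complex
  refine integrableOn_ball_of_norm_le_rpow (C := ‖rho J0‖) (α := 1) (by rw [hfr]; norm_num)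
    (by rw [hfr]; norm_num) (Eventually.of_forall fun ζ => ?_) ?_
  · refine ((rho J0).le_opNorm _).trans (mul_le_mul_of_nonneg_left ?_ (norm_nonneg _))
    rw [Real.rpow_neg_one, norm_inv, norm_mul, mul_inv]
    have h1 : ‖(2 * Real.pi : ℂ)‖⁻¹ ≤ 1 := by
      apply inv_le_one_of_one_le₀
      rw [norm_mul, Complex.norm_ofNat, Complex.norm_real, Real.norm_of_nonneg Real.pi_pos.le]
      linarith [Real.pi_gt_three]
    exact mul_le_of_le_one_left (by positivity) h1
  · have : Measurable fun ζ : ℂ => (2 * Real.pi * ζ : ℂ)⁻¹ := by fun_prop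
    exact (rho J0).continuous.comp_aestronglyMeasurable this.aestronglyMeasurable

lemma rho_comm (J0 : E →L[ℝ] E) (c : ℂ) (x : E) : J0 (rho J0 c x) = rho J0 c (J0 x) := by
  simp [rho_apply]

lemma dbar_conv [CompleteSpace E] (J0 : E →L[ℝ] E) (hJ0 : ∀ x, J0 (J0 x) = -x)
    (g : ℂ → E) (g' : ℂ → ℂ →L[ℝ] E)
    (hg : ∀ z, HasFDerivAt g (g' z) z) (hg' : Continuous g') (M : ℝ)
    (h1 : ∀ z, ‖g z‖ ≤ M) (h2 : ∀ z, ‖g' z‖ ≤ M)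
    (hs : ∀ z, 2 ≤ ‖z‖ → g z = 0) (z : ℂ) (hz : ‖z‖ < 1) :
    ∃ D : ℂ →L[ℝ] E, HasFDerivAt (fun z => ∫ ζ, kap J0 ζ (g (z - ζ))) D z ∧
      D 1 + J0 (D Complex.I) = g z := by
  refine ⟨_, conv_hasFDerivAt (kap J0) (kap_integrable J0) g g' hg hg' M h1 h2 z, ?_⟩
  have hgc : Continuous fun ζ => g' (z - ζ) := by fun_prop
  have hi : Integrable fun ζ => (kap J0 ζ).comp (g' (z - ζ)) := by
    refine ((kap_integrable J0).norm.mul_const M).mono' ?_ (Eventually.of_forall fun ζ => ?_)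
    · exact (ContinuousLinearMap.compL ℝ ℂ E E).aestronglyMeasurable_comp₂
        (kap_integrable J0).aestronglyMeasurable hgc.aestronglyMeasurable
    · exact ((kap J0 ζ).opNorm_comp_le _).trans (mul_le_mul_of_nonneg_left (h2 _) (norm_nonneg _))
  have hi1 : ∀ h : ℂ, Integrable fun ζ => kap J0 ζ (g' (z - ζ) h) := fun h =>
    (ContinuousLinearMap.apply ℝ E h).integrable_comp hi
  rw [ContinuousLinearMap.integral_apply hi, ContinuousLinearMap.integral_apply hi]
  simp only [ContinuousLinearMap.comp_apply]
  rw [← J0.integral_comp_comm (hi1 _), ← integral_add (hi1 _) (J0.integrable_comp (hi1 _))]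
  rw [← cauchy_pompeiu J0 hJ0 g g' hg hg' 2 hs z]
  congr 1
  funext ζ
  by_cases hζ : ζ ∈ ball (0:ℂ) 4
  · simp only [kap, indicator_of_mem hζ, rho_comm, map_add]
  · have h4 : 4 ≤ ‖ζ‖ := by simpa using hζ
    have h3 : 2 < ‖z - ζ‖ := by
      have := norm_sub_norm_le ζ z
      rw [norm_sub_rev] at this
      linarith
    have h5 : g' (z - ζ) = 0 := by
      have h1 : g =ᶠ[𝓝 (z - ζ)] fun _ => (0:E) := by
        filter_upwards [(isOpen_lt continuous_const continuous_norm).mem_nhds h3] with x hx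
        exact hs x (le_of_lt hx)
      exact (hg _).unique ((hasFDerivAt_const (0:E) _).congr_of_eventuallyEq h1)
    simp [h5]
end KRAux3

section KRAux4
open MeasureTheory
variable {E : Type*} [NormedAddCommGroup E] [NormedSpace ℝ E]

lemma curl_bound (J0 Q : E →L[ℝ] E) (Q' : E →L[ℝ] E →L[ℝ] E) (w : E) (w' f' : ℂ →L[ℝ] E)
    (hq : Q' (Q w) (J0 w) - Q' (Q (J0 w)) w + Q (J0 (w' 1) - w' Complex.I) = 0) (h k : ℂ) :
    ‖(Q' (f' h) (rho J0 k w) + Q (rho J0 k (w' h))) - (Q' (f' k) (rho J0 h w) + Q (rho J0 h (w' k)))‖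
      ≤ (2 * ‖Q'‖ * ‖rho J0‖ * ‖w‖) * ‖f' - Q.comp ((rho J0).flip w)‖ * ‖h‖ * ‖k‖ := by
  have hw : ∀ h : ℂ, w' h = h.re • w' 1 + h.im • w' Complex.I := by
    intro h
    rw [← w'.map_smul, ← w'.map_smul, ← w'.map_add]; congr 1
    simp [Complex.re_add_im]
  set e := f' - Q.comp ((rho J0).flip w) with he
  have hf : ∀ h : ℂ, f' h = Q (rho J0 h w) + e h := by
    intro h; simp [he]
  have key : (Q' (f' h) (rho J0 k w) + Q (rho J0 k (w' h)))
      - (Q' (f' k) (rho J0 h w) + Q (rho J0 h (w' k)))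
      = Q' (e h) (rho J0 k w) - Q' (e k) (rho J0 h w) := by
    rw [hf h, hf k, hw h, hw k]
    simp only [rho_apply, map_add, map_smul, map_sub, smul_add, add_apply,
      smul_apply] at hq ⊢
    linear_combination (norm := module) (h.re * k.im - h.im * k.re) • hq
  rw [key]
  have b : ∀ h k : ℂ, ‖Q' (e h) (rho J0 k w)‖ ≤ ‖Q'‖ * (‖e‖ * ‖h‖) * (‖rho J0‖ * ‖k‖ * ‖w‖) := by
    intro h k
    refine (Q'.le_opNorm₂ _ _).trans ?_
    gcongr
    · exact e.le_opNorm h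
    · exact (rho J0).le_opNorm₂ k w
  have := norm_sub_le (Q' (e h) (rho J0 k w)) (Q' (e k) (rho J0 h w))
  have := b h k
  have := b k h
  linarith

lemma rad_closed [CompleteSpace E] (a : ℂ → ℂ →L[ℝ] E) (a' : ℂ → ℂ →L[ℝ] ℂ →L[ℝ] E)
    (had : ∀ z, HasFDerivAt a (a' z) z) (ha' : Continuous a') (M : ℝ)
    (h1 : ∀ z, ‖a z‖ ≤ M) (h2 : ∀ z, ‖a' z‖ ≤ M) (f' : ℂ → ℂ →L[ℝ] E)
    (hf' : ∀ z, ‖z‖ < 1 → f' z = ∫ t in (0:ℝ)..1, radD a a' z t)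
    (hc : ∀ z, ‖z‖ < 1 → ∀ h k : ℂ, ‖a' z h k - a' z k h‖ ≤ (1/2) * ‖f' z - a z‖ * ‖h‖ * ‖k‖)
    (z : ℂ) (hz : ‖z‖ < 1) : f' z = a z := by
  have hac : Continuous a := continuous_iff_continuousAt.2 fun z => (had z).continuousAt
  have hM : 0 ≤ M := (norm_nonneg _).trans (h1 0)
  have hrc := radD_cont a a' hac ha'
  have herr : ∀ z, ‖z‖ < 1 → ∀ h, (f' z - a z) h =
      ∫ t in (0:ℝ)..1, t • (a' (t • z) h z - a' (t • z) z h) := by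
    intro z hz h
    have hd : ∀ t : ℝ, HasDerivAt (fun t : ℝ => t • a (t • z) h)
        (a (t • z) h + t • a' (t • z) z h) t := by
      intro t
      have e1 : HasDerivAt (fun t : ℝ => t • z) z t := by
        simpa using (hasDerivAt_id t).smul_const z
      have e2 : HasDerivAt (fun t : ℝ => a (t • z)) (a' (t • z) z) t :=
        (had (t • z)).comp_hasDerivAt t e1
      have e3 : HasDerivAt (fun t : ℝ => a (t • z) h) (a' (t • z) z h) t := by
        simpa using e2.clm_apply (hasDerivAt_const t h)
      have e4 := (hasDerivAt_id t).smul e3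
      refine e4.congr_deriv ?_
      simp [add_comm]
    have ci : Continuous fun t : ℝ => a (t • z) h + t • a' (t • z) z h := by fun_prop
    have e5 := intervalIntegral.integral_eq_sub_of_hasDerivAt (a := 0) (b := 1)
      (fun t _ => hd t) (ci.intervalIntegrable 0 1)
    simp only [one_smul, zero_smul, sub_zero] at e5
    rw [sub_apply, hf' z hz, ← e5]
    have c1 : Continuous fun t : ℝ => radD a a' z t := hrc.comp (by fun_prop : Continuous fun t : ℝ => (z, t))
    rw [ContinuousLinearMap.intervalIntegral_apply (c1.intervalIntegrable 0 1)]
    rw [← intervalIntegral.integral_sub ((by fun_prop : Continuous fun t : ℝ => radD a a' z t h).intervalIntegrable 0 1) (ci.intervalIntegrable 0 1)]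
    congr 1
    funext t
    simp [radD, smul_sub]
  have hstep : ∀ S : ℝ, (∀ z, ‖z‖ < 1 → ‖f' z - a z‖ ≤ S) →
      ∀ z, ‖z‖ < 1 → ‖f' z - a z‖ ≤ (1/2) * S := by
    intro S hS z hz
    have hS0 : 0 ≤ S := (norm_nonneg _).trans (hS z hz)
    refine ContinuousLinearMap.opNorm_le_bound _ (by positivity) fun h => ?_
    rw [herr z hz h]
    have := intervalIntegral.norm_integral_le_of_norm_le_const (a := (0:ℝ)) (b := 1)
      (C := (1/2) * S * ‖h‖)
      (f := fun t : ℝ => t • (a' (t • z) h z - a' (t • z) z h)) (fun t ht => ?_)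
    · simpa using this
    · rw [uIoc_of_le zero_le_one] at ht
      have htz : ‖t • z‖ < 1 := by
        rw [norm_smul, Real.norm_of_nonneg ht.1.le]
        nlinarith [norm_nonneg z, ht.2, ht.1]
      rw [norm_smul, Real.norm_of_nonneg ht.1.le]
      have b1 := hc _ htz h z
      have b2 := hS _ htz
      calc t * ‖a' (t • z) h z - a' (t • z) z h‖ ≤ 1 * ((1/2) * S * ‖h‖ * 1) := by
            apply mul_le_mul ht.2 _ (norm_nonneg _) zero_le_one
            refine b1.trans ?_
            gcongr
        _ = _ := by ring
  have hS0 : ∀ z, ‖z‖ < 1 → ‖f' z - a z‖ ≤ 3 * M := by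
    intro z hz
    have b : ‖f' z‖ ≤ 2 * M := by
      rw [hf' z hz]
      have := intervalIntegral.norm_integral_le_of_norm_le_const (a := (0:ℝ)) (b := 1)
        (C := 2 * M) (f := fun t : ℝ => radD a a' z t) (fun t ht => ?_)
      · simpa using this
      · rw [uIoc_of_le zero_le_one] at ht
        refine ContinuousLinearMap.opNorm_le_bound _ (by positivity) fun h => ?_
        have e1 : radD a a' z t h = a (t • z) h + t • a' (t • z) h z := by simp [radD]
        rw [e1]
        have b1 : ‖a (t • z) h‖ ≤ M * ‖h‖ := (a _).le_of_opNorm_le (h1 _) h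
        have b2 : ‖a' (t • z) h z‖ ≤ M * ‖h‖ := by
          refine ((a' _).le_opNorm₂ _ _).trans ?_
          calc ‖a' (t • z)‖ * ‖h‖ * ‖z‖ ≤ M * ‖h‖ * 1 := by
                gcongr
                exact h2 _
            _ = _ := mul_one _
        have b3 : ‖t • a' (t • z) h z‖ ≤ M * ‖h‖ := by
          rw [norm_smul, Real.norm_of_nonneg ht.1.le]
          exact (mul_le_of_le_one_left (norm_nonneg _) ht.2).trans b2
        linarith [norm_add_le (a (t • z) h) (t • a' (t • z) h z)]
    linarith [norm_sub_le (f' z) (a z), h1 z]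
  have hall : ∀ n : ℕ, ∀ z, ‖z‖ < 1 → ‖f' z - a z‖ ≤ (1/2) ^ n * (3 * M) := by
    intro n
    induction n with
    | zero => simpa using hS0
    | succ n ih =>
      intro z hz
      have := hstep _ ih z hz
      rwa [← mul_assoc, ← pow_succ'] at this
  have ht : Tendsto (fun n : ℕ => ((1:ℝ)/2) ^ n * (3 * M)) atTop (𝓝 0) := by
    simpa using (tendsto_pow_atTop_nhds_zero_of_lt_one (by norm_num) (by norm_num : (1:ℝ)/2 < 1)).mul_const (3 * M)
  have := ge_of_tendsto' ht fun n => hall n z hz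
  exact sub_eq_zero.1 (norm_le_zero_iff.1 this)
end KRAux4

section KRAux5
open MeasureTheory
variable {E : Type*} [NormedAddCommGroup E] [NormedSpace ℝ E]

/-- the radial coefficient -/
def kA (J0 : E →L[ℝ] E) (P : E → E →L[ℝ] E) (u : E × E) : ℂ →L[ℝ] E × E :=
  (ContinuousLinearMap.inl ℝ E E).comp ((P u.1).comp ((rho J0).flip u.2))

/-- the right-hand side of the dbar equation -/
def kq (J0 : E →L[ℝ] E) (P : E → E →L[ℝ] E) (u : E × E) : E :=
  J0 (Ring.inverse (P u.1) (fderiv ℝ P u.1 (P u.1 u.2) (J0 u.2)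
    - fderiv ℝ P u.1 (P u.1 (J0 u.2)) u.2))

lemma kA_contDiffAt (J0 : E →L[ℝ] E) (P : E → E →L[ℝ] E) (hP : ContDiffAt ℝ 3 P 0) :
    ContDiffAt ℝ 2 (kA J0 P) 0 := by
  have h1 : ContDiffAt ℝ 2 (fun u : E × E => P u.1) 0 :=
    ContDiffAt.comp (0 : E × E) (hP.of_le (by norm_num)) contDiffAt_fst
  have h2 : ContDiffAt ℝ 2 (fun u : E × E => (rho J0).flip u.2) 0 :=
    (rho J0).flip.contDiff.contDiffAt.comp (0 : E × E) contDiffAt_snd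
  exact contDiffAt_const.clm_comp (h1.clm_comp h2)

lemma kA_zero (J0 : E →L[ℝ] E) (P : E → E →L[ℝ] E) : kA J0 P 0 = 0 := by
  simp [kA]

lemma kq_contDiffAt [CompleteSpace E] (J0 : E →L[ℝ] E) (P : E → E →L[ℝ] E) (hP : ContDiffAt ℝ 3 P 0)
    (hu : IsUnit (P 0)) : ContDiffAt ℝ 2 (kq J0 P) 0 := by
  have h1 : ContDiffAt ℝ 2 (fun u : E × E => P u.1) 0 :=
    ContDiffAt.comp (0 : E × E) (hP.of_le (by norm_num)) contDiffAt_fst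
  have hd : ContDiffAt ℝ 2 (fderiv ℝ P) 0 := hP.fderiv_right (by norm_num)
  have h2 : ContDiffAt ℝ 2 (fun u : E × E => fderiv ℝ P u.1) 0 :=
    ContDiffAt.comp (0 : E × E) hd contDiffAt_fst
  obtain ⟨U, hU⟩ := hu
  have hi : ContDiffAt ℝ 2 (Ring.inverse : (E →L[ℝ] E) → _) (P (0 : E × E).1) := by
    have := contDiffAt_ringInverse ℝ (n := 2) U
    rw [hU] at this
    exact this
  have h3 : ContDiffAt ℝ 2 (fun u : E × E => Ring.inverse (P u.1)) 0 :=
    ContDiffAt.comp (g := fun T : E →L[ℝ] E => Ring.inverse T) (0 : E × E) hi h1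
  have hj : ContDiffAt ℝ 2 (fun u : E × E => J0 u.2) 0 :=
    J0.contDiff.contDiffAt.comp (0 : E × E) contDiffAt_snd
  refine J0.contDiff.contDiffAt.comp (0 : E × E) (h3.clm_apply (ContDiffAt.sub ?_ ?_))
  · exact (h2.clm_apply (h1.clm_apply contDiffAt_snd)).clm_apply hj
  · exact (h2.clm_apply (h1.clm_apply hj)).clm_apply contDiffAt_snd

lemma kq_zero (J0 : E →L[ℝ] E) (P : E → E →L[ℝ] E) : kq J0 P 0 = 0 := by
  simp [kq]

lemma kq_curl (J0 : E →L[ℝ] E) (hJ0 : ∀ x, J0 (J0 x) = -x) (P : E → E →L[ℝ] E) (u : E × E)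
    (hu : IsUnit (P u.1)) (η : ℝ) (w' : ℂ →L[ℝ] E)
    (hw : w' 1 + J0 (w' Complex.I) = η • kq J0 P u) :
    (η • fderiv ℝ P u.1) ((η • P u.1) u.2) (J0 u.2)
      - (η • fderiv ℝ P u.1) ((η • P u.1) (J0 u.2)) u.2
      + (η • P u.1) (J0 (w' 1) - w' Complex.I) = 0 := by
  have e1 : J0 (w' 1) - w' Complex.I = J0 (w' 1 + J0 (w' Complex.I)) := by
    rw [map_add, hJ0]; abel
  have e2 : ∀ y, P u.1 (Ring.inverse (P u.1) y) = y := by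
    intro y
    have := Ring.mul_inverse_cancel _ hu
    exact congrArg (fun T : E →L[ℝ] E => T y) this
  rw [e1, hw, kq]
  simp only [map_smul, hJ0, smul_apply, map_neg, e2]
  module

lemma ev_norm_aux {G : Type*} [NormedAddCommGroup G] (g : E → G) (hg : ContinuousAt g 0) :
    ∀ᶠ x in 𝓝 (0:E), ‖g x‖ < ‖g 0‖ + 1 :=
  hg.norm.eventually_lt_const (by linarith)

lemma kr_deltas [CompleteSpace E] (J0 : E →L[ℝ] E) (P : E → E →L[ℝ] E) (hP : ContDiffAt ℝ 3 P 0)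
    (hu : IsUnit (P 0)) (δ : ℝ) (hδ : 0 < δ) : ∃ δ₀ > 0, δ₀ ≤ δ ∧ ∀ x, ‖x‖ ≤ δ₀ →
      IsUnit (P x) ∧ DifferentiableAt ℝ P x ∧ 2 * ‖fderiv ℝ P x‖ * ‖rho J0‖ * δ₀ ≤ 1/2 := by
  have hd : ContDiffAt ℝ 2 (fderiv ℝ P) 0 := hP.fderiv_right (by norm_num)
  have e1 : ∀ᶠ x in 𝓝 (0:E), IsUnit (P x) :=
    hP.continuousAt.eventually (Units.isOpen.mem_nhds hu)
  have e2 : ∀ᶠ x in 𝓝 (0:E), DifferentiableAt ℝ P x := by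
    filter_upwards [hP.eventually (by simp)] with x hx
    exact hx.differentiableAt (by norm_num)
  have e3 : ∀ᶠ x in 𝓝 (0:E), ‖fderiv ℝ P x‖ < ‖fderiv ℝ P 0‖ + 1 :=
    ev_norm_aux _ hd.continuousAt
  obtain ⟨r, hr, h⟩ := Metric.eventually_nhds_iff_ball.1 (e1.and (e2.and e3))
  set C := ‖fderiv ℝ P 0‖ + 1
  have hC : 0 < C := by positivity
  set L := ‖rho J0‖ with hL
  have hL0 : 0 ≤ L := (rho J0).opNorm_nonneg
  have hden : 0 < 4 * (C * L + 1) := by positivity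
  refine ⟨min (min (r/2) δ) (1 / (4 * (C * L + 1))), by positivity, (min_le_left _ _).trans (min_le_right _ _), ?_⟩
  intro x hx
  have hxr : x ∈ ball (0:E) r := by
    rw [mem_ball_zero_iff]
    have := (min_le_left (min (r/2) δ) (1 / (4 * (C * L + 1)))).trans (min_le_left _ _)
    linarith
  obtain ⟨h1, h2, h3⟩ := h x hxr
  refine ⟨h1, h2, ?_⟩
  calc 2 * ‖fderiv ℝ P x‖ * L * min (min (r/2) δ) (1 / (4 * (C * L + 1)))
      ≤ 2 * C * L * (1 / (4 * (C * L + 1))) := by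
        gcongr
        exact min_le_right _ _
    _ ≤ 1/2 := by
        rw [mul_one_div, div_le_iff₀ hden]; nlinarith
end KRAux5

section KRAux6
open MeasureTheory
variable {E : Type*} [NormedAddCommGroup E] [NormedSpace ℝ E]

lemma kap_conv_int (J0 : E →L[ℝ] E) (g : ℂ → E) (hg : Continuous g) (M : ℝ) (hM : ∀ z, ‖g z‖ ≤ M)
    (z : ℂ) : Integrable fun ζ => kap J0 ζ (g (z - ζ)) := by
  have hgc : Continuous fun ζ => g (z - ζ) := by fun_prop
  refine ((kap_integrable J0).norm.mul_const M).mono' ?_ (Eventually.of_forall fun ζ => ?_)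
  · exact (ContinuousLinearMap.id ℝ (E →L[ℝ] E)).aestronglyMeasurable_comp₂
      (kap_integrable J0).aestronglyMeasurable hgc.aestronglyMeasurable
  · exact (kap J0 ζ).le_opNorm_of_le (hM _)

lemma curl_coeff (T : E →L[ℝ] E →L[ℝ] E) (L δ η : ℝ) (w : E) (hη : 0 ≤ η) (hη1 : η ≤ 1)
    (hL : 0 ≤ L) (hw : ‖w‖ ≤ δ) (h : 2 * ‖T‖ * L * δ ≤ 1 / 2) :
    2 * ‖η • T‖ * L * ‖w‖ ≤ 1 / 2 := by
  have e1 : ‖η • T‖ ≤ ‖T‖ := by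
    refine (T.opNorm_smul_le η).trans ?_
    rw [Real.norm_of_nonneg hη]
    exact mul_le_of_le_one_left T.opNorm_nonneg hη1
  refine le_trans ?_ h
  have := T.opNorm_nonneg
  gcongr

set_option maxHeartbeats 1000000 in
lemma kr_core [CompleteSpace E] (J0 : E →L[ℝ] E) (hJ0 : ∀ x, J0 (J0 x) = -x)
    (P : E → E →L[ℝ] E) (hP : ContDiffAt ℝ 3 P 0)
    (hu : IsUnit (P 0)) (δ : ℝ) (hδ : 0 < δ) :
    ∃ η > (0:ℝ), ∃ ε > (0:ℝ), ∀ v : E, ‖v‖ ≤ ε → ∃ f w : ℂ → E, f 0 = 0 ∧ w 0 = v ∧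
      ∀ z, ‖z‖ < 1 → ‖f z‖ ≤ δ ∧
        HasFDerivAt f (η • (P (f z)).comp ((rho J0).flip (w z))) z := by
  obtain ⟨δ₀, hδ₀, hδδ, hall⟩ := kr_deltas J0 P hP hu δ hδ
  let bump : ContDiffBump (0:ℂ) := ⟨1, 2, one_pos, by norm_num⟩
  let χ : ℂ → ℝ := fun z => bump z
  have hχ : ContDiff ℝ 1 χ := bump.contDiff
  have hχs : ∀ z, 2 ≤ ‖z‖ → χ z = 0 := fun z hz =>
    bump.zero_of_le_dist (by simpa [bump] using hz)
  have hχ1 : ∀ z, ‖z‖ ≤ 1 → χ z = 1 := fun z hz =>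
    bump.one_of_mem_closedBall (by simpa [bump] using hz)
  have hχcs : HasCompactSupport χ := bump.hasCompactSupport
  obtain ⟨T, hT⟩ := exists_rad (F := E × E) χ hχ 2 (by norm_num) hχs
  let inr := ContinuousLinearMap.inr ℝ E E
  have hκ : Integrable fun ζ => inr.comp (kap J0 ζ) :=
    (ContinuousLinearMap.compL ℝ E E (E × E) inr).integrable_comp (kap_integrable J0)
  obtain ⟨S, hS⟩ := exists_conv (F := E × E) (fun ζ => inr.comp (kap J0 ζ)) hκ χ hχ hχcs
  obtain ⟨η, hη, hη1, ε, hε, hfix⟩ := C1b_fixed T S (kA J0 P) (kA_contDiffAt J0 P hP)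
    (kA_zero J0 P) (kq J0 P) (kq_contDiffAt J0 P hP hu) (kq_zero J0 P) δ₀ hδ₀
  refine ⟨η, hη, ε, hε, fun v hv => ?_⟩
  obtain ⟨u, hun, a, b, ha, hb, heq⟩ := hfix (0, v) (by simpa [Prod.norm_def] using hv)
  let fst := ContinuousLinearMap.fst ℝ E E
  let snd := ContinuousLinearMap.snd ℝ E E
  let f : ℂ → E := fun z => (u.1.1 z).1
  let w : ℂ → E := fun z => (u.1.1 z).2
  let f' : ℂ → ℂ →L[ℝ] E := fun z => fst.comp (u.1.2 z)
  let w' : ℂ → ℂ →L[ℝ] E := fun z => snd.comp (u.1.2 z)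
  have hf : ∀ z, HasFDerivAt f (f' z) z := fun z =>
    fst.hasFDerivAt.comp z (C1b_hasFDerivAt u z)
  have hw : ∀ z, HasFDerivAt w (w' z) z := fun z =>
    snd.hasFDerivAt.comp z (C1b_hasFDerivAt u z)
  have hfn : ∀ z, ‖f z‖ ≤ δ₀ := fun z =>
    (norm_fst_le (u.1.1 z)).trans ((C1b_norm1 u z).trans hun)
  have hwn : ∀ z, ‖w z‖ ≤ δ₀ := fun z =>
    (norm_snd_le (u.1.1 z)).trans ((C1b_norm1 u z).trans hun)
  -- the one-form
  let L : (ℂ →L[ℝ] E × E) →L[ℝ] (ℂ →L[ℝ] E) := η • ContinuousLinearMap.compL ℝ ℂ (E × E) E fst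
  let α : ℂ → ℂ →L[ℝ] E := fun z => L (a.1.1 z)
  let α' : ℂ → ℂ →L[ℝ] ℂ →L[ℝ] E := fun z => L.comp (a.1.2 z)
  have hα : ∀ z, HasFDerivAt α (α' z) z := fun z =>
    L.hasFDerivAt.comp z (C1b_hasFDerivAt a z)
  have hα' : Continuous α' := by
    have : Continuous fun z => a.1.2 z := a.1.2.continuous
    exact (ContinuousLinearMap.compL ℝ ℂ (ℂ →L[ℝ] E × E) (ℂ →L[ℝ] E) L).continuous.comp this
  have hα1 : ∀ z, ‖α z‖ ≤ ‖L‖ * ‖a‖ := fun z =>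
    L.le_opNorm_of_le (C1b_norm1 a z)
  have hα2 : ∀ z, ‖α' z‖ ≤ ‖L‖ * ‖a‖ := fun z =>
    (L.opNorm_comp_le _).trans (mul_le_mul_of_nonneg_left (C1b_norm2 a z) (norm_nonneg _))
  have hαe : ∀ z, α z = η • (P (f z)).comp ((rho J0).flip (w z)) := by
    intro z
    refine ContinuousLinearMap.ext fun h => ?_
    simp [α, L, ha, kA, f, w, fst]
  have hαc : Continuous α := continuous_iff_continuousAt.2 fun z => (hα z).continuousAt
  have hac : Continuous fun z => a.1.1 z := a.1.1.continuous
  -- the dbar equation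
  let g : ℂ → E := fun z => χ z • b.1.1 z
  let g' : ℂ → ℂ →L[ℝ] E := fun z => χ z • b.1.2 z + (fderiv ℝ χ z).smulRight (b.1.1 z)
  have hg : ∀ z, HasFDerivAt g (g' z) z := fun z =>
    (hχ.differentiable one_ne_zero z).hasFDerivAt.smul (C1b_hasFDerivAt b z)
  have hg' : Continuous g' := by
    have h1 : Continuous fun z => b.1.1 z := b.1.1.continuous
    have h2 : Continuous fun z => b.1.2 z := b.1.2.continuous
    have h3 := hχ.continuous_fderiv one_ne_zero
    have h4 := hχ.continuous
    exact (h4.smul h2).add ((ContinuousLinearMap.smulRightL ℝ ℂ E).continuous₂.comp (h3.prodMk h1))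
  have hgs : ∀ z, 2 ≤ ‖z‖ → g z = 0 := fun z hz => by simp [g, hχs z hz]
  have hgcs : HasCompactSupport g := hχcs.smul_right
  have hgfd : fderiv ℝ g = g' := funext fun z => (hg z).fderiv
  have hgc : Continuous g := continuous_iff_continuousAt.2 fun z => (hg z).continuousAt
  obtain ⟨M1, hM1⟩ := hgc.bounded_above_of_compact_support hgcs
  obtain ⟨M2, hM2⟩ := hg'.bounded_above_of_compact_support (hgfd ▸ hgcs.fderiv ℝ)
  -- components of the fixed point equation
  have hSb : ∀ z, (S b).1.1 z = inr (∫ ζ, kap J0 ζ (χ (z - ζ) • b.1.1 (z - ζ)))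
      - inr (∫ ζ, kap J0 ζ (χ (0 - ζ) • b.1.1 (0 - ζ))) := by
    intro z
    have h1 := fun z => inr.integral_comp_comm (kap_conv_int J0 g hgc M1 hM1 z)
    rw [hS]
    exact congrArg₂ (· - ·) (h1 z) (h1 0)
  have hfeq : ∀ z, ‖z‖ ≤ 1 → f z = ∫ t in (0:ℝ)..1, α (t • z) z := by
    intro z hz
    have e1 : f z = η • ((T a).1.1 z).1 := by
      have := congrArg Prod.fst (heq z)
      rw [hSb] at this
      simpa [inr] using this
    rw [e1, hT, hχ1 z hz, one_smul]
    have ci : Continuous fun t : ℝ => a.1.1 (t • z) z := by fun_prop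
    have := fst.intervalIntegral_comp_comm (ci.intervalIntegrable (μ := volume) 0 1)
    have e2 : (∫ t in (0:ℝ)..1, a.1.1 (t • z) z).1 = ∫ t in (0:ℝ)..1, fst (a.1.1 (t • z) z) := this.symm
    rw [e2, ← intervalIntegral.integral_smul]
    rfl
  let W : ℂ → E := fun z => ∫ ζ, kap J0 ζ (χ (z - ζ) • b.1.1 (z - ζ))
  have hweq : ∀ z, w z = v + η • (W z - W 0) := by
    intro z
    have h0 : ((T a).1.1 z).2 = 0 := by
      rw [hT]
      have ci : Continuous fun t : ℝ => a.1.1 (t • z) z := by fun_prop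
      have := snd.intervalIntegral_comp_comm (ci.intervalIntegrable (μ := volume) 0 1)
      have e2 : (∫ t in (0:ℝ)..1, a.1.1 (t • z) z).2 = ∫ t in (0:ℝ)..1, snd (a.1.1 (t • z) z) := this.symm
      rw [Prod.smul_snd, e2]
      simp [ha, kA, snd]
    have := congrArg Prod.snd (heq z)
    rw [hSb] at this
    simp only [Prod.snd_add, Prod.smul_snd, h0, smul_zero, add_zero] at this
    simpa [inr, W] using this
  have hdbar : ∀ z, ‖z‖ < 1 → w' z 1 + J0 (w' z Complex.I) = η • kq J0 P (u.1.1 z) := by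
    intro z hz
    obtain ⟨D, hD, hDe⟩ := dbar_conv J0 hJ0 g g' hg hg' (max M1 M2)
      (fun z => (hM1 z).trans (le_max_left _ _)) (fun z => (hM2 z).trans (le_max_right _ _)) hgs z hz
    have e1 : w' z = η • D := by
      have h1 : HasFDerivAt w (η • D) z := by
        have : w = fun z => v + η • (W z - W 0) := funext hweq
        rw [this]
        exact ((hD.sub_const (W 0)).const_smul η).const_add v
      exact (hw z).unique h1
    rw [e1, smul_apply, smul_apply, map_smul, ← smul_add, hDe]
    simp [g, hχ1 z hz.le, hb]
  -- closedness
  have hf'eq : ∀ z, ‖z‖ < 1 → f' z = ∫ t in (0:ℝ)..1, radD α α' z t := by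
    intro z hz
    have h1 := rad_hasFDerivAt α α' hα hα' _ hα1 hα2 z
    refine (hf z).unique (h1.congr_of_eventuallyEq ?_)
    filter_upwards [(isOpen_lt continuous_norm continuous_const).mem_nhds hz] with y hy
    exact hfeq y (le_of_lt hy)
  have hα'e : ∀ z h k, α' z h k =
      (η • fderiv ℝ P (f z)) (f' z h) (rho J0 k (w z)) + (η • P (f z)) (rho J0 k (w' z h)) := by
    intro z h k
    have h1 : HasFDerivAt (fun y => α y k) ((α' z).flip k) z := by
      have := (hα z).clm_apply (hasFDerivAt_const k z)
      refine this.congr_fderiv ?_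
      simp
    have h2 : HasFDerivAt (fun y => P (f y)) ((fderiv ℝ P (f z)).comp (f' z)) z :=
      ((hall (f z) (hfn z)).2.1.hasFDerivAt).comp z (hf z)
    have h3 : HasFDerivAt (fun y => rho J0 k (w y)) ((rho J0 k).comp (w' z)) z :=
      (rho J0 k).hasFDerivAt.comp z (hw z)
    have h4 := (h2.clm_apply h3).const_smul η
    have h5 : (fun y => α y k) = fun y => η • (P (f y)) (rho J0 k (w y)) := by
      funext y; rw [hαe]; rfl
    rw [h5] at h1
    have h6 := congrArg (fun T : ℂ →L[ℝ] E => T h) (h1.unique h4)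
    simp only [ContinuousLinearMap.flip_apply] at h6
    rw [h6]
    simp [add_comm]
  have hfα : ∀ z, ‖z‖ < 1 → f' z = α z := by
    refine rad_closed α α' hα hα' _ hα1 hα2 f' hf'eq fun z hz h k => ?_
    rw [hα'e, hα'e]
    obtain ⟨hU, hdiff, hsm⟩ := hall (f z) (hfn z)
    have hq := kq_curl J0 hJ0 P (u.1.1 z) hU η (w' z) (hdbar z hz)
    have := curl_bound J0 (η • P (f z)) (η • fderiv ℝ P (f z)) (w z) (w' z) (f' z) hq h k
    refine this.trans ?_
    have e1 : (η • P (f z)).comp ((rho J0).flip (w z)) = α z := by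
      rw [hαe]; rfl
    rw [e1]
    gcongr
    exact curl_coeff _ _ _ _ _ hη.le hη1 (rho J0).opNorm_nonneg (hwn z) hsm
  refine ⟨f, w, ?_, ?_, fun z hz => ⟨(hfn z).trans hδδ, ?_⟩⟩
  · rw [hfeq 0 (by simp)]; simp
  · rw [hweq 0]; simp
  · rw [← hαe, ← hfα z hz]; exact hf z
end KRAux6

section KRAux7
variable {E : Type*} [NormedAddCommGroup E] [NormedSpace ℝ E]

lemma disc_exists_s5 [CompleteSpace E] (Ω : Set E) (hΩ : IsOpen Ω) (J : E → E →L[ℝ] E)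
    (hJ : ContDiffOn ℝ (⊤ : ℕ∞) J Ω) (hJ2 : ∀ x ∈ Ω, ∀ y, J x (J x y) = -y)
    (p : E) (hp : p ∈ Ω) (v : E) :
    ∃ r : ℝ, 0 < r ∧ ∃ (f : ℂ → E) (f' : ℂ → ℂ →L[ℝ] E), f 0 = p ∧ f' 0 1 = r • v ∧
      ∀ z, ‖z‖ < 1 → f z ∈ Ω ∧ HasFDerivAt f (f' z) z ∧
        ∀ ξ, f' z (Complex.I * ξ) = J (f z) (f' z ξ) := by
  set J0 := J p with hJ0d
  have hJ0 : ∀ x, J0 (J0 x) = -x := hJ2 p hp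
  let P : E → E →L[ℝ] E := fun x => J (p + x) + J0
  have hP : ContDiffAt ℝ 3 P 0 := by
    have h1 : ContDiffAt ℝ 3 J (p + 0) := by
      rw [add_zero]
      exact (hJ.contDiffAt (hΩ.mem_nhds hp)).of_le (by
        have : ((3 : ℕ∞) : WithTop ℕ∞) ≤ ((⊤ : ℕ∞) : WithTop ℕ∞) := WithTop.coe_le_coe.2 le_top
        exact this)
    have h2 : ContDiffAt ℝ 3 (fun x : E => p + x) 0 := contDiffAt_const.add contDiffAt_id
    exact (ContDiffAt.comp (0:E) h1 h2).add contDiffAt_const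
  have hP0 : P 0 = (2:ℝ) • J0 := by
    simp only [P, add_zero, ← hJ0d]; module
  have hu : IsUnit (P 0) := by
    rw [hP0]
    refine ⟨⟨(2:ℝ) • J0, -(2:ℝ)⁻¹ • J0, ?_, ?_⟩, rfl⟩
    · refine ContinuousLinearMap.ext fun x => ?_
      simp [hJ0, smul_smul]
    · refine ContinuousLinearMap.ext fun x => ?_
      simp [hJ0, smul_smul]
  obtain ⟨δ, hδ, hball⟩ := Metric.nhds_basis_closedBall.mem_iff.1 (hΩ.mem_nhds hp)
  obtain ⟨η, hη, ε, hε, hmain⟩ := kr_core J0 hJ0 P hP hu δ hδ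
  set s := ε / (‖J0 v‖ + 1) with hs
  have hs0 : 0 < s := by positivity
  obtain ⟨f, w, hf0, hw0, hfw⟩ := hmain (-(s • J0 v)) (by
    rw [norm_neg, norm_smul, Real.norm_of_nonneg hs0.le, hs, div_mul_eq_mul_div,
      div_le_iff₀ (by positivity)]
    nlinarith [norm_nonneg (J0 v)])
  refine ⟨2 * η * s, by positivity, fun z => p + f z,
    fun z => η • (P (f z)).comp ((rho J0).flip (w z)), by simp [hf0], ?_, fun z hz => ?_⟩
  · simp only [hf0, hw0, hP0]
    simp [rho_apply, hJ0, smul_smul]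
    module
  · obtain ⟨h1, h2⟩ := hfw z hz
    have hmem : p + f z ∈ Ω := hball (by simpa [mem_closedBall_iff_norm] using h1)
    refine ⟨hmem, h2.const_add p, fun ξ => ?_⟩
    have hr : rho J0 (Complex.I * ξ) (w z) = J0 (rho J0 ξ (w z)) := by
      simp [rho_apply, hJ0]; abel
    simp only [smul_apply, ContinuousLinearMap.comp_apply, ContinuousLinearMap.flip_apply, map_smul, hr]
    congr 1
    simp only [P, add_apply, map_add, hJ0, hJ2 _ hmem]
    abel
end KRAux7


/-- through every point and in every direction there is a `J`-holomorphic
disc; consequently the Kobayashi–Royden pseudonorm is finite. -/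
theorem kobayashiRoyden_finite
    (n : ℕ) (hn : 1 ≤ n) (Ω : Set (Cn n)) (hΩ : IsOpen Ω) (hne : Ω.Nonempty)
    (J : Cn n → (Cn n →L[ℝ] Cn n)) (hJ : IsAlmostComplexOn n Ω J)
    (p : Cn n) (hp : p ∈ Ω) (v : Cn n) :
    (∃ r : ℝ, 0 < r ∧ ∃ f : ℂ → Cn n, IsJHolomorphicOn n Ω J 1 f ∧ f 0 = p ∧
      fderiv ℝ f 0 1 = r • v) ∧
    kobayashiRoyden n Ω J p v < ⊤ := by
  have key : ∃ r : ℝ, 0 < r ∧ ∃ f : ℂ → Cn n, IsJHolomorphicOn n Ω J 1 f ∧ f 0 = p ∧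
      fderiv ℝ f 0 1 = r • v := by
    obtain ⟨r, hr, f, f', hf0, hf1, hf⟩ := disc_exists_s5 Ω hΩ J hJ.1
      (fun x hx y => by
        have := congrArg (fun T : Cn n →L[ℝ] Cn n => T y) (hJ.2 x hx)
        simpa using this) p hp v
    refine ⟨r, hr, f, ⟨fun z hz => (hf z (by simpa using hz)).1, fun z hz => ?_⟩, hf0, ?_⟩
    · obtain ⟨-, h2, h3⟩ := hf z (by simpa using hz)
      exact ⟨h2.differentiableAt, fun ξ => by rw [h2.fderiv]; exact h3 ξ⟩
    · rw [(hf 0 (by simp)).2.1.fderiv]; exact hf1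
  refine ⟨key, ?_⟩
  obtain ⟨r, hr, hf⟩ := key
  exact lt_of_le_of_lt (sInf_le ⟨r, hr, hf, rfl⟩) ENNReal.ofReal_lt_top
end
end
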